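/- Let W be a finitely generated infinite irreducible Coxeter group that is not virtually abelian (for finitely generated infinite irreducible Coxeter groups this is equivalent to being non-affine). Then every commensurating endomorphism φ : W →* W is an inner automorphism of W: there exists w ∈ W with φ(g) = w * g * w⁻¹ for all g ∈ W. -/

import Mathlib

/-- `g` and `h` are commensurable in `G`: some nonzero power of `g` is conjugate
to a nonzero power of `h`. -/
def CommElem {G : Type*} [Group G] (g h : G) : Prop :=
  ∃ (z : G) (m n : ℤ), m ≠ 0 ∧ n ≠ 0 ∧ g ^ n = z * h ^ m * z⁻¹

/-- A Coxeter matrix `M` on the index set `B` is irreducible if `B` cannot be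
partitioned into two nonempty subsets `A` and `Aᶜ` with `M a b = 2` for all
`a ∈ A`, `b ∈ Aᶜ`. -/
def CoxeterIrreducible {B : Type*} (M : CoxeterMatrix B) : Prop :=
  ¬ ∃ A : Set B, A.Nonempty ∧ Aᶜ.Nonempty ∧ ∀ a ∈ A, ∀ b ∈ Aᶜ, M a b = 2

namespace CoxeterTits

open Real

section Dihedral

variable {V : Type*} [AddCommGroup V] [Module ℝ V]

/-- The endomorphism `x ↦ x - 2 b(x, a) a`. -/
noncomputable def reflEnd (b : LinearMap.BilinForm ℝ V) (a : V) : Module.End ℝ V :=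
  1 - (2 : ℝ) • (b.flip a).smulRight a

theorem reflEnd_apply (b : LinearMap.BilinForm ℝ V) (a x : V) :
    reflEnd b a x = x - (2 * b x a) • a := by
  simp [reflEnd, mul_smul]

theorem reflEnd_mul_self {b : LinearMap.BilinForm ℝ V} {a : V} (ha : b a a = 1) :
    reflEnd b a * reflEnd b a = 1 := by
  ext x
  simp only [Module.End.mul_apply, reflEnd_apply, Module.End.one_apply, map_sub, map_smul,
    LinearMap.sub_apply, LinearMap.smul_apply, smul_eq_mul, ha]
  module

theorem reflEnd_isometry {b : LinearMap.BilinForm ℝ V} (hs : ∀ x y, b x y = b y x) {a : V}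
    (ha : b a a = 1) (x y : V) : b (reflEnd b a x) (reflEnd b a y) = b x y := by
  simp only [reflEnd_apply, map_sub, map_smul, LinearMap.sub_apply, LinearMap.smul_apply,
    smul_eq_mul, ha, hs a y]
  ring

/-- The Chebyshev-type sequence `sin (n θ) / sin θ`, extended continuously to all `θ`. -/
noncomputable def sinQuot (θ : ℝ) : ℕ → ℝ
  | 0 => 0
  | 1 => 1
  | n + 2 => 2 * cos θ * sinQuot θ (n + 1) - sinQuot θ n

theorem sinQuot_add_two (θ : ℝ) (n : ℕ) :
    sinQuot θ (n + 2) = 2 * cos θ * sinQuot θ (n + 1) - sinQuot θ n := rfl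

theorem sin_mul_sinQuot (θ : ℝ) (n : ℕ) :
    sin θ * sinQuot θ n = sin (n * θ) ∧ sin θ * sinQuot θ (n + 1) = sin ((n + 1) * θ) := by
  induction n with
  | zero => simp [sinQuot]
  | succ n ih =>
    refine ⟨by simpa using ih.2, ?_⟩
    rw [sinQuot_add_two, mul_sub, ih.1, mul_left_comm, ih.2]
    have e1 : ((n + 1 : ℕ) + 1 : ℝ) * θ = (n + 1) * θ + θ := by push_cast; ring
    have e2 : (n : ℝ) * θ = (n + 1) * θ - θ := by ring
    rw [e1, e2, sin_add, sin_sub]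
    ring

theorem sinQuot_zero (n : ℕ) : sinQuot 0 n = n ∧ sinQuot 0 (n + 1) = n + 1 := by
  induction n with
  | zero => simp [sinQuot]
  | succ n ih =>
    refine ⟨by simpa using ih.2, ?_⟩
    rw [sinQuot_add_two, ih.1, ih.2, cos_zero]
    push_cast
    ring

theorem sinQuot_nonneg {m k : ℕ} (hm : m ≠ 1) (hk : m ≠ 0 → k ≤ m) : 0 ≤ sinQuot (π / m) k := by
  rcases eq_or_ne m 0 with rfl | h0
  · simp [(sinQuot_zero k).1]
  · have hm2 : (2 : ℝ) ≤ m := by exact_mod_cast (show 2 ≤ m by omega)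
    have hpos : 0 < sin (π / m) := by
      apply sin_pos_of_pos_of_lt_pi
      · positivity
      · rw [div_lt_iff₀ (by positivity)]
        nlinarith [pi_pos]
    have h := (sin_mul_sinQuot (π / m) k).1
    have h2 : 0 ≤ sin (k * (π / m)) := by
      apply sin_nonneg_of_nonneg_of_le_pi
      · positivity
      · have : (k : ℝ) ≤ m := by exact_mod_cast hk h0
        rw [mul_div_assoc', div_le_iff₀ (by positivity)]
        nlinarith [pi_pos]
    rw [← h] at h2
    exact nonneg_of_mul_nonneg_right h2 hpos

variable {b : LinearMap.BilinForm ℝ V} {a c : V} {θ : ℝ}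

theorem reflEnd_mul_pow_left (haa : b a a = 1) (hcc : b c c = 1) (hac : b a c = -cos θ)
    (hca : b c a = -cos θ) (k : ℕ) :
    ((reflEnd b a * reflEnd b c) ^ k) a = sinQuot θ (2 * k + 1) • a + sinQuot θ (2 * k) • c := by
  induction k with
  | zero => simp [sinQuot]
  | succ k ih =>
    rw [pow_succ', Module.End.mul_apply, ih, show 2 * (k + 1) + 1 = (2 * k + 1) + 2 by ring,
      show 2 * (k + 1) = 2 * k + 2 by ring, sinQuot_add_two, sinQuot_add_two]
    simp only [Module.End.mul_apply, reflEnd_apply, map_sub, map_add, map_smul,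
      LinearMap.sub_apply, LinearMap.add_apply, LinearMap.smul_apply, smul_eq_mul, haa, hcc, hac,
      hca, show 2 * k + 1 + 1 = 2 * k + 2 by ring, sinQuot_add_two]
    module

theorem reflEnd_mul_pow_right (haa : b a a = 1) (hcc : b c c = 1) (hac : b a c = -cos θ)
    (hca : b c a = -cos θ) (k : ℕ) :
    ((reflEnd b a * reflEnd b c) ^ (k + 1)) c =
      -sinQuot θ (2 * k + 2) • a - sinQuot θ (2 * k + 1) • c := by
  induction k with
  | zero =>
    simp only [zero_add, pow_one, Module.End.mul_apply, reflEnd_apply, map_sub, map_smul,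
      LinearMap.sub_apply, LinearMap.smul_apply, smul_eq_mul, hcc, hac, hca, sinQuot, mul_zero]
    module
  | succ k ih =>
    rw [pow_succ', Module.End.mul_apply, ih, show 2 * (k + 1) + 2 = (2 * k + 2) + 2 by ring,
      show 2 * (k + 1) + 1 = 2 * k + 1 + 2 by ring, sinQuot_add_two, sinQuot_add_two]
    simp only [Module.End.mul_apply, reflEnd_apply, map_sub, map_add, map_smul,
      LinearMap.sub_apply, LinearMap.add_apply, LinearMap.smul_apply, smul_eq_mul, haa, hcc, hac,
      hca, show 2 * k + 2 + 1 = 2 * k + 1 + 2 by ring, sinQuot_add_two]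
    module

theorem reflEnd_mul_pow_eq_one {m : ℕ} (hm : m ≠ 1) (hm0 : m ≠ 0) (haa : b a a = 1)
    (hcc : b c c = 1) (hac : b a c = -cos (π / m)) (hca : b c a = -cos (π / m)) :
    (reflEnd b a * reflEnd b c) ^ m = 1 := by
  set θ : ℝ := π / m with hθ
  have hm2 : (2 : ℝ) ≤ m := by exact_mod_cast (show 2 ≤ m by omega)
  have hmθ : (m : ℝ) * θ = π := by rw [hθ]; field_simp
  have hpos : 0 < sin θ := by
    apply sin_pos_of_pos_of_lt_pi
    · positivity
    · rw [hθ, div_lt_iff₀ (by positivity)]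
      nlinarith [pi_pos]
  have hv : ∀ n : ℕ, ∀ y, sin (n * θ) = sin θ * y → sinQuot θ n = y := fun n y h =>
    mul_left_cancel₀ hpos.ne' (((sin_mul_sinQuot θ n).1).trans h)
  have h0 : sinQuot θ (2 * m) = 0 := hv _ _ (by
    rw [show ((2 * m : ℕ) : ℝ) * θ = 2 * π by push_cast; rw [mul_assoc, hmθ]]; simp)
  have h1 : sinQuot θ (2 * m + 1) = 1 := hv _ _ (by
    rw [show ((2 * m + 1 : ℕ) : ℝ) * θ = θ + 2 * π by
      push_cast; rw [add_mul, mul_assoc, hmθ]; ring]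
    simp)
  obtain ⟨l, rfl⟩ : ∃ l, m = l + 1 := ⟨m - 1, by omega⟩
  have h2 : sinQuot θ (2 * l + 1) = -1 := hv _ _ (by
    rw [show ((2 * l + 1 : ℕ) : ℝ) * θ = 2 * π - θ by
      rw [← hmθ]; push_cast; ring]
    simp [sin_two_pi_sub])
  set T := reflEnd b a * reflEnd b c with hT
  have ha : (T ^ (l + 1)) a = a := by
    rw [hT, reflEnd_mul_pow_left haa hcc hac hca, h0, h1]; simp
  have hc : (T ^ (l + 1)) c = c := by
    rw [hT, reflEnd_mul_pow_right haa hcc hac hca, h2, show 2 * l + 2 = 2 * (l + 1) by ring, h0]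
    simp
  have hfix : ∀ x, b x a = 0 → b x c = 0 → ∀ k, (T ^ k) x = x := by
    intro x hxa hxc k
    induction k with
    | zero => simp
    | succ k ih =>
      rw [pow_succ', Module.End.mul_apply, ih]
      simp [hT, Module.End.mul_apply, reflEnd_apply, hxa, hxc]
  have hsq : sin θ ^ 2 ≠ 0 := by positivity
  have hsc := sin_sq_add_cos_sq θ
  ext x
  set u := (b x a + b x c * cos θ) / sin θ ^ 2 with hu
  set v := (b x c + b x a * cos θ) / sin θ ^ 2 with hv'
  have hx : x = u • a + v • c + (x - u • a - v • c) := by module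
  have key := hfix (x - u • a - v • c) (by
      simp only [map_sub, map_smul, LinearMap.sub_apply, LinearMap.smul_apply, smul_eq_mul, haa,
        hca, hu, hv']
      field_simp
      linear_combination (b x a) * hsc) (by
      simp only [map_sub, map_smul, LinearMap.sub_apply, LinearMap.smul_apply, smul_eq_mul, hcc,
        hac, hu, hv']
      field_simp
      linear_combination (b x c) * hsc) (l + 1)
  rw [hx, map_add, map_add, map_smul, map_smul, key, ha, hc]
  simp

/-- The alternating product of `k` reflections, ending in the reflection in `c`. -/
noncomputable def altRefl (b : LinearMap.BilinForm ℝ V) (a c : V) : ℕ → Module.End ℝ V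
  | 0 => 1
  | k + 1 => (if Even k then reflEnd b c else reflEnd b a) * altRefl b a c k

theorem altRefl_apply (haa : b a a = 1) (hcc : b c c = 1) (hac : b a c = -cos θ)
    (hca : b c a = -cos θ) (k : ℕ) :
    altRefl b a c k a =
      if Even k then sinQuot θ (k + 1) • a + sinQuot θ k • c
      else sinQuot θ k • a + sinQuot θ (k + 1) • c := by
  induction k with
  | zero => simp [altRefl, sinQuot]
  | succ k ih =>
    rw [altRefl, Module.End.mul_apply, ih]
    rcases Nat.even_or_odd k with h | h
    · have h' : ¬ Even (k + 1) := by simpa [Nat.even_add_one] using h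
      simp only [h, h', if_true, if_false, reflEnd_apply, map_add, map_smul,
        LinearMap.add_apply, LinearMap.smul_apply, smul_eq_mul, hac, hcc, sinQuot_add_two]
      module
    · have h0 : ¬ Even k := by simpa using h
      have h' : Even (k + 1) := by simpa [Nat.even_add_one] using h
      simp only [h0, h', if_true, if_false, reflEnd_apply, map_add, map_smul,
        LinearMap.add_apply, LinearMap.smul_apply, smul_eq_mul, hca, haa, sinQuot_add_two]
      module

end Dihedral

end CoxeterTits

namespace CoxeterTits

open Real

section Length

variable {ι : Type*} {M : CoxeterMatrix ι} {W : Type*} [Group W] (cs : CoxeterSystem M W)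

/-- A non-identity element is the product of an element `v` and a dihedral element ending in a
given right descent, with additive lengths and neither dihedral generator a right descent of `v`. -/
theorem exists_eq_mul_alternatingWord {w : W} {j : ι} (hj : cs.IsRightDescent w j) {i : ι} :
    ∃ (v : W) (k : ℕ), 1 ≤ k ∧ w = v * cs.wordProd (CoxeterSystem.alternatingWord i j k) ∧
      cs.length w = cs.length v + k ∧ ¬ cs.IsRightDescent v i ∧ ¬ cs.IsRightDescent v j := by
  classical
  let p : ℕ → Prop := fun k => ∃ v, w = v * cs.wordProd (CoxeterSystem.alternatingWord i j k) ∧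
    cs.length w = cs.length v + k
  have hp1 : p 1 := ⟨w * cs.simple j, by simp [CoxeterSystem.alternatingWord],
    ((cs.isRightDescent_iff).1 hj).symm⟩
  have hle : ∀ k, p k → k ≤ cs.length w := by
    rintro k ⟨v, -, h⟩
    omega
  have hk1 : 1 ≤ Nat.findGreatest p (cs.length w) := Nat.le_findGreatest (hle 1 hp1) hp1
  have hpk : p (Nat.findGreatest p (cs.length w)) := Nat.findGreatest_spec (hle 1 hp1) hp1
  have hmax : ∀ k, p k → k ≤ Nat.findGreatest p (cs.length w) := fun k hk =>
    Nat.le_findGreatest (hle k hk) hk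
  generalize Nat.findGreatest p (cs.length w) = k at hk1 hpk hmax
  obtain ⟨v, hv, hl⟩ := hpk
  have hnext : ¬ cs.IsRightDescent v (if Even k then j else i) := by
    intro hd
    have h1 := (cs.isRightDescent_iff).1 hd
    have := hmax (k + 1) ⟨v * cs.simple (if Even k then j else i), by
      rw [CoxeterSystem.alternatingWord_succ', cs.wordProd_cons, hv]
      simp [mul_assoc], by omega⟩
    omega
  obtain ⟨l, rfl⟩ : ∃ l, k = l + 1 := ⟨k - 1, by omega⟩
  have hprev : ¬ cs.IsRightDescent v (if Even l then j else i) := by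
    intro hd
    have h1 := (cs.isRightDescent_iff).1 hd
    rw [CoxeterSystem.alternatingWord_succ', cs.wordProd_cons, ← mul_assoc] at hv
    have h2 := cs.length_mul_le (v * cs.simple (if Even l then j else i))
      (cs.wordProd (CoxeterSystem.alternatingWord i j l))
    rw [← hv] at h2
    have h3 := cs.length_wordProd_le (CoxeterSystem.alternatingWord i j l)
    rw [CoxeterSystem.length_alternatingWord] at h3
    omega
  refine ⟨v, l + 1, hk1, hv, hl, ?_⟩
  by_cases he : Even l
  · simp only [he, if_true, Nat.even_add_one, not_true_eq_false, if_false] at hnext hprev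
    exact ⟨hnext, hprev⟩
  · simp only [he, if_true, Nat.even_add_one, not_false_eq_true, if_false] at hnext hprev
    exact ⟨hprev, hnext⟩

end Length

section Rep

variable {ι : Type*} [Fintype ι] [DecidableEq ι]

/-- The bilinear form of the geometric representation of a Coxeter group. -/
noncomputable def form (M : CoxeterMatrix ι) : LinearMap.BilinForm ℝ (ι → ℝ) :=
  Matrix.toBilin' (Matrix.of fun i j => -cos (π / M i j))

/-- The simple roots. -/
abbrev simpleRoot (i : ι) : ι → ℝ := Pi.single i 1

theorem form_simpleRoot (M : CoxeterMatrix ι) (i j : ι) :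
    form M (simpleRoot i) (simpleRoot j) = -cos (π / M i j) := by
  simp [form, Matrix.toBilin'_single]

theorem form_simpleRoot_self (M : CoxeterMatrix ι) (i : ι) :
    form M (simpleRoot i) (simpleRoot i) = 1 := by
  simp [form_simpleRoot]

theorem eq_sum_simpleRoot (x : ι → ℝ) : x = ∑ i, x i • simpleRoot i := by
  ext j
  simp [Finset.sum_apply, Pi.single_apply]

theorem form_comm (M : CoxeterMatrix ι) (x y : ι → ℝ) : form M x y = form M y x := by
  simp only [form, Matrix.toBilin'_apply, Matrix.of_apply]
  rw [Finset.sum_comm]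
  refine Finset.sum_congr rfl fun i _ => Finset.sum_congr rfl fun j _ => ?_
  rw [M.symmetric]
  ring

theorem form_eq_sum (M : CoxeterMatrix ι) (x y : ι → ℝ) :
    form M x y = ∑ i, y i * form M x (simpleRoot i) := by
  conv_lhs => rw [eq_sum_simpleRoot y]
  simp [map_sum]

theorem form_nonpos_of_ne {M : CoxeterMatrix ι} {i j : ι} (h : i ≠ j) :
    form M (simpleRoot i) (simpleRoot j) ≤ 0 := by
  rw [form_simpleRoot, neg_nonpos]
  rcases eq_or_ne (M i j) 0 with h0 | h0
  · simp [h0]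
  · have h1 := M.off_diagonal i j h
    have : (2 : ℝ) ≤ M i j := by exact_mod_cast (show 2 ≤ M i j by omega)
    apply cos_nonneg_of_neg_pi_div_two_le_of_le
    · have : 0 ≤ π / M i j := by positivity
      linarith [pi_pos]
    · exact div_le_div_of_nonneg_left pi_pos.le (by norm_num) this

theorem form_neg_of_ne_two {M : CoxeterMatrix ι} {i j : ι} (h : i ≠ j) (h2 : M i j ≠ 2) :
    form M (simpleRoot i) (simpleRoot j) < 0 := by
  rw [form_simpleRoot, neg_lt_zero]
  rcases eq_or_ne (M i j) 0 with h0 | h0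
  · simp [h0]
  · have h1 := M.off_diagonal i j h
    have : (2 : ℝ) < M i j := by exact_mod_cast (show 2 < M i j by omega)
    apply cos_pos_of_mem_Ioo ⟨?_, ?_⟩
    · have : 0 ≤ π / M i j := by positivity
      linarith [pi_pos]
    · exact div_lt_div_of_pos_left pi_pos (by norm_num) this

theorem isLiftable_reflEnd (M : CoxeterMatrix ι) :
    M.IsLiftable fun i => reflEnd (form M) (simpleRoot i) := by
  intro i j
  rcases eq_or_ne i j with rfl | hij
  · simp [reflEnd_mul_self (form_simpleRoot_self M i)]
  · rcases eq_or_ne (M i j) 0 with h0 | h0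
    · simp [h0]
    · exact reflEnd_mul_pow_eq_one (M.off_diagonal i j hij) h0 (form_simpleRoot_self M i)
        (form_simpleRoot_self M j) (form_simpleRoot M i j)
        (by rw [form_comm, form_simpleRoot])

variable {M : CoxeterMatrix ι} {W : Type*} [Group W] (cs : CoxeterSystem M W)

/-- The geometric representation of a Coxeter group. -/
noncomputable def rep : W →* Module.End ℝ (ι → ℝ) := cs.lift ⟨_, isLiftable_reflEnd M⟩

theorem rep_simple (i : ι) : rep cs (cs.simple i) = reflEnd (form M) (simpleRoot i) :=
  cs.lift_apply_simple (isLiftable_reflEnd M) i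

theorem rep_simple_apply (i : ι) (x : ι → ℝ) :
    rep cs (cs.simple i) x = x - (2 * form M x (simpleRoot i)) • simpleRoot i := by
  rw [rep_simple, reflEnd_apply]

theorem rep_simple_self (i : ι) : rep cs (cs.simple i) (simpleRoot i) = -simpleRoot i := by
  rw [rep_simple_apply, form_simpleRoot_self]
  module

theorem rep_mul_apply (u w : W) (x : ι → ℝ) : rep cs (u * w) x = rep cs u (rep cs w x) := by
  rw [map_mul, Module.End.mul_apply]

theorem rep_inv_apply_self (w : W) (x : ι → ℝ) : rep cs w⁻¹ (rep cs w x) = x := by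
  rw [← rep_mul_apply]; simp

theorem rep_apply_inv_self (w : W) (x : ι → ℝ) : rep cs w (rep cs w⁻¹ x) = x := by
  rw [← rep_mul_apply]; simp

theorem form_rep (w : W) (x y : ι → ℝ) : form M (rep cs w x) (rep cs w y) = form M x y := by
  induction w using cs.simple_induction_left generalizing x y with
  | one => simp
  | mul_simple_left w i ih =>
    rw [rep_mul_apply, rep_mul_apply, rep_simple,
      reflEnd_isometry (form_comm M) (form_simpleRoot_self M i), ih]

theorem rep_wordProd_alternatingWord (i j : ι) (k : ℕ) :
    rep cs (cs.wordProd (CoxeterSystem.alternatingWord i j k)) =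
      altRefl (form M) (simpleRoot i) (simpleRoot j) k := by
  induction k with
  | zero => simp [altRefl, CoxeterSystem.alternatingWord]
  | succ k ih =>
    rw [CoxeterSystem.alternatingWord_succ', cs.wordProd_cons, map_mul, ih, altRefl]
    split_ifs <;> rw [rep_simple]

theorem rep_simpleRoot_nonneg {w : W} {i : ι} (h : ¬ cs.IsRightDescent w i) :
    0 ≤ rep cs w (simpleRoot i) := by
  induction hn : cs.length w using Nat.strong_induction_on generalizing w i with
  | _ n ih =>
    rcases eq_or_ne w 1 with rfl | hw
    · simp
    obtain ⟨j, hj⟩ := cs.exists_rightDescent_of_ne_one hw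
    have hij : i ≠ j := by rintro rfl; exact h hj
    obtain ⟨v, k, hk1, hwv, hl, hvi, hvj⟩ := exists_eq_mul_alternatingWord cs hj (i := i)
    have hi := ih (cs.length v) (by omega) hvi rfl
    have hj' := ih (cs.length v) (by omega) hvj rfl
    have hkm : M i j ≠ 0 → k + 1 ≤ M i j := by
      intro hM
      have h2 := cs.length_mul_le v (cs.wordProd (CoxeterSystem.alternatingWord i j k))
      rw [← hwv, hl] at h2
      by_contra! hcon
      rcases (show k = M i j ∨ k > M i j by omega) with hk | hk
      · obtain ⟨l, rfl⟩ : ∃ l, k = l + 1 := ⟨k - 1, by omega⟩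
        have hbraid : cs.wordProd (CoxeterSystem.alternatingWord i j (l + 1)) =
            cs.wordProd (CoxeterSystem.alternatingWord i j l) * cs.simple i := by
          have := cs.wordProd_braidWord_eq i j
          rw [CoxeterSystem.braidWord, CoxeterSystem.braidWord, M.symmetric j i, ← hk] at this
          rw [this, CoxeterSystem.alternatingWord_succ, List.concat_eq_append, cs.wordProd_append]
          simp
        rw [hbraid] at hwv
        have h3 := cs.length_mul_le v (cs.wordProd (CoxeterSystem.alternatingWord i j l))
        have h4 := cs.length_wordProd_le (CoxeterSystem.alternatingWord i j l)
        rw [CoxeterSystem.length_alternatingWord] at h4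
        have h5 : w * cs.simple i = v * cs.wordProd (CoxeterSystem.alternatingWord i j l) := by
          rw [hwv]; simp [mul_assoc]
        apply h
        rw [CoxeterSystem.IsRightDescent, h5]
        omega
      · have h3 := cs.not_isReduced_alternatingWord i j hM hk
        have h4 := cs.length_wordProd_le (CoxeterSystem.alternatingWord i j k)
        rw [CoxeterSystem.IsReduced] at h3
        rw [CoxeterSystem.length_alternatingWord] at h3 h4
        omega
    have hm1 := M.off_diagonal i j hij
    have ha : 0 ≤ sinQuot (π / M i j) k := sinQuot_nonneg hm1 fun h0 => by have := hkm h0; omega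
    have hb : 0 ≤ sinQuot (π / M i j) (k + 1) := sinQuot_nonneg hm1 hkm
    rw [hwv, rep_mul_apply, rep_wordProd_alternatingWord,
      altRefl_apply (form_simpleRoot_self M i) (form_simpleRoot_self M j) (form_simpleRoot M i j)
        (by rw [form_comm, form_simpleRoot])]
    split_ifs <;> rw [map_add, map_smul, map_smul] <;>
      exact add_nonneg (smul_nonneg (by assumption) hi) (smul_nonneg (by assumption) hj')

theorem rep_simpleRoot_nonpos {w : W} {i : ι} (h : cs.IsRightDescent w i) :
    rep cs w (simpleRoot i) ≤ 0 := by
  have h1 : ¬ cs.IsRightDescent (w * cs.simple i) i :=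
    (cs.isRightDescent_iff_not_isRightDescent_mul).1 h
  have h2 := rep_simpleRoot_nonneg cs h1
  rw [rep_mul_apply, rep_simple_self, map_neg] at h2
  exact neg_nonneg.1 h2

/-- The root system of a Coxeter group. -/
def roots : Set (ι → ℝ) := {β | ∃ w i, β = rep cs w (simpleRoot i)}

variable {cs}

theorem simpleRoot_mem_roots (i : ι) : simpleRoot i ∈ roots cs := ⟨1, i, by simp⟩

theorem rep_mem_roots {β : ι → ℝ} (h : β ∈ roots cs) (w : W) : rep cs w β ∈ roots cs := by
  obtain ⟨u, i, rfl⟩ := h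
  exact ⟨w * u, i, (rep_mul_apply cs w u _).symm⟩

theorem neg_mem_roots {β : ι → ℝ} (h : β ∈ roots cs) : -β ∈ roots cs := by
  obtain ⟨u, i, rfl⟩ := h
  exact ⟨u * cs.simple i, i, by rw [rep_mul_apply, rep_simple_self, map_neg]⟩

theorem form_root_self {β : ι → ℝ} (h : β ∈ roots cs) : form M β β = 1 := by
  obtain ⟨u, i, rfl⟩ := h
  rw [form_rep, form_simpleRoot_self]

theorem root_ne_zero {β : ι → ℝ} (h : β ∈ roots cs) : β ≠ 0 := by
  rintro rfl
  simpa using form_root_self h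

theorem root_nonneg_or_nonpos {β : ι → ℝ} (h : β ∈ roots cs) : 0 ≤ β ∨ β ≤ 0 := by
  obtain ⟨u, i, rfl⟩ := h
  by_cases hd : cs.IsRightDescent u i
  · exact Or.inr (rep_simpleRoot_nonpos cs hd)
  · exact Or.inl (rep_simpleRoot_nonneg cs hd)

theorem exists_rep_simpleRoot_nonpos {w : W} (h : w ≠ 1) : ∃ i, rep cs w (simpleRoot i) ≤ 0 :=
  (cs.exists_rightDescent_of_ne_one h).imp fun _ hi => rep_simpleRoot_nonpos cs hi

theorem eq_one_of_forall_pos {w : W} (h : ∀ i, 0 < rep cs w (simpleRoot i) i) : w = 1 := by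
  by_contra hw
  obtain ⟨i, hi⟩ := exists_rep_simpleRoot_nonpos (cs := cs) hw
  exact (h i).not_ge (hi i)

theorem eq_one_of_forall_rep_simpleRoot {w : W} (h : ∀ i, rep cs w (simpleRoot i) = simpleRoot i) :
    w = 1 :=
  eq_one_of_forall_pos (cs := cs) fun i => by simp [h]

theorem exists_reflection {β : ι → ℝ} (h : β ∈ roots cs) :
    ∃ t : W, ∀ x, rep cs t x = x - (2 * form M x β) • β := by
  obtain ⟨u, i, rfl⟩ := h
  refine ⟨u * cs.simple i * u⁻¹, fun x => ?_⟩
  rw [rep_mul_apply, rep_mul_apply, rep_simple_apply, map_sub, map_smul, rep_apply_inv_self]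
  congr 3
  rw [← form_rep cs u, rep_apply_inv_self]

theorem eq_of_rep_eq {u w : W} (h : ∀ x, rep cs u x = rep cs w x) : u = w := by
  have : w⁻¹ * u = 1 := eq_one_of_forall_rep_simpleRoot (cs := cs) fun i => by
    rw [rep_mul_apply, h, rep_inv_apply_self]
  rw [inv_mul_eq_one] at this
  exact this.symm

/-- A simple reflection changes only one coordinate, and hence maps a positive root which is not
the simple root to a positive root. -/
theorem rep_simple_nonneg {β : ι → ℝ} (h : β ∈ roots cs) (h0 : 0 ≤ β) {i j : ι} (hij : j ≠ i)
    (hj : 0 < β j) : 0 ≤ rep cs (cs.simple i) β := by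
  refine (root_nonneg_or_nonpos (rep_mem_roots h _)).resolve_right fun hle => ?_
  have := hle j
  rw [rep_simple_apply] at this
  simp [hij] at this
  linarith

theorem eq_simpleRoot_of_forall {β : ι → ℝ} (h : β ∈ roots cs) (h0 : 0 ≤ β) {i : ι}
    (hj : ∀ j, j ≠ i → β j ≤ 0) : β = simpleRoot i := by
  have h1 : β = β i • simpleRoot i := by
    ext j
    rcases eq_or_ne j i with rfl | hji
    · simp
    · simpa [hji] using le_antisymm (hj j hji) (h0 j)
  have h2 := form_root_self h
  rw [h1] at h2
  simp only [map_smul, LinearMap.smul_apply, smul_eq_mul, form_simpleRoot_self] at h2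
  have h3 : β i = 1 := by
    have : 0 ≤ β i := h0 i
    nlinarith
  rw [h1, h3, one_smul]

theorem rep_simple_nonneg_of_ne {β : ι → ℝ} (h : β ∈ roots cs) (h0 : 0 ≤ β) {i : ι}
    (hne : β ≠ simpleRoot i) : 0 ≤ rep cs (cs.simple i) β := by
  by_contra hc
  refine hne (eq_simpleRoot_of_forall h h0 fun j hji => ?_)
  by_contra! hpos
  exact hc (rep_simple_nonneg h h0 hji hpos)

end Rep

end CoxeterTits

namespace CoxeterTits

open Filter Topology

section Ultralimit

/-- A fixed non-principal ultrafilter on `ℕ`. -/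
noncomputable abbrev UF : Filter ℕ := (hyperfilter ℕ : Filter ℕ)

theorem uf_le_atTop : UF ≤ atTop := Nat.hyperfilter_le_atTop

theorem uf_not {p : ℕ → Prop} : (¬ ∀ᶠ k in UF, p k) ↔ ∀ᶠ k in UF, ¬ p k :=
  Ultrafilter.eventually_not.symm

theorem uf_or {p q : ℕ → Prop} (h : ∀ᶠ k in UF, p k ∨ q k) :
    (∀ᶠ k in UF, p k) ∨ ∀ᶠ k in UF, q k :=
  Ultrafilter.eventually_or.1 h

theorem uf_exists_of_finite {α : Type*} {s : Set α} (hs : s.Finite) {p : α → ℕ → Prop}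
    (h : ∀ᶠ k in UF, ∃ a ∈ s, p a k) : ∃ a ∈ s, ∀ᶠ k in UF, p a k := by
  have := (Ultrafilter.finite_biUnion_mem_iff (f := hyperfilter ℕ) hs (s := fun a => {k | p a k})).1
    (by
      refine mem_of_superset h fun k hk => ?_
      obtain ⟨a, ha, hp⟩ := hk
      exact Set.mem_biUnion ha hp)
  exact this

theorem uf_eventually_eq_of_finite {α : Type*} {s : Set α} (hs : s.Finite) {f : ℕ → α}
    (h : ∀ᶠ k in UF, f k ∈ s) : ∃ a ∈ s, ∀ᶠ k in UF, f k = a :=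
  uf_exists_of_finite hs (p := fun a k => f k = a) (h.mono fun k hk => ⟨f k, hk, rfl⟩)

theorem uf_not_eventually_eq_of_injective {α : Type*} {f : ℕ → α} (hf : Function.Injective f)
    (a : α) : ¬ ∀ᶠ k in UF, f k = a := by
  intro h
  have hfin : {k | f k = a}.Finite :=
    Set.Subsingleton.finite fun x hx y hy => hf (hx.trans hy.symm)
  exact compl_notMem h (hyperfilter_le_cofinite hfin.compl_mem_cofinite)

theorem finite_of_forall_seq {α : Type*} {s : Set α}
    (h : ∀ f : ℕ → α, (∀ k, f k ∈ s) → ∃ a, ∀ᶠ k in UF, f k = a) : s.Finite := by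
  by_contra hs
  obtain ⟨a, ha⟩ := h (fun k => Set.Infinite.natEmbedding s hs k) (fun k => Subtype.coe_prop _)
  exact uf_not_eventually_eq_of_injective
    (Subtype.val_injective.comp (Set.Infinite.natEmbedding s hs).injective) a ha

theorem uf_exists_tendsto_of_isCompact {X : Type*} [TopologicalSpace X] {K : Set X}
    (hK : IsCompact K) {f : ℕ → X} (h : ∀ᶠ k in UF, f k ∈ K) :
    ∃ z ∈ K, Tendsto f UF (𝓝 z) := by
  obtain ⟨z, hz, hle⟩ := hK.ultrafilter_le_nhds ((hyperfilter ℕ).map f)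
    (by rw [Ultrafilter.coe_map]; exact tendsto_principal.2 h)
  exact ⟨z, hz, hle⟩

theorem uf_exists_tendsto_of_norm_le {V : Type*} [NormedAddCommGroup V] [ProperSpace V]
    {f : ℕ → V} {C : ℝ} (h : ∀ᶠ k in UF, ‖f k‖ ≤ C) : ∃ z, Tendsto f UF (𝓝 z) := by
  obtain ⟨z, -, hz⟩ := uf_exists_tendsto_of_isCompact (isCompact_closedBall (0 : V) C)
    (f := f) (by simpa using h)
  exact ⟨z, hz⟩

theorem uf_bddAbove_or_tendsto_atTop (f : ℕ → ℝ) :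
    (∃ C, ∀ᶠ k in UF, f k ≤ C) ∨ Tendsto f UF atTop := by
  by_cases h : ∃ C, ∀ᶠ k in UF, f k ≤ C
  · exact Or.inl h
  · push Not at h
    refine Or.inr (tendsto_atTop.2 fun C => ?_)
    exact (h C).mono fun k hk => hk.le

theorem uf_exists_tendsto_of_mem_Icc {f : ℕ → ℝ} {a b : ℝ}
    (h : ∀ᶠ k in UF, f k ∈ Set.Icc a b) : ∃ z ∈ Set.Icc a b, Tendsto f UF (𝓝 z) :=
  uf_exists_tendsto_of_isCompact isCompact_Icc h

variable {V : Type*} [NormedAddCommGroup V] [NormedSpace ℝ V] [FiniteDimensional ℝ V]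

theorem tendsto_bilin (b : LinearMap.BilinForm ℝ V) {α : Type*} {l : Filter α} {f g : α → V}
    {x y : V} (hf : Tendsto f l (𝓝 x)) (hg : Tendsto g l (𝓝 y)) :
    Tendsto (fun k => b (f k) (g k)) l (𝓝 (b x y)) := by
  have : Continuous fun p : V × V => LinearMap.toContinuousBilinearMap b p.1 p.2 := by fun_prop
  exact (this.tendsto (x, y)).comp (hf.prodMk_nhds hg)

theorem tendsto_linear {E : Type*} [AddCommGroup E] [Module ℝ E] [TopologicalSpace E]
    [IsTopologicalAddGroup E] [ContinuousSMul ℝ E] (T : V →ₗ[ℝ] E) {α : Type*}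
    {l : Filter α} {f : α → V} {x : V} (hf : Tendsto f l (𝓝 x)) :
    Tendsto (fun k => T (f k)) l (𝓝 (T x)) :=
  (T.continuous_of_finiteDimensional.tendsto x).comp hf

end Ultralimit

end CoxeterTits

namespace CoxeterTits

open Filter Topology

section Finiteness

variable {ι : Type*} [Fintype ι] [DecidableEq ι] {M : CoxeterMatrix ι} {W : Type*} [Group W]
  {cs : CoxeterSystem M W}

theorem finite_roots_norm_le (C : ℝ) : {β ∈ roots cs | ‖β‖ ≤ C}.Finite := by
  by_contra hinf
  have hinf : {β ∈ roots cs | ‖β‖ ≤ C}.Infinite := hinf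
  set f : ℕ → (ι → ℝ) := fun k => hinf.natEmbedding _ k with hf
  have hmem : ∀ k, f k ∈ roots cs ∧ ‖f k‖ ≤ C := fun k => Subtype.coe_prop (hinf.natEmbedding _ k)
  have hinj : Function.Injective f := Subtype.val_injective.comp (hinf.natEmbedding _).injective
  obtain ⟨z, hz⟩ := uf_exists_tendsto_of_norm_le (Eventually.of_forall fun k => (hmem k).2)
  have hzz : form M z z = 1 := by
    refine tendsto_nhds_unique (tendsto_bilin (form M) hz hz) ?_
    simp [form_root_self (hmem _).1]
  have hcont : ∀ i, Tendsto (fun p : (ι → ℝ) × (ι → ℝ) => (reflEnd (form M) p.1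
      (reflEnd (form M) p.2 (simpleRoot i))) i) (𝓝 (z, z)) (𝓝 1) := by
    intro i
    have h1 : (reflEnd (form M) z (reflEnd (form M) z (simpleRoot i))) i = 1 := by
      rw [← Module.End.mul_apply, reflEnd_mul_self hzz]
      simp
    rw [← h1]
    simp only [reflEnd_apply]
    have h2 : Tendsto (fun p : (ι → ℝ) × (ι → ℝ) => p.1) (𝓝 (z, z)) (𝓝 z) :=
      continuous_fst.tendsto (z, z) 
    have h3 : Tendsto (fun p : (ι → ℝ) × (ι → ℝ) => p.2) (𝓝 (z, z)) (𝓝 z) :=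
      continuous_snd.tendsto (z, z)
    have h4 : Tendsto (fun p : (ι → ℝ) × (ι → ℝ) =>
        simpleRoot i - (2 * form M (simpleRoot i) p.2) • p.2) (𝓝 (z, z))
        (𝓝 (simpleRoot i - (2 * form M (simpleRoot i) z) • z)) :=
      tendsto_const_nhds.sub (((tendsto_bilin _ tendsto_const_nhds h3).const_mul 2).smul h3)
    exact ((h4.sub (((tendsto_bilin _ h4 h2).const_mul 2).smul h2)).apply_nhds i)
  have hpos : ∀ᶠ p : (ι → ℝ) × (ι → ℝ) in 𝓝 (z, z), 0 < form M p.1 p.2 ∧ ∀ i,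
      0 < (reflEnd (form M) p.1 (reflEnd (form M) p.2 (simpleRoot i))) i := by
    refine Eventually.and ?_ (eventually_all.2 fun i => (hcont i).eventually_const_lt one_pos)
    exact (tendsto_bilin (form M) (continuous_fst.tendsto (z, z))
      (continuous_snd.tendsto (z, z))).eventually_const_lt
      (by rw [hzz]; exact one_pos)
  rw [nhds_prod_eq] at hpos
  obtain ⟨p, hp, q, hq, hpq⟩ := eventually_prod_iff.1 hpos
  have hev := (hz.eventually hp).and (hz.eventually hq)
  obtain ⟨l, hl, -⟩ := hev.exists
  refine uf_not_eventually_eq_of_injective hinj (f l) (hev.mono fun k hk => ?_)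
  obtain ⟨h1, h2⟩ := hpq hl hk.2
  obtain ⟨t, ht⟩ := exists_reflection (hmem l).1
  obtain ⟨u, hu⟩ := exists_reflection (hmem k).1
  have htu : t * u = 1 := eq_one_of_forall_pos (cs := cs) fun i => by
    have := h2 i
    rwa [reflEnd_apply, reflEnd_apply, ← hu, ← ht, ← rep_mul_apply] at this
  have h3 : rep cs (t * u) (f k) = f k := by simp [htu]
  rw [rep_mul_apply, hu, form_root_self (hmem k).1, ht] at h3
  have h4 : f k = (form M (f k) (f l)) • f l := by
    have : (2 : ℝ) • f k = (2 : ℝ) • ((form M (f k) (f l)) • f l) := by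
      simp only [map_sub, map_smul, LinearMap.sub_apply, LinearMap.smul_apply, smul_eq_mul] at h3
      linear_combination (norm := module) -h3
    exact smul_right_injective _ (two_ne_zero) this
  have h5 := form_root_self (hmem k).1
  rw [form_comm] at h1
  set c := form M (f k) (f l)
  rw [h4] at h5
  simp only [map_smul, LinearMap.smul_apply, smul_eq_mul, form_root_self (hmem l).1] at h5
  have : c = 1 := by nlinarith
  rw [h4, this, one_smul]

end Finiteness

end CoxeterTits

namespace CoxeterTits

open Filter Topology

section Perron

theorem apply_eq_zero_of_psd {V : Type*} [AddCommGroup V] [Module ℝ V]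
    {b : LinearMap.BilinForm ℝ V} (hs : ∀ x y, b x y = b y x) (hb : ∀ x, 0 ≤ b x x) {x : V}
    (hx : b x x = 0) (y : V) : b x y = 0 := by
  have h : ∀ t : ℝ, 0 ≤ 2 * t * b x y + t ^ 2 * b y y := fun t => by
    have := hb (x + t • y)
    simp only [map_add, map_smul, LinearMap.add_apply, LinearMap.smul_apply, smul_eq_mul, hx,
      hs y x] at this
    linarith
  by_contra hne
  have hyy := hb y
  have h1 := h (-(b x y) / (b y y + 1))
  have h2 : 2 * (-(b x y) / (b y y + 1)) * b x y + (-(b x y) / (b y y + 1)) ^ 2 * b y y =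
      -(b x y) ^ 2 * (b y y + 2) / (b y y + 1) ^ 2 := by
    field_simp
    ring
  rw [h2] at h1
  have : 0 < (b x y) ^ 2 := by positivity
  have h3 : -(b x y) ^ 2 * (b y y + 2) / (b y y + 1) ^ 2 < 0 := by
    apply div_neg_of_neg_of_pos <;> nlinarith
  linarith

variable {ι : Type*} [Fintype ι] [DecidableEq ι] {M : CoxeterMatrix ι}

theorem form_abs_le (x : ι → ℝ) : form M |x| |x| ≤ form M x x := by
  simp only [form, Matrix.toBilin'_apply, Matrix.of_apply]
  refine Finset.sum_le_sum fun i _ => Finset.sum_le_sum fun j _ => ?_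
  rcases eq_or_ne i j with rfl | hij
  · simp only [Pi.abs_apply]
    simp
  · have h := form_nonpos_of_ne (M := M) hij
    rw [form_simpleRoot] at h
    simp only [Pi.abs_apply]
    have : x i * x j ≤ |x i| * |x j| := by rw [← abs_mul]; exact le_abs_self _
    nlinarith

theorem forall_pos_of_irreducible (hirr : CoxeterIrreducible M) {v : ι → ℝ} (h0 : 0 ≤ v)
    (hne : v ≠ 0) (h : ∀ i, v i = 0 → 0 ≤ form M v (simpleRoot i)) (i : ι) : 0 < v i := by
  by_contra hi
  apply hirr
  have hi0 : v i = 0 := le_antisymm (not_lt.1 hi) (h0 i)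
  refine ⟨{i | v i = 0}, ⟨i, hi0⟩, ?_, fun a ha b hb => ?_⟩
  · obtain ⟨j, hj⟩ := Function.ne_iff.1 hne
    exact ⟨j, hj⟩
  · by_contra hab
    have hne' : a ≠ b := by rintro rfl; exact hb ha
    have h1 := h a ha
    rw [form_comm, form_eq_sum] at h1
    have h2 : ∑ j, v j * form M (simpleRoot a) (simpleRoot j) < 0 := by
      refine Finset.sum_neg' (fun j _ => ?_) ⟨b, Finset.mem_univ _, ?_⟩
      · rcases eq_or_ne a j with rfl | haj
        · simp [show v a = 0 from ha]
        · exact mul_nonpos_of_nonneg_of_nonpos (h0 j) (form_nonpos_of_ne haj)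
      · exact mul_neg_of_pos_of_neg (lt_of_le_of_ne (h0 b) (Ne.symm hb))
          (form_neg_of_ne_two hne' hab)
    linarith

/-- Perron–Frobenius for the Gram matrix of an irreducible Coxeter group: the lowest eigenvalue
has an eigenvector with positive coordinates. -/
theorem exists_perron [Nonempty ι] (hirr : CoxeterIrreducible M) :
    ∃ (μ : ℝ) (v : ι → ℝ), (∀ i, 0 < v i) ∧ (∀ i, form M v (simpleRoot i) = μ * v i) ∧
      ∀ x, μ * ∑ i, x i ^ 2 ≤ form M x x := by
  set S : Set (ι → ℝ) := {x | ∑ i, x i ^ 2 = 1} with hS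
  have hcomp : IsCompact S := by
    refine Metric.isCompact_of_isClosed_isBounded (isClosed_eq (by fun_prop) (by fun_prop)) ?_
    refine (Metric.isBounded_closedBall (x := (0 : ι → ℝ)) (r := 1)).subset fun x hx => ?_
    rw [mem_closedBall_zero_iff, pi_norm_le_iff_of_nonneg zero_le_one]
    intro i
    have : x i ^ 2 ≤ 1 := by
      rw [← show ∑ i, x i ^ 2 = 1 from hx]
      exact Finset.single_le_sum (f := fun i => x i ^ 2) (fun i _ => sq_nonneg _)
        (Finset.mem_univ i)
    rw [Real.norm_eq_abs]
    exact abs_le_one_iff_mul_self_le_one.2 (by nlinarith)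
  have hne : S.Nonempty := ⟨simpleRoot (Classical.arbitrary ι), by
    simp [hS, Pi.single_apply]⟩
  obtain ⟨x, hx, hmin⟩ := hcomp.exists_isMinOn hne (f := fun x => form M x x) (by
    apply Continuous.continuousOn
    exact continuous_iff_continuousAt.2 fun x => tendsto_bilin (form M) tendsto_id tendsto_id)
  set μ := form M x x with hμ
  have hmin' : ∀ y, μ * ∑ i, y i ^ 2 ≤ form M y y := by
    intro y
    rcases eq_or_ne (∑ i, y i ^ 2) 0 with h0 | h0
    · have : y = 0 := by
        ext i
        have := (Finset.sum_eq_zero_iff_of_nonneg fun i _ => sq_nonneg (y i)).1 h0 i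
          (Finset.mem_univ i)
        simpa using this
      simp [this]
    · have hpos : 0 < ∑ i, y i ^ 2 :=
        lt_of_le_of_ne (Finset.sum_nonneg fun i _ => sq_nonneg _) (Ne.symm h0)
      set r := Real.sqrt (∑ i, y i ^ 2) with hr
      have hr2 : r ^ 2 = ∑ i, y i ^ 2 := Real.sq_sqrt hpos.le
      have hr0 : 0 < r := Real.sqrt_pos.2 hpos
      have hmem : r⁻¹ • y ∈ S := by
        simp only [hS, Set.mem_ofPred_eq, Pi.smul_apply, smul_eq_mul, mul_pow, ← Finset.mul_sum,
          ← hr2]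
        field_simp
      have := hmin hmem
      simp only [Set.mem_ofPred_eq, map_smul, LinearMap.smul_apply, smul_eq_mul] at this
      rw [← hμ] at this
      rw [← hr2]
      calc μ * r ^ 2 ≤ (r⁻¹ * (r⁻¹ * form M y y)) * r ^ 2 := by gcongr
        _ = form M y y := by field_simp
  set q : LinearMap.BilinForm ℝ (ι → ℝ) := form M - μ • Matrix.toBilin' 1 with hq
  have hdot : ∀ x y : ι → ℝ, Matrix.toBilin' (1 : Matrix ι ι ℝ) x y = ∑ i, x i * y i := by
    intro x y
    simp [Matrix.toBilin'_apply', dotProduct]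
  have hqa : ∀ x y, q x y = form M x y - μ * ∑ i, x i * y i := fun x y => by
    simp [hq, hdot]
  have hvv : form M |x| |x| = μ * ∑ i, |x| i ^ 2 := by
    refine le_antisymm ?_ (hmin' _)
    have : ∑ i, |x| i ^ 2 = 1 := by simpa [hS] using hx
    rw [this, mul_one]
    exact form_abs_le x
  have hv : ∀ y, q |x| y = 0 := apply_eq_zero_of_psd
    (fun x y => by rw [hqa, hqa, form_comm]; simp only [mul_comm])
    (fun y => by
      rw [hqa, sub_nonneg]
      simpa [sq] using hmin' y)
    (by rw [hqa, hvv]; simp [sq])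
  have heig : ∀ i, form M |x| (simpleRoot i) = μ * |x| i := fun i => by
    have := hv (simpleRoot i)
    rw [hqa, sub_eq_zero] at this
    simpa [Pi.single_apply] using this
  refine ⟨μ, |x|, forall_pos_of_irreducible hirr (abs_nonneg x) ?_ fun i hi => ?_, heig, hmin'⟩
  · intro h
    have : x = 0 := funext fun i => abs_eq_zero.1 (congrFun h i)
    simp [hS, this] at hx
  · rw [heig, hi, mul_zero]

variable {W : Type*} [Group W] {cs : CoxeterSystem M W}

theorem finite_of_finite_roots (h : (roots cs).Finite) : Finite W := by
  have := h.to_subtype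
  refine Finite.of_injective (β := ι → roots cs)
    (fun w i => ⟨rep cs w (simpleRoot i), w, i, rfl⟩) fun u w huw => ?_
  refine eq_of_rep_eq (cs := cs) fun x => ?_
  have h1 : ∀ i, rep cs u (simpleRoot i) = rep cs w (simpleRoot i) := fun i =>
    congrArg Subtype.val (congrFun huw i)
  rw [eq_sum_simpleRoot x]
  simp [map_sum, h1]

theorem finite_of_bounded_roots {C : ℝ} (h : ∀ β ∈ roots cs, ‖β‖ ≤ C) : Finite W :=
  finite_of_finite_roots ((finite_roots_norm_le (cs := cs) C).subset fun β hβ => ⟨hβ, h β hβ⟩)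

end Perron

end CoxeterTits

namespace CoxeterTits

open Filter Topology

section Chamber

variable {ι : Type*} [Fintype ι] [DecidableEq ι] {M : CoxeterMatrix ι} {W : Type*} [Group W]
  {cs : CoxeterSystem M W}

theorem roots_seq_dichotomy {f : ℕ → ι → ℝ} (hf : ∀ k, f k ∈ roots cs) :
    (∃ a, ∀ᶠ k in UF, f k = a) ∨ (Tendsto (fun k => ‖f k‖) UF atTop ∧
      ∃ z : ι → ℝ, ‖z‖ = 1 ∧ Tendsto (fun k => ‖f k‖⁻¹ • f k) UF (𝓝 z)) := by
  rcases uf_bddAbove_or_tendsto_atTop fun k => ‖f k‖ with ⟨C, hC⟩ | h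
  · obtain ⟨a, -, ha⟩ := uf_eventually_eq_of_finite (finite_roots_norm_le (cs := cs) C)
      (hC.mono fun k hk => ⟨hf k, hk⟩)
    exact Or.inl ⟨a, ha⟩
  · have hn : ∀ k, ‖‖f k‖⁻¹ • f k‖ = 1 := fun k => by
      have := norm_ne_zero_iff.2 (root_ne_zero (hf k))
      rw [norm_smul, norm_inv, norm_norm, inv_mul_cancel₀ this]
    obtain ⟨z, hz⟩ := uf_exists_tendsto_of_norm_le (Eventually.of_forall fun k => (hn k).le)
    refine Or.inr ⟨h, z, tendsto_nhds_unique hz.norm ?_, hz⟩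
    simp [hn]

theorem form_self_of_tendsto {f : ℕ → ι → ℝ} (hf : ∀ k, f k ∈ roots cs) {c : ℕ → ℝ}
    (hc : Tendsto c UF (𝓝 0)) {z : ι → ℝ} (hz : Tendsto (fun k => c k • f k) UF (𝓝 z)) :
    form M z z = 0 := by
  refine tendsto_nhds_unique (tendsto_bilin (form M) hz hz) ?_
  simpa [form_root_self (hf _)] using hc.mul hc

theorem finite_of_no_limit {S : Set (ι → ℝ)} (hS : S ⊆ roots cs)
    (h : ∀ f : ℕ → ι → ℝ, (∀ k, f k ∈ S) → ∀ z : ι → ℝ, ‖z‖ = 1 → form M z z = 0 →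
      Tendsto (fun k => ‖f k‖⁻¹ • f k) UF (𝓝 z) → False) : S.Finite := by
  refine finite_of_forall_seq fun f hf => ?_
  rcases roots_seq_dichotomy fun k => hS (hf k) with h1 | ⟨h1, z, hz, hlim⟩
  · exact h1
  · exact (h f hf z hz (form_self_of_tendsto (fun k => hS (hf k)) h1.inv_tendsto_atTop hlim)
      hlim).elim

/-- A linear functional which is negative on finitely many positive roots is dominant, up to the
action of the group. -/
theorem exists_dominant (f : (ι → ℝ) →ₗ[ℝ] ℝ)
    (hfin : ∀ w, {β ∈ roots cs | 0 ≤ β ∧ f (rep cs w⁻¹ β) < 0}.Finite) :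
    ∃ w, ∀ i, 0 ≤ f (rep cs w⁻¹ (simpleRoot i)) := by
  set N : W → Set (ι → ℝ) := fun w => {β ∈ roots cs | 0 ≤ β ∧ f (rep cs w⁻¹ β) < 0} with hN
  obtain ⟨w, hw⟩ : ∃ w, ∀ u, (N w).ncard ≤ (N u).ncard := by
    obtain ⟨n, ⟨w, rfl⟩, hn⟩ := WellFounded.has_min (wellFounded_lt (α := ℕ))
      (Set.range fun w => (N w).ncard) (Set.range_nonempty _)
    exact ⟨w, fun u => not_lt.1 (hn _ ⟨u, rfl⟩)⟩
  refine ⟨w, fun i => ?_⟩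
  by_contra! hi
  have hmem : simpleRoot i ∈ N w := ⟨simpleRoot_mem_roots i, by simp, hi⟩
  refine (hw (cs.simple i * w)).not_gt ?_
  have hcan : ∀ x, rep cs (cs.simple i) (rep cs (cs.simple i) x) = x := fun x => by
    rw [← rep_mul_apply]; simp
  have hsub : (rep cs (cs.simple i)) '' N (cs.simple i * w) ⊆ N w \ {simpleRoot i} := by
    rintro _ ⟨β, ⟨hβ, hβ0, hβf⟩, rfl⟩
    rw [mul_inv_rev, cs.inv_simple, rep_mul_apply] at hβf
    refine ⟨⟨rep_mem_roots hβ _, rep_simple_nonneg_of_ne hβ hβ0 ?_, hβf⟩, ?_⟩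
    · rintro rfl
      rw [rep_simple_self, map_neg, map_neg] at hβf
      linarith
    · intro heq
      have h1 := congrArg (rep cs (cs.simple i)) (Set.mem_singleton_iff.1 heq)
      rw [hcan, rep_simple_self] at h1
      have := hβ0 i
      rw [h1] at this
      simp at this
      linarith
  calc (N (cs.simple i * w)).ncard = ((rep cs (cs.simple i)) '' N (cs.simple i * w)).ncard :=
        (Set.ncard_image_of_injective _ (Function.LeftInverse.injective hcan)).symm
    _ ≤ (N w \ {simpleRoot i}).ncard := Set.ncard_le_ncard hsub ((hfin w).subset Set.sdiff_subset)
    _ < (N w).ncard := Set.ncard_sdiff_singleton_lt_of_mem hmem (hfin w)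

end Chamber

section Affine

variable {ι : Type*} [Fintype ι] [DecidableEq ι] {M : CoxeterMatrix ι} {W : Type*} [Group W]
  {cs : CoxeterSystem M W}

theorem eq_zero_of_isotropic (hirr : CoxeterIrreducible M) (hpsd : ∀ x, 0 ≤ form M x x)
    {x : ι → ℝ} (hx : form M x x = 0) {i : ι} (hi : x i = 0) : x = 0 := by
  by_contra hne
  have h1 : form M |x| |x| = 0 := le_antisymm (hx ▸ form_abs_le x) (hpsd _)
  have h2 := forall_pos_of_irreducible hirr (abs_nonneg x)
    (fun h => hne (funext fun i => abs_eq_zero.1 (congrFun h i)))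
    (fun j _ => (apply_eq_zero_of_psd (form_comm M) hpsd h1 _).ge) i
  simp [hi] at h2

theorem eq_smul_of_isotropic [Nonempty ι] (hirr : CoxeterIrreducible M)
    (hpsd : ∀ x, 0 ≤ form M x x) {δ : ι → ℝ} (hδ : ∀ i, 0 < δ i) (hrad : ∀ x, form M δ x = 0)
    {x : ι → ℝ} (hx : form M x x = 0) : ∃ t : ℝ, x = t • δ := by
  obtain ⟨i⟩ := ‹Nonempty ι›
  refine ⟨x i / δ i, sub_eq_zero.1 (eq_zero_of_isotropic hirr hpsd (i := i) ?_ ?_)⟩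
  · simp [hx, hrad, form_comm M x δ]
  · simp [(hδ i).ne']

theorem rep_radical {δ : ι → ℝ} (hrad : ∀ x, form M δ x = 0) (w : W) : rep cs w δ = δ := by
  induction w using cs.simple_induction_left with
  | one => simp
  | mul_simple_left w i ih => rw [rep_mul_apply, ih, rep_simple_apply, hrad]; simp

theorem finite_neg_roots_affine [Nonempty ι] (hirr : CoxeterIrreducible M)
    (hpsd : ∀ x, 0 ≤ form M x x) {δ : ι → ℝ} (hδ : ∀ i, 0 < δ i) (hrad : ∀ x, form M δ x = 0)
    (f : (ι → ℝ) →ₗ[ℝ] ℝ) (hf : f δ = 1) : {β ∈ roots cs | 0 ≤ β ∧ f β < 0}.Finite := by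
  refine finite_of_no_limit (cs := cs) (fun β hβ => hβ.1) fun g hg z hz hzz hlim => ?_
  obtain ⟨t, rfl⟩ := eq_smul_of_isotropic hirr hpsd hδ hrad hzz
  have h0 : 0 ≤ t • δ := ge_of_tendsto' hlim fun k =>
    smul_nonneg (inv_nonneg.2 (norm_nonneg _)) (hg k).2.1
  have h1 : f (t • δ) ≤ 0 := le_of_tendsto' (tendsto_linear f hlim) fun k => by
    rw [map_smul, smul_eq_mul]
    exact mul_nonpos_of_nonneg_of_nonpos (inv_nonneg.2 (norm_nonneg _)) (hg k).2.2.le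
  rw [map_smul, hf, smul_eq_mul, mul_one] at h1
  obtain ⟨i⟩ := ‹Nonempty ι›
  have h2 : 0 ≤ t * δ i := h0 i
  have h3 : 0 ≤ t := nonneg_of_mul_nonneg_left h2 (hδ i)
  have : t = 0 := le_antisymm h1 h3
  simp [this] at hz

theorem exists_common_zero_coordinate [Nonempty ι] (hirr : CoxeterIrreducible M)
    (hpsd : ∀ x, 0 ≤ form M x x) {δ : ι → ℝ} (hδ : ∀ i, 0 < δ i) (hrad : ∀ x, form M δ x = 0)
    {β γ : ι → ℝ} (hβ : β ∈ roots cs) (hγ : γ ∈ roots cs) (h : form M β γ ^ 2 ≠ 1) :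
    ∃ (w : W) (i : ι), rep cs w β i = 0 ∧ rep cs w γ i = 0 := by
  have hnot : δ ∉ Submodule.span ℝ {β, γ} := by
    rw [Submodule.mem_span_pair]
    rintro ⟨a, b, hab⟩
    have h1 := hrad β
    have h2 := hrad γ
    rw [← hab] at h1 h2
    simp only [map_add, map_smul, LinearMap.add_apply, LinearMap.smul_apply, smul_eq_mul,
      form_root_self hβ, form_root_self hγ, form_comm M γ β] at h1 h2
    set c := form M β γ
    have hb : b * (1 - c ^ 2) = 0 := by linear_combination h2 - c * h1
    have hb0 : b = 0 := (mul_eq_zero.1 hb).resolve_right fun h' => h (by linarith)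
    have ha0 : a = 0 := by rw [hb0] at h1; linarith
    obtain ⟨i⟩ := ‹Nonempty ι›
    have := hδ i
    rw [← hab, ha0, hb0] at this
    simp at this
  obtain ⟨f₀, hf₀, hker⟩ := Submodule.exists_le_ker_of_notMem hnot
  set f := (f₀ δ)⁻¹ • f₀ with hfdef
  have hfδ : f δ = 1 := by simp [hfdef, hf₀]
  have hfβ : f β = 0 := by
    have : f₀ β = 0 := hker (Submodule.subset_span (by simp))
    simp [hfdef, this]
  have hfγ : f γ = 0 := by
    have : f₀ γ = 0 := hker (Submodule.subset_span (by simp))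
    simp [hfdef, this]
  obtain ⟨w, hw⟩ := exists_dominant (cs := cs) f fun w =>
    finite_neg_roots_affine (cs := cs) hirr hpsd hδ hrad (f ∘ₗ rep cs w⁻¹)
      (by rw [LinearMap.comp_apply, rep_radical hrad, hfδ])
  have hsum : ∀ x : ι → ℝ, f x = ∑ i, rep cs w x i * f (rep cs w⁻¹ (simpleRoot i)) := by
    intro x
    conv_lhs => rw [← rep_inv_apply_self cs w x, eq_sum_simpleRoot (rep cs w x)]
    simp [map_sum]
  have hzero : ∀ x ∈ roots cs, f x = 0 → ∀ i, rep cs w x i * f (rep cs w⁻¹ (simpleRoot i)) = 0 := by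
    intro x hx hfx i
    rw [hsum] at hfx
    rcases root_nonneg_or_nonpos (rep_mem_roots hx w) with h0 | h0
    · exact (Finset.sum_eq_zero_iff_of_nonneg fun j _ => mul_nonneg (h0 j) (hw j)).1 hfx i
        (Finset.mem_univ i)
    · exact (Finset.sum_eq_zero_iff_of_nonpos fun j _ =>
        mul_nonpos_of_nonpos_of_nonneg (h0 j) (hw j)).1 hfx i (Finset.mem_univ i)
  obtain ⟨i, hi⟩ : ∃ i, f (rep cs w⁻¹ (simpleRoot i)) ≠ 0 := by
    by_contra! hall
    have := hsum δ
    simp [hall, hfδ] at this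
  exact ⟨w, i, (mul_eq_zero.1 (hzero β hβ hfβ i)).resolve_right hi,
    (mul_eq_zero.1 (hzero γ hγ hfγ i)).resolve_right hi⟩

theorem finite_form_values [Nonempty ι] (hirr : CoxeterIrreducible M)
    (hpsd : ∀ x, 0 ≤ form M x x) {δ : ι → ℝ} (hδ : ∀ i, 0 < δ i) (hrad : ∀ x, form M δ x = 0) :
    {c | ∃ β ∈ roots cs, ∃ γ ∈ roots cs, form M β γ = c}.Finite := by
  have hfin : ∀ i : ι, {β ∈ roots cs | β i = 0}.Finite := fun i => by
    refine finite_of_no_limit (cs := cs) (fun β hβ => hβ.1) fun g hg z hz hzz hlim => ?_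
    have h0 : z i = 0 := tendsto_nhds_unique (hlim.apply_nhds i) (by simp [(hg _).2])
    rw [eq_zero_of_isotropic hirr hpsd hzz h0] at hz
    simp at hz
  have hfin' : (⋃ i, {β ∈ roots cs | β i = 0}).Finite := Set.finite_iUnion hfin
  refine ((Set.Finite.image2 (fun β γ => form M β γ) hfin' hfin').union
    (Set.toFinite {1, -1})).subset ?_
  rintro c ⟨β, hβ, γ, hγ, rfl⟩
  by_cases h : form M β γ ^ 2 = 1
  · exact Or.inr (by rwa [sq, mul_self_eq_one_iff] at h)
  · obtain ⟨w, i, h1, h2⟩ := exists_common_zero_coordinate hirr hpsd hδ hrad hβ hγ h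
    exact Or.inl ⟨rep cs w β, Set.mem_iUnion.2 ⟨i, rep_mem_roots hβ w, h1⟩, rep cs w γ,
      Set.mem_iUnion.2 ⟨i, rep_mem_roots hγ w, h2⟩, form_rep cs w β γ⟩

theorem virtually_abelian_of_affine [Nonempty ι] (cs : CoxeterSystem M W)
    (hirr : CoxeterIrreducible M)
    (hpsd : ∀ x, 0 ≤ form M x x) {δ : ι → ℝ} (hδ : ∀ i, 0 < δ i) (hrad : ∀ x, form M δ x = 0) :
    ∃ A : Subgroup W, A.index ≠ 0 ∧ ∀ x y : A, x * y = y * x := by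
  let H : Subgroup W :=
    { carrier := {w | ∀ x y, form M (rep cs w x) y = form M x y}
      one_mem' := by simp
      mul_mem' := fun {u w} hu hw x y => by
        rw [rep_mul_apply, hu, hw]
      inv_mem' := fun {u} hu x y => by
        rw [← hu, rep_apply_inv_self] }
  refine ⟨H, ?_, ?_⟩
  · have := (finite_form_values (cs := cs) hirr hpsd hδ hrad).to_subtype
    have hfin : Finite (W ⧸ H) := by
      refine Finite.of_injective (β := ι → ι →
        {c | ∃ β ∈ roots cs, ∃ γ ∈ roots cs, form M β γ = c}) (fun q i j =>
          ⟨form M (rep cs q.out (simpleRoot i)) (simpleRoot j), _,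
            rep_mem_roots (simpleRoot_mem_roots i) _, _, simpleRoot_mem_roots j, rfl⟩) ?_
      intro q r hqr
      have h1 : ∀ i j, form M (rep cs q.out (simpleRoot i)) (simpleRoot j) =
          form M (rep cs r.out (simpleRoot i)) (simpleRoot j) := fun i j =>
        congrArg Subtype.val (congrFun (congrFun hqr i) j)
      have h2 : ∀ x y, form M (rep cs q.out x) y = form M (rep cs r.out x) y := fun x y => by
        rw [eq_sum_simpleRoot x, eq_sum_simpleRoot y]
        simp [map_sum, h1]
      rw [← q.out_eq', ← r.out_eq']
      refine Eq.symm (QuotientGroup.eq.2 fun x y => ?_)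
      rw [rep_mul_apply, ← form_rep cs r.out, rep_apply_inv_self, h2, form_rep]
    exact Subgroup.index_ne_zero_of_finite
  · have hH : ∀ u ∈ H, ∀ x, ∃ t : ℝ, rep cs u x = x + t • δ := fun u hu x => by
      obtain ⟨t, ht⟩ := eq_smul_of_isotropic hirr hpsd hδ hrad (x := rep cs u x - x) (by
        have h1 : form M (rep cs u x - x) = 0 := by
          refine LinearMap.ext fun y => ?_
          simp [hu x y]
        rw [h1, LinearMap.zero_apply])
      exact ⟨t, by rw [← ht]; abel⟩
    rintro ⟨u, hu⟩ ⟨w, hw⟩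
    refine Subtype.ext (eq_of_rep_eq (cs := cs) fun x => ?_)
    obtain ⟨s, hs⟩ := hH u hu x
    obtain ⟨t, ht⟩ := hH w hw x
    simp only [Subgroup.coe_mul] 
    rw [rep_mul_apply, rep_mul_apply, hs, ht, map_add, map_add, map_smul, map_smul,
      rep_radical hrad, rep_radical hrad, hs, ht]
    abel

end Affine

end CoxeterTits

namespace CoxeterTits

open Filter Topology

section LimitCone

variable {ι : Type*} [Fintype ι] [DecidableEq ι] {M : CoxeterMatrix ι} {W : Type*} [Group W]
  (cs : CoxeterSystem M W)

/-- The cone of limits of small multiples of roots. -/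
def limitCone : Set (ι → ℝ) :=
  ⋂ (ε : ℝ) (_ : 0 < ε), closure {x | ∃ β ∈ roots cs, ∃ c : ℝ, 0 < c ∧ c < ε ∧ x = c • β}

/-- The nonnegative part of the cone of limits of small multiples of roots. -/
def limitConePos : Set (ι → ℝ) := limitCone cs ∩ {x | 0 ≤ x}

variable {cs}

theorem mem_limitCone {z : ι → ℝ} : z ∈ limitCone cs ↔ ∀ ε > 0,
    z ∈ closure {x | ∃ β ∈ roots cs, ∃ c : ℝ, 0 < c ∧ c < ε ∧ x = c • β} := by
  simp [limitCone]

theorem mem_limitCone_of_tendsto {f : ℕ → ι → ℝ} (hf : ∀ k, f k ∈ roots cs) {c : ℕ → ℝ}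
    (hc : Tendsto c UF (𝓝 0)) (hc0 : ∀ᶠ k in UF, 0 < c k) {z : ι → ℝ}
    (hz : Tendsto (fun k => c k • f k) UF (𝓝 z)) : z ∈ limitCone cs :=
  mem_limitCone.2 fun _ hε => mem_closure_of_tendsto hz
    ((hc0.and (hc.eventually_lt_const hε)).mono fun k hk => ⟨f k, hf k, c k, hk.1, hk.2, rfl⟩)

theorem exists_tendsto_of_mem_limitCone {z : ι → ℝ} (hz : z ∈ limitCone cs) :
    ∃ (f : ℕ → ι → ℝ) (c : ℕ → ℝ), (∀ k, f k ∈ roots cs) ∧ (∀ k, 0 < c k) ∧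
      Tendsto c UF (𝓝 0) ∧ Tendsto (fun k => c k • f k) UF (𝓝 z) := by
  have h : ∀ k : ℕ, ∃ β ∈ roots cs, ∃ c : ℝ, 0 < c ∧ c < 1 / ((k : ℝ) + 1) ∧
      dist (c • β) z < 1 / ((k : ℝ) + 1) := fun k => by
    have hk : (0 : ℝ) < 1 / ((k : ℝ) + 1) := by positivity
    obtain ⟨x, ⟨β, hβ, c, hc0, hc, rfl⟩, hx⟩ := Metric.mem_closure_iff.1
      (mem_limitCone.1 hz _ hk) _ hk
    exact ⟨β, hβ, c, hc0, hc, by rwa [dist_comm]⟩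
  choose f hf c hc0 hc hd using h
  have hlim : Tendsto (fun k : ℕ => 1 / ((k : ℝ) + 1)) UF (𝓝 0) :=
    tendsto_one_div_add_atTop_nhds_zero_nat.mono_left uf_le_atTop
  refine ⟨f, c, hf, hc0, squeeze_zero (fun k => (hc0 k).le) (fun k => (hc k).le) hlim, ?_⟩
  exact tendsto_iff_dist_tendsto_zero.2
    (squeeze_zero (fun k => dist_nonneg) (fun k => (hd k).le) hlim)

theorem isClosed_limitConePos : IsClosed (limitConePos cs) := by
  refine IsClosed.inter (isClosed_iInter fun ε => isClosed_iInter fun _ => isClosed_closure) ?_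
  exact isClosed_Ici

theorem smul_mem_limitConePos {t : ℝ} (ht : 0 < t) {z : ι → ℝ} (hz : z ∈ limitConePos cs) :
    t • z ∈ limitConePos cs := by
  obtain ⟨f, c, hf, hc0, hc, hlim⟩ := exists_tendsto_of_mem_limitCone hz.1
  refine ⟨mem_limitCone_of_tendsto hf (c := fun k => t * c k) (by simpa using hc.const_mul t)
    (Eventually.of_forall fun k => mul_pos ht (hc0 k)) ?_,
    show 0 ≤ t • z from smul_nonneg ht.le (show 0 ≤ z from hz.2)⟩
  simpa only [mul_smul] using hlim.const_smul t

theorem rep_mem_limitCone {z : ι → ℝ} (hz : z ∈ limitCone cs) (w : W) :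
    rep cs w z ∈ limitCone cs := by
  obtain ⟨f, c, hf, hc0, hc, hlim⟩ := exists_tendsto_of_mem_limitCone hz
  refine mem_limitCone_of_tendsto (fun k => rep_mem_roots (hf k) w) hc
    (Eventually.of_forall hc0) ?_
  simpa only [map_smul] using tendsto_linear (rep cs w) hlim

theorem form_self_of_mem_limitCone {z : ι → ℝ} (hz : z ∈ limitCone cs) : form M z z = 0 := by
  obtain ⟨f, c, hf, hc0, hc, hlim⟩ := exists_tendsto_of_mem_limitCone hz
  exact form_self_of_tendsto hf hc hlim

theorem limitCone_nonneg_or_nonpos {z : ι → ℝ} (hz : z ∈ limitCone cs) : 0 ≤ z ∨ z ≤ 0 := by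
  obtain ⟨f, c, hf, hc0, hc, hlim⟩ := exists_tendsto_of_mem_limitCone hz
  rcases uf_or (Eventually.of_forall fun k => root_nonneg_or_nonpos (hf k)) with h | h
  · exact Or.inl (ge_of_tendsto hlim (h.mono fun k hk => smul_nonneg (hc0 k).le hk))
  · exact Or.inr (le_of_tendsto hlim (h.mono fun k hk => smul_nonpos_of_nonneg_of_nonpos (hc0 k).le hk))

theorem neg_mem_limitCone {z : ι → ℝ} (hz : z ∈ limitCone cs) : -z ∈ limitCone cs := by
  obtain ⟨f, c, hf, hc0, hc, hlim⟩ := exists_tendsto_of_mem_limitCone hz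
  refine mem_limitCone_of_tendsto (fun k => neg_mem_roots (hf k)) hc
    (Eventually.of_forall hc0) ?_
  simpa only [smul_neg] using hlim.neg

theorem mem_or_neg_mem_limitConePos {z : ι → ℝ} (hz : z ∈ limitCone cs) :
    z ∈ limitConePos cs ∨ -z ∈ limitConePos cs :=
  (limitCone_nonneg_or_nonpos hz).imp (fun h => ⟨hz, h⟩)
    fun h => ⟨neg_mem_limitCone hz, neg_nonneg.2 h⟩

theorem rep_mem_limitConePos {z : ι → ℝ} (hz : z ∈ limitConePos cs) (w : W) :
    rep cs w z ∈ limitConePos cs := by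
  induction w using cs.simple_induction_left with
  | one => simpa using hz
  | mul_simple_left w i ih =>
    rw [rep_mul_apply]
    generalize rep cs w z = y at ih
    have hmem := rep_mem_limitCone ih.1 (cs.simple i)
    refine ⟨hmem, ?_⟩
    by_cases h : ∃ j, j ≠ i ∧ 0 < y j
    · obtain ⟨j, hji, hj⟩ := h
      refine (limitCone_nonneg_or_nonpos hmem).resolve_right fun hle => ?_
      have := hle j
      rw [rep_simple_apply] at this
      simp [hji] at this
      linarith
    · push Not at h
      have h1 : y = y i • simpleRoot i := by
        ext j
        rcases eq_or_ne j i with rfl | hji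
        · simp
        · simpa [hji] using le_antisymm (h j hji) (ih.2 j)
      have h2 := form_self_of_mem_limitCone ih.1
      rw [h1] at h2
      simp only [map_smul, LinearMap.smul_apply, smul_eq_mul, form_simpleRoot_self] at h2
      have h3 : y i = 0 := by nlinarith
      rw [h1, h3]
      simp

theorem form_nonpos_of_mem_limitConePos {p u : ι → ℝ} (hp : p ∈ limitConePos cs)
    (hu : u ∈ limitConePos cs) : form M p u ≤ 0 := by
  rcases eq_or_ne p 0 with rfl | hp0
  · simp
  obtain ⟨f, c, hf, hc0, hc, hlim⟩ := exists_tendsto_of_mem_limitCone hp.1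
  choose t ht using fun k => exists_reflection (hf k)
  have h1 : Tendsto (fun k => (c k ^ 2) • rep cs (t k) u) UF
      (𝓝 ((0 : ℝ) • u - (2 * form M u p) • p)) := by
    have h2 : ∀ k, (c k ^ 2) • rep cs (t k) u =
        (c k ^ 2) • u - (2 * form M u (c k • f k)) • (c k • f k) := fun k => by
      rw [ht, map_smul, smul_eq_mul]
      module
    simp only [h2]
    refine Tendsto.sub (Tendsto.smul_const ?_ u)
      (((tendsto_bilin (form M) tendsto_const_nhds hlim).const_mul 2).smul hlim)
    simpa using hc.pow 2
  have h3 : 0 ≤ (0 : ℝ) • u - (2 * form M u p) • p := ge_of_tendsto' h1 fun k =>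
    smul_nonneg (sq_nonneg _) (rep_mem_limitConePos hu (t k)).2
  obtain ⟨i, hi⟩ := Function.ne_iff.1 hp0
  have hi' : 0 < p i := lt_of_le_of_ne (hp.2 i) (Ne.symm hi)
  have h4 := h3 i
  simp at h4
  rw [form_comm]
  by_contra! hcon
  nlinarith [mul_pos hcon hi']

theorem eq_one_of_fixes_generic {y : ι → ℝ}
    (hL : ∀ z ∈ limitConePos cs, z ≠ 0 → form M y z < 0) (hΦ : ∀ β ∈ roots cs, form M y β ≠ 0)
    {w : W} (hw : rep cs w y = y) : w = 1 := by
  obtain ⟨u, hu⟩ := exists_dominant (cs := cs) (-(form M y)) fun u => by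
    refine finite_of_no_limit (cs := cs) (fun β hβ => hβ.1) fun g hg z hz hzz hlim => ?_
    rcases roots_seq_dichotomy fun k => (hg k).1 with ⟨a, ha⟩ | ⟨h1, -⟩
    · have : Tendsto (fun k => ‖g k‖⁻¹ • g k) UF (𝓝 (‖a‖⁻¹ • a)) :=
        tendsto_const_nhds.congr' (ha.mono fun k hk => by simp only [hk])
      have h2 := tendsto_nhds_unique hlim this
      obtain ⟨k, hk⟩ := ha.exists
      have h3 := (hg k).1
      rw [hk] at h3
      rw [h2] at hzz
      simp only [map_smul, LinearMap.smul_apply, smul_eq_mul, form_root_self h3] at hzz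
      have := norm_ne_zero_iff.2 (root_ne_zero h3)
      field_simp at hzz
      simp at hzz
    · have hz1 : z ∈ limitCone cs := mem_limitCone_of_tendsto (fun k => (hg k).1)
        h1.inv_tendsto_atTop (Eventually.of_forall fun k =>
          inv_pos.2 (norm_pos_iff.2 (root_ne_zero (hg k).1))) hlim
      have hz0 : 0 ≤ z := ge_of_tendsto' hlim fun k =>
        smul_nonneg (inv_nonneg.2 (norm_nonneg _)) (hg k).2.1
      have hne : rep cs u⁻¹ z ≠ 0 := fun h => by
        have := rep_apply_inv_self cs u z
        rw [h, map_zero] at this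
        simp [← this] at hz
      have h2 := hL _ (rep_mem_limitConePos ⟨hz1, hz0⟩ u⁻¹) hne
      have h3 : 0 ≤ form M y (rep cs u⁻¹ z) :=
        ge_of_tendsto' (tendsto_linear (form M y ∘ₗ rep cs u⁻¹) hlim) fun k => by
          have := (hg k).2.2
          simp only [LinearMap.neg_apply, neg_lt_zero] at this
          rw [map_smul, smul_eq_mul]
          exact mul_nonneg (inv_nonneg.2 (norm_nonneg _)) this.le
      linarith
  have hneg : ∀ i, form M (rep cs u y) (simpleRoot i) < 0 := fun i => by
    have h1 := hu i
    have h2 := hΦ _ (rep_mem_roots (simpleRoot_mem_roots i) u⁻¹)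
    rw [LinearMap.neg_apply, neg_nonneg] at h1
    rw [← rep_apply_inv_self cs u (simpleRoot i), form_rep]
    exact lt_of_le_of_ne h1 h2
  by_contra hne
  have hne' : u * w * u⁻¹ ≠ 1 := fun h => hne (by simpa using h)
  obtain ⟨i, hi⟩ := exists_rep_simpleRoot_nonpos (cs := cs) hne'
  have h1 : form M (rep cs u y) (rep cs (u * w * u⁻¹) (simpleRoot i)) =
      form M (rep cs u y) (simpleRoot i) := by
    have h2 : rep cs (u * w * u⁻¹) (rep cs u y) = rep cs u y := by
      rw [rep_mul_apply, rep_mul_apply, rep_inv_apply_self, hw]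
    conv_lhs => rw [← h2]
    rw [form_rep]
  have h3 : 0 ≤ form M (rep cs u y) (rep cs (u * w * u⁻¹) (simpleRoot i)) := by
    rw [form_eq_sum]
    exact Finset.sum_nonneg fun j _ => mul_nonneg_of_nonpos_of_nonpos (hi j) (hneg j).le
  linarith [hneg i]

theorem exists_root_not_orthogonal (hirr : CoxeterIrreducible M) {x y : ι → ℝ}
    (hx : ∃ β ∈ roots cs, form M β x ≠ 0) (hy : ∃ β ∈ roots cs, form M β y ≠ 0) :
    ∃ β ∈ roots cs, form M β x ≠ 0 ∧ form M β y ≠ 0 := by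
  by_contra! hcon
  obtain ⟨γ, hγ, hγx⟩ := hx
  obtain ⟨β, hβ, hβy⟩ := hy
  have hβx : ∀ β ∈ roots cs, form M β y ≠ 0 → form M β x = 0 := fun β h h' => by
    by_contra h''
    exact h' (hcon β h h'')
  have hperp : ∀ β ∈ roots cs, form M β y ≠ 0 → ∀ γ ∈ roots cs, form M γ x ≠ 0 →
      form M β γ = 0 := by
    intro β hβ hβy γ hγ hγx
    obtain ⟨t, ht⟩ := exists_reflection hγ
    have h1 : form M (rep cs t β) y ≠ 0 := by
      rw [ht]
      simpa [hcon γ hγ hγx] using hβy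
    have h2 := hβx _ (rep_mem_roots hβ t) h1
    rw [ht] at h2
    simpa [hβx β hβ hβy, hγx] using h2
  set U := Submodule.span ℝ {β ∈ roots cs | form M β y ≠ 0} with hU
  have hUγ : ∀ z ∈ U, form M z γ = 0 := by
    intro z hz
    induction hz using Submodule.span_induction with
    | mem z hz => exact hperp z hz.1 hz.2 γ hγ hγx
    | zero => simp
    | add a b _ _ ha hb => simp [ha, hb]
    | smul c a _ ha => simp [ha]
  have hinv : ∀ i, ∀ z ∈ U, rep cs (cs.simple i) z ∈ U := by
    intro i z hz
    induction hz using Submodule.span_induction with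
    | mem z hz =>
      by_cases h1 : form M (simpleRoot i) y = 0
      · refine Submodule.subset_span ⟨rep_mem_roots hz.1 _, ?_⟩
        rw [rep_simple_apply]
        simpa [h1] using hz.2
      · rw [rep_simple_apply]
        exact sub_mem (Submodule.subset_span hz)
          (Submodule.smul_mem _ _ (Submodule.subset_span ⟨simpleRoot_mem_roots i, h1⟩))
    | zero => simp
    | add a b _ _ ha hb => rw [map_add]; exact add_mem ha hb
    | smul c a _ ha => rw [map_smul]; exact Submodule.smul_mem _ _ ha
  have hdich : ∀ i, simpleRoot i ∈ U ∨ ∀ z ∈ U, form M z (simpleRoot i) = 0 := by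
    intro i
    by_contra! h
    obtain ⟨h1, z, hz, hzi⟩ := h
    have h2 := sub_mem hz (hinv i z hz)
    rw [rep_simple_apply, sub_sub_cancel] at h2
    exact h1 ((Submodule.smul_mem_iff _ (mul_ne_zero two_ne_zero hzi)).1 h2)
  have hall : ∀ i, simpleRoot i ∈ U := by
    by_contra! hex
    apply hirr
    refine ⟨{i | simpleRoot i ∈ U}, ?_, hex, fun a ha b hb => ?_⟩
    · by_contra hemp
      rw [Set.not_nonempty_iff_eq_empty, Set.eq_empty_iff_forall_notMem] at hemp
      have h1 := form_root_self hβ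
      rw [form_eq_sum, Finset.sum_eq_zero] at h1
      · exact zero_ne_one h1
      · intro i _
        rw [(hdich i).resolve_left (hemp i) β (Submodule.subset_span ⟨hβ, hβy⟩), mul_zero]
    · by_contra hab
      have hne : a ≠ b := by rintro rfl; exact hb ha
      exact (form_neg_of_ne_two hne hab).ne ((hdich b).resolve_left hb _ ha)
  have h1 := form_root_self hγ
  rw [form_eq_sum, Finset.sum_eq_zero] at h1
  · exact zero_ne_one h1
  · intro i _
    rw [form_comm, hUγ _ (hall i), mul_zero]

theorem exists_one_lt_abs_form [Infinite W] (cs : CoxeterSystem M W) {μ : ℝ} (hμ : μ ≠ 0)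
    {v : ι → ℝ} (hv : ∀ i, 0 < v i) (hvμ : ∀ i, form M v (simpleRoot i) = μ * v i) :
    ∃ β ∈ roots cs, ∃ γ ∈ roots cs, 1 < |form M β γ| := by
  by_contra! h
  set S := ∑ i, v i with hS
  have hbound : ∀ β ∈ roots cs, ∀ i, |β i| ≤ S / |μ| / v i := by
    intro β hβ i
    have h1 : form M v β = μ * ∑ i, β i * v i := by
      rw [form_eq_sum, Finset.mul_sum]
      exact Finset.sum_congr rfl fun i _ => by rw [hvμ]; ring
    have h2 : |form M v β| ≤ S := by
      rw [form_comm, form_eq_sum]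
      refine (Finset.abs_sum_le_sum_abs _ _).trans (Finset.sum_le_sum fun i _ => ?_)
      rw [abs_mul, abs_of_pos (hv i)]
      exact mul_le_of_le_one_right (hv i).le (h β hβ _ (simpleRoot_mem_roots i))
    have h3 : |∑ i, β i * v i| = ∑ i, |β i| * v i := by
      rcases root_nonneg_or_nonpos hβ with h0 | h0
      · rw [abs_of_nonneg (Finset.sum_nonneg fun i _ => mul_nonneg (h0 i) (hv i).le)]
        exact Finset.sum_congr rfl fun i _ => by rw [abs_of_nonneg (h0 i)]
      · rw [abs_of_nonpos (Finset.sum_nonpos fun i _ =>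
          mul_nonpos_of_nonpos_of_nonneg (h0 i) (hv i).le), ← Finset.sum_neg_distrib]
        exact Finset.sum_congr rfl fun i _ => by rw [abs_of_nonpos (h0 i)]; ring
    have h4 : |β i| * v i ≤ ∑ i, |β i| * v i :=
      Finset.single_le_sum (f := fun i => |β i| * v i)
        (fun i _ => mul_nonneg (abs_nonneg _) (hv i).le) (Finset.mem_univ i)
    rw [h1, abs_mul, h3] at h2
    rw [le_div_iff₀ (hv i), le_div_iff₀ (abs_pos.2 hμ)]
    nlinarith [abs_pos.2 hμ]
  have hS0 : 0 ≤ S := Finset.sum_nonneg fun i _ => (hv i).le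
  refine not_finite_iff_infinite.2 ‹Infinite W› (finite_of_bounded_roots (cs := cs)
    (C := ∑ i, S / |μ| / v i) fun β hβ => ?_)
  have hnn : ∀ i, 0 ≤ S / |μ| / v i := fun i =>
    div_nonneg (div_nonneg hS0 (abs_nonneg _)) (hv i).le
  rw [pi_norm_le_iff_of_nonneg (Finset.sum_nonneg fun i _ => hnn i)]
  intro i
  exact (hbound β hβ i).trans
    (Finset.single_le_sum (f := fun i => S / |μ| / v i) (fun i _ => hnn i) (Finset.mem_univ i))

theorem eq_zero_of_mem_limitConePos {μ : ℝ} (hμ : μ ≠ 0) {v : ι → ℝ} (hv : ∀ i, 0 < v i)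
    (hvμ : ∀ i, form M v (simpleRoot i) = μ * v i) {z : ι → ℝ} (hz : z ∈ limitConePos cs)
    (h : ∀ β ∈ roots cs, form M z β = 0) : z = 0 := by
  have h1 : form M v z = μ * ∑ i, z i * v i := by
    rw [form_eq_sum, Finset.mul_sum]
    exact Finset.sum_congr rfl fun i _ => by rw [hvμ]; ring
  have h2 : form M v z = 0 := by
    rw [form_comm, form_eq_sum]
    exact Finset.sum_eq_zero fun i _ => by rw [h _ (simpleRoot_mem_roots i), mul_zero]
  rw [h2] at h1
  have h3 := (mul_eq_zero.1 h1.symm).resolve_left hμ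
  ext i
  have := (Finset.sum_eq_zero_iff_of_nonneg fun i _ => mul_nonneg (hz.2 i) (hv i).le).1 h3 i
    (Finset.mem_univ i)
  exact (mul_eq_zero.1 this).resolve_right (hv i).ne'

end LimitCone

end CoxeterTits

namespace CoxeterTits

open Filter Topology

/-- A group acting faithfully on a finite-dimensional real vector space with an invariant bilinear
form, a system of roots, and a closed cone of limit directions of roots. -/
structure RootData (W : Type*) [Group W] (V : Type*) [NormedAddCommGroup V] [NormedSpace ℝ V] where
  /-- the representation -/
  ρ : W →* Module.End ℝ V
  /-- the invariant form -/
  B : LinearMap.BilinForm ℝ V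
  /-- the roots -/
  Φ : Set V
  /-- the limit cone -/
  L : Set V
  /-- the reflections -/
  s : V → W
  /-- a finite set of roots spanning the space -/
  Δ : Finset V
  comm : ∀ x y, B x y = B y x
  inv : ∀ w x y, B (ρ w x) (ρ w y) = B x y
  Φ_map : ∀ w, ∀ β ∈ Φ, ρ w β ∈ Φ
  Φ_self : ∀ β ∈ Φ, B β β = 1
  s_apply : ∀ β ∈ Φ, ∀ x, ρ (s β) x = x - (2 * B x β) • β
  faithful : ∀ w, (∀ x, ρ w x = x) → w = 1
  Δ_sub : ∀ δ ∈ Δ, δ ∈ Φ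
  Δ_span : Submodule.span ℝ (Δ : Set V) = ⊤
  finite_bdd : ∀ C : ℝ, {β ∈ Φ | ‖β‖ ≤ C}.Finite
  L_closed : IsClosed L
  L_smul : ∀ t : ℝ, 0 < t → ∀ z ∈ L, t • z ∈ L
  L_map : ∀ w, ∀ z ∈ L, ρ w z ∈ L
  L_limit : ∀ (f : ℕ → V) (c : ℕ → ℝ) (z : V), (∀ k, f k ∈ Φ) → Tendsto c UF (𝓝 0) →
    (∀ k, 0 < c k) → Tendsto (fun k => c k • f k) UF (𝓝 z) → z ∈ L ∨ -z ∈ L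
  L_nonpos : ∀ x ∈ L, ∀ y ∈ L, B x y ≤ 0
  L_self : ∀ x ∈ L, B x x = 0
  L_rad : ∀ z ∈ L, (∀ β ∈ Φ, B z β = 0) → z = 0
  stab : ∀ y, (∀ z ∈ L, z ≠ 0 → B y z < 0) → (∀ β ∈ Φ, B y β ≠ 0) → ∀ w, ρ w y = y → w = 1
  nonorth : ∀ x y, (∃ β ∈ Φ, B β x ≠ 0) → (∃ β ∈ Φ, B β y ≠ 0) → ∃ β ∈ Φ, B β x ≠ 0 ∧ B β y ≠ 0
  hyp : ∃ β ∈ Φ, ∃ γ ∈ Φ, 1 < |B β γ|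
  gen : Subgroup.closure (s '' Φ) = ⊤

section Instance

variable {ι : Type*} [Fintype ι] [DecidableEq ι] {M : CoxeterMatrix ι} {W : Type*} [Group W]

open Classical in
/-- The root data of an infinite non-affine irreducible Coxeter group. -/
noncomputable def rootData [Infinite W] (cs : CoxeterSystem M W) (hirr : CoxeterIrreducible M)
    {μ : ℝ} (hμ : μ ≠ 0) {v : ι → ℝ} (hv : ∀ i, 0 < v i)
    (hvμ : ∀ i, form M v (simpleRoot i) = μ * v i) : RootData W (ι → ℝ) where
  ρ := rep cs
  B := form M
  Φ := roots cs
  L := limitConePos cs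
  s := fun β => if h : β ∈ roots cs then (exists_reflection h).choose else 1
  Δ := Finset.univ.image fun i : ι => simpleRoot i
  comm := form_comm M
  inv := form_rep cs
  Φ_map := fun w β h => rep_mem_roots h w
  Φ_self := fun β h => form_root_self h
  s_apply := fun β h x => by
    rw [dif_pos h]
    exact (exists_reflection h).choose_spec x
  faithful := fun w h => eq_of_rep_eq (cs := cs) fun x => by rw [h]; simp
  Δ_sub := fun δ h => by
    obtain ⟨i, -, rfl⟩ := Finset.mem_image.1 h
    exact simpleRoot_mem_roots i
  Δ_span := by
    rw [eq_top_iff]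
    intro x _
    rw [eq_sum_simpleRoot x]
    exact sum_mem fun i _ => Submodule.smul_mem _ _ (Submodule.subset_span (by simp))
  finite_bdd := finite_roots_norm_le
  L_closed := isClosed_limitConePos
  L_smul := fun t ht z hz => smul_mem_limitConePos ht hz
  L_map := fun w z hz => rep_mem_limitConePos hz w
  L_limit := fun f c z hf hc hc0 hz => mem_or_neg_mem_limitConePos
    (mem_limitCone_of_tendsto hf hc (Eventually.of_forall hc0) hz)
  L_nonpos := fun x hx y hy => form_nonpos_of_mem_limitConePos hx hy
  L_self := fun x hx => form_self_of_mem_limitCone hx.1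
  L_rad := fun z hz h => eq_zero_of_mem_limitConePos hμ hv hvμ hz h
  stab := fun y h1 h2 w hw => eq_one_of_fixes_generic h1 h2 hw
  nonorth := fun x y hx hy => exists_root_not_orthogonal hirr hx hy
  hyp := exists_one_lt_abs_form cs hμ hv hvμ
  gen := by
    rw [eq_top_iff, ← cs.subgroup_closure_range_simple]
    refine Subgroup.closure_mono ?_
    rintro _ ⟨i, rfl⟩
    refine ⟨simpleRoot i, simpleRoot_mem_roots i, ?_⟩
    dsimp only
    rw [dif_pos (simpleRoot_mem_roots (cs := cs) i)]
    refine eq_of_rep_eq (cs := cs) fun x => ?_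
    rw [(exists_reflection (simpleRoot_mem_roots (cs := cs) i)).choose_spec x, rep_simple_apply]

end Instance

namespace RootData

variable {W : Type*} [Group W] {V : Type*} [NormedAddCommGroup V] [NormedSpace ℝ V]
  (R : RootData W V)

theorem mul_apply (u w : W) (x : V) : R.ρ (u * w) x = R.ρ u (R.ρ w x) := by simp

theorem one_apply (x : V) : R.ρ 1 x = x := by simp

theorem inv_apply_self (w : W) (x : V) : R.ρ w⁻¹ (R.ρ w x) = x := by
  rw [← mul_apply, inv_mul_cancel, one_apply]

theorem apply_inv_self (w : W) (x : V) : R.ρ w (R.ρ w⁻¹ x) = x := by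
  rw [← mul_apply, mul_inv_cancel, one_apply]

theorem form_inv_left (w : W) (x y : V) : R.B (R.ρ w⁻¹ x) y = R.B x (R.ρ w y) := by
  rw [← R.inv w (R.ρ w⁻¹ x), apply_inv_self]

theorem apply_injective (w : W) : Function.Injective (R.ρ w) := fun x y h => by
  rw [← R.inv_apply_self w x, h, R.inv_apply_self]

theorem apply_eq_zero {w : W} {x : V} : R.ρ w x = 0 ↔ x = 0 :=
  ⟨fun h => R.apply_injective w (by rw [h, map_zero]), fun h => by rw [h, map_zero]⟩

theorem ext_apply {u w : W} (h : ∀ x, R.ρ u x = R.ρ w x) : u = w := by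
  have := R.faithful (w⁻¹ * u) fun x => by rw [mul_apply, h, inv_apply_self]
  exact (inv_mul_eq_one.1 this).symm

theorem ext_Δ {u w : W} (h : ∀ δ ∈ R.Δ, R.ρ u δ = R.ρ w δ) : u = w := by
  refine R.ext_apply fun x => ?_
  have : R.ρ u = R.ρ w := LinearMap.ext_on R.Δ_span fun δ hδ => h δ hδ
  rw [this]

theorem zero_mem : (0 : V) ∉ R.Φ := fun h => by simpa using R.Φ_self 0 h

theorem root_ne_zero {β : V} (h : β ∈ R.Φ) : β ≠ 0 := fun h0 => R.zero_mem (h0 ▸ h)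

theorem s_self {β : V} (h : β ∈ R.Φ) : R.ρ (R.s β) β = -β := by
  rw [R.s_apply β h, R.Φ_self β h]
  module

theorem neg_mem {β : V} (h : β ∈ R.Φ) : -β ∈ R.Φ := R.s_self h ▸ R.Φ_map _ _ h

theorem s_mul_self {β : V} (h : β ∈ R.Φ) : R.s β * R.s β = 1 := by
  refine R.faithful _ fun x => ?_
  rw [mul_apply, R.s_apply β h x, map_sub, map_smul, R.s_self h, R.s_apply β h]
  module

theorem s_inv {β : V} (h : β ∈ R.Φ) : (R.s β)⁻¹ = R.s β :=
  inv_eq_of_mul_eq_one_left (R.s_mul_self h)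

theorem s_s {β : V} (h : β ∈ R.Φ) (x : V) : R.ρ (R.s β) (R.ρ (R.s β) x) = x := by
  rw [← mul_apply, R.s_mul_self h, one_apply]

theorem conj_s {β : V} (h : β ∈ R.Φ) (w : W) : w * R.s β * w⁻¹ = R.s (R.ρ w β) := by
  refine R.ext_apply fun x => ?_
  rw [mul_apply, mul_apply, R.s_apply β h, R.s_apply _ (R.Φ_map w β h), map_sub, map_smul,
    apply_inv_self, form_inv_left]

theorem s_neg {β : V} (h : β ∈ R.Φ) : R.s (-β) = R.s β := by
  refine R.ext_apply fun x => ?_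
  rw [R.s_apply β h, R.s_apply _ (R.neg_mem h), map_neg]
  module

theorem s_ne_one {β : V} (h : β ∈ R.Φ) : R.s β ≠ 1 := fun h1 => by
  have := R.s_self h
  rw [h1, one_apply] at this
  have h2 : (2 : ℝ) • β = 0 := by
    rw [two_smul]
    nth_rewrite 1 [this]
    simp
  exact R.root_ne_zero h ((smul_eq_zero.1 h2).resolve_left two_ne_zero)

theorem eq_or_eq_neg_of_s_eq {β γ : V} (hβ : β ∈ R.Φ) (hγ : γ ∈ R.Φ) (h : R.s β = R.s γ) :
    β = γ ∨ β = -γ := by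
  have h1 := R.s_self hβ
  rw [h, R.s_apply γ hγ] at h1
  have h2 : β = R.B β γ • γ := by
    have : (2 : ℝ) • β = (2 : ℝ) • (R.B β γ • γ) := by
      rw [← sub_eq_zero] at h1 ⊢
      rw [← h1]
      module
    exact smul_right_injective V two_ne_zero this
  have h3 := R.Φ_self β hβ
  rw [h2] at h3
  simp only [map_smul, LinearMap.smul_apply, smul_eq_mul, R.Φ_self γ hγ, mul_one] at h3
  rcases mul_self_eq_one_iff.1 h3 with h4 | h4
  · left; rw [h2, h4, one_smul]
  · right; rw [h2, h4, neg_one_smul]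

theorem L_limit' {f : ℕ → V} {c : ℕ → ℝ} {z : V} (hf : ∀ᶠ k in UF, f k ∈ R.Φ)
    (hc : Tendsto c UF (𝓝 0)) (hc0 : ∀ᶠ k in UF, 0 < c k)
    (hz : Tendsto (fun k => c k • f k) UF (𝓝 z)) : z ∈ R.L ∨ -z ∈ R.L := by
  classical
  obtain ⟨β, hβ, -⟩ := R.hyp
  refine R.L_limit (fun k => if f k ∈ R.Φ ∧ 0 < c k then f k else β)
    (fun k => if f k ∈ R.Φ ∧ 0 < c k then c k else 1) z (fun k => ?_) ?_ (fun k => ?_) ?_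
  · split_ifs with h
    · exact h.1
    · exact hβ
  · refine hc.congr' ((hf.and hc0).mono fun k hk => ?_)
    dsimp only
    rw [if_pos hk]
  · split_ifs with h
    · exact h.2
    · exact one_pos
  · refine hz.congr' ((hf.and hc0).mono fun k hk => ?_)
    dsimp only
    rw [if_pos hk, if_pos hk]

section FiniteDimensional

variable [FiniteDimensional ℝ V]

theorem seq_dichotomy {f : ℕ → V} (hf : ∀ᶠ k in UF, f k ∈ R.Φ) :
    (∃ a ∈ R.Φ, ∀ᶠ k in UF, f k = a) ∨
      (Tendsto (fun k => ‖f k‖) UF atTop ∧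
      ∃ z ∈ R.L, ‖z‖ = 1 ∧ ∃ c : ℕ → ℝ, Tendsto c UF (𝓝 0) ∧
        Tendsto (fun k => c k • f k) UF (𝓝 z)) := by
  rcases uf_bddAbove_or_tendsto_atTop fun k => ‖f k‖ with ⟨C, hC⟩ | h
  · left
    obtain ⟨a, ha, h⟩ := uf_eventually_eq_of_finite (R.finite_bdd C) (hf.and hC)
    exact ⟨a, ha.1, h⟩
  · right
    refine ⟨h, ?_⟩
    have hpos : ∀ᶠ k in UF, 0 < ‖f k‖ := h.eventually_gt_atTop 0
    have hone : ∀ᶠ k in UF, ‖‖f k‖⁻¹ • f k‖ = 1 := hpos.mono fun k hk => by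
      rw [norm_smul, norm_inv, norm_norm, inv_mul_cancel₀ hk.ne']
    obtain ⟨z, hz⟩ := uf_exists_tendsto_of_norm_le (hone.mono fun k hk => hk.le)
    have hz1 : ‖z‖ = 1 := tendsto_nhds_unique (hz.norm)
      (tendsto_const_nhds.congr' (hone.mono fun k hk => hk.symm))
    rcases R.L_limit' hf h.inv_tendsto_atTop (hpos.mono fun k hk => inv_pos.2 hk) hz with h1 | h1
    · exact ⟨z, h1, hz1, _, h.inv_tendsto_atTop, hz⟩
    · refine ⟨-z, h1, by rwa [norm_neg], fun k => -‖f k‖⁻¹, ?_, ?_⟩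
      · simpa using h.inv_tendsto_atTop.neg
      · simpa using hz.neg

theorem exists_tendsto_unit {f : ℕ → V} (hf : ∀ᶠ k in UF, f k ∈ R.L ∧ f k ≠ 0) :
    ∃ z ∈ R.L, ‖z‖ = 1 ∧ Tendsto (fun k => ‖f k‖⁻¹ • f k) UF (𝓝 z) := by
  have hone : ∀ᶠ k in UF, ‖‖f k‖⁻¹ • f k‖ = 1 := hf.mono fun k hk => by
    rw [norm_smul, norm_inv, norm_norm, inv_mul_cancel₀ (norm_ne_zero_iff.2 hk.2)]
  obtain ⟨z, hz⟩ := uf_exists_tendsto_of_norm_le (hone.mono fun k hk => hk.le)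
  refine ⟨z, R.L_closed.mem_of_tendsto hz (hf.mono fun k hk =>
    R.L_smul _ (inv_pos.2 (norm_pos_iff.2 hk.2)) _ hk.1), ?_, hz⟩
  exact tendsto_nhds_unique (hz.norm)
    (tendsto_const_nhds.congr' (hone.mono fun k hk => hk.symm))

end FiniteDimensional

end RootData

end CoxeterTits

namespace CoxeterTits

open Filter Topology

namespace RootData

variable {W : Type*} [Group W] {V : Type*} [NormedAddCommGroup V] [NormedSpace ℝ V]

theorem s_smul_add (R : RootData W V) {β γ : V} {r : ℝ} (hγ : γ ∈ R.Φ) (hr : 1 < r)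
    (hB : R.B β γ = -(r + r⁻¹) / 2) : R.ρ (R.s γ) (r • β + γ) = r • (r • γ + β) := by
  have h1 : r * r⁻¹ = 1 := mul_inv_cancel₀ (one_pos.trans hr).ne'
  rw [R.s_apply _ hγ, map_add, map_smul, LinearMap.add_apply, LinearMap.smul_apply,
    R.Φ_self _ hγ, smul_eq_mul]
  have h2 : 2 * (r * R.B β γ + 1) = 1 - r ^ 2 := by rw [hB]; linear_combination -h1
  rw [h2]
  module

/-- A pair of roots spanning a hyperbolic plane, with its two ends in the limit cone. -/
structure HypPair (R : RootData W V) where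
  /-- the first root -/
  β : V
  /-- the second root -/
  γ : V
  /-- the square root of the translation factor -/
  r : ℝ
  hβ : β ∈ R.Φ
  hγ : γ ∈ R.Φ
  hr : 1 < r
  hB : R.B β γ = -(r + r⁻¹) / 2
  hp : r • β + γ ∈ R.L
  hq : r • γ + β ∈ R.L

namespace HypPair

variable {R : RootData W V} (H : R.HypPair)

/-- The same pair in the opposite order. -/
def swap : R.HypPair where
  β := H.γ
  γ := H.β
  r := H.r
  hβ := H.hγ
  hγ := H.hβ
  hr := H.hr
  hB := by rw [R.comm, H.hB]
  hp := H.hq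
  hq := H.hp

/-- The attracting end. -/
def p : V := H.r • H.β + H.γ

/-- The repelling end. -/
def q : V := H.r • H.γ + H.β

/-- The translation. -/
def g : W := R.s H.β * R.s H.γ

/-- The translation factor. -/
def lam : ℝ := H.r ^ 2

@[simp] theorem swap_p : H.swap.p = H.q := rfl

@[simp] theorem swap_q : H.swap.q = H.p := rfl

@[simp] theorem swap_lam : H.swap.lam = H.lam := rfl

theorem swap_g : H.swap.g = H.g⁻¹ := by
  rw [g, g, mul_inv_rev, R.s_inv H.hβ, R.s_inv H.hγ]
  rfl

theorem r_pos : 0 < H.r := one_pos.trans H.hr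

theorem one_lt_lam : 1 < H.lam := one_lt_pow₀ H.hr two_ne_zero

theorem lam_pos : 0 < H.lam := one_pos.trans H.one_lt_lam

theorem two_mul_r_mul : 2 * H.r * R.B H.β H.γ = -(H.r ^ 2 + 1) := by
  have := H.r_pos.ne'
  rw [H.hB]
  field_simp

theorem p_mem : H.p ∈ R.L := H.hp

theorem q_mem : H.q ∈ R.L := H.hq

theorem pp : R.B H.p H.p = 0 := R.L_self _ H.hp

theorem qq : R.B H.q H.q = 0 := R.L_self _ H.hq

theorem two_r_mul_pq : 2 * H.r * R.B H.p H.q = -(H.r ^ 2 - 1) ^ 2 := by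
  have h1 := H.two_mul_r_mul
  have h2 := R.comm H.γ H.β
  simp only [p, q, map_add, map_smul, LinearMap.add_apply, LinearMap.smul_apply, smul_eq_mul,
    R.Φ_self _ H.hβ, R.Φ_self _ H.hγ, h2]
  linear_combination (H.r ^ 2 + 1) * h1

theorem lam_sub_one_pos : 0 < H.r ^ 2 - 1 := sub_pos.2 H.one_lt_lam

theorem pq_neg : R.B H.p H.q < 0 := by
  have h1 := H.two_r_mul_pq
  have h2 := H.r_pos
  have h3 := pow_pos H.lam_sub_one_pos 2
  by_contra! h
  nlinarith

theorem pq_ne : R.B H.p H.q ≠ 0 := H.pq_neg.ne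

theorem p_ne_zero : H.p ≠ 0 := fun h => H.pq_ne (by rw [h]; simp)

theorem q_ne_zero : H.q ≠ 0 := H.swap.p_ne_zero

theorem s_γ_p : R.ρ (R.s H.γ) H.p = H.r • H.q :=
  R.s_smul_add H.hγ H.hr H.hB

theorem s_β_q : R.ρ (R.s H.β) H.q = H.r • H.p := H.swap.s_γ_p

theorem s_β_p : R.ρ (R.s H.β) H.p = H.r⁻¹ • H.q := by
  have h := congrArg (R.ρ (R.s H.β)) H.s_β_q
  rw [R.s_s H.hβ, map_smul] at h
  rw [h, smul_smul, inv_mul_cancel₀ H.r_pos.ne', one_smul]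

theorem s_γ_q : R.ρ (R.s H.γ) H.q = H.r⁻¹ • H.p := H.swap.s_β_p

theorem lam_sub_one_smul_β : (H.r ^ 2 - 1) • H.β = H.r • H.p - H.q := by
  rw [p, q]
  module

theorem g_p : R.ρ H.g H.p = H.lam • H.p := by
  rw [g, mul_apply, s_γ_p, map_smul, s_β_q, smul_smul, lam, sq]

theorem g_q : R.ρ H.g H.q = H.lam⁻¹ • H.q := by
  rw [g, mul_apply, s_γ_q, map_smul, s_β_p, smul_smul, lam, sq, mul_inv]

theorem zpow_p (k : ℤ) : R.ρ (H.g ^ k) H.p = H.lam ^ k • H.p := by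
  induction k using Int.induction_on with
  | zero => simp
  | succ k ih =>
    rw [zpow_add_one, mul_apply, g_p, map_smul, ih, smul_smul, zpow_add_one₀ H.lam_pos.ne',
      mul_comm]
  | pred k ih =>
    rw [zpow_sub_one, mul_apply]
    have : R.ρ H.g⁻¹ H.p = H.lam⁻¹ • H.p := by
      rw [← swap_g, ← swap_q, H.swap.g_q, swap_lam]
    rw [this, map_smul, ih, smul_smul, zpow_sub_one₀ H.lam_pos.ne', mul_comm]

theorem zpow_q (k : ℤ) : R.ρ (H.g ^ k) H.q = H.lam ^ (-k) • H.q := by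
  have := H.swap.zpow_p (-k)
  rwa [swap_g, inv_zpow', neg_neg] at this

/-- The coefficient of the attracting end. -/
noncomputable def cp : V →ₗ[ℝ] ℝ := (R.B H.p H.q)⁻¹ • R.B H.q

/-- The coefficient of the repelling end. -/
noncomputable def cq : V →ₗ[ℝ] ℝ := (R.B H.p H.q)⁻¹ • R.B H.p

/-- The component orthogonal to both ends. -/
noncomputable def mm : V →ₗ[ℝ] V :=
  LinearMap.id - H.cp.smulRight H.p - H.cq.smulRight H.q

theorem cp_apply (x : V) : H.cp x = (R.B H.p H.q)⁻¹ * R.B H.q x := rfl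

theorem cq_apply (x : V) : H.cq x = (R.B H.p H.q)⁻¹ * R.B H.p x := rfl

@[simp] theorem swap_cp : H.swap.cp = H.cq := by
  rw [cp, cq, swap_p, swap_q, R.comm]

@[simp] theorem swap_cq : H.swap.cq = H.cp := by
  rw [cp, cq, swap_p, swap_q, R.comm]

theorem mm_apply (x : V) : H.mm x = x - H.cp x • H.p - H.cq x • H.q := by
  simp [mm]

theorem decomp (x : V) : x = H.cp x • H.p + H.cq x • H.q + H.mm x := by
  rw [mm_apply]; abel

@[simp] theorem cp_p : H.cp H.p = 1 := by
  rw [cp_apply, R.comm H.q, inv_mul_cancel₀ H.pq_ne]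

@[simp] theorem cp_q : H.cp H.q = 0 := by rw [cp_apply, H.qq, mul_zero]

@[simp] theorem cq_p : H.cq H.p = 0 := by rw [cq_apply, H.pp, mul_zero]

@[simp] theorem cq_q : H.cq H.q = 1 := by rw [cq_apply, inv_mul_cancel₀ H.pq_ne]

@[simp] theorem cp_mm (x : V) : H.cp (H.mm x) = 0 := by simp [mm_apply]

theorem form_q (x : V) : R.B x H.q = R.B H.p H.q * H.cp x := by
  rw [cp_apply, mul_inv_cancel_left₀ H.pq_ne, R.comm]

theorem form_p (x : V) : R.B x H.p = R.B H.p H.q * H.cq x := by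
  rw [cq_apply, mul_inv_cancel_left₀ H.pq_ne, R.comm]

theorem mm_orth_q (x : V) : R.B (H.mm x) H.q = 0 := by
  rw [form_q, mm_apply]
  simp

theorem mm_orth_p (x : V) : R.B (H.mm x) H.p = 0 := by
  rw [form_p, mm_apply]
  simp

theorem orth_iff {x : V} :
    (R.B x H.p = 0 ∧ R.B x H.q = 0) ↔ (R.B x H.β = 0 ∧ R.B x H.γ = 0) := by
  constructor
  · rintro ⟨h1, h2⟩
    have key : ∀ K : R.HypPair, R.B x K.p = 0 → R.B x K.q = 0 → R.B x K.β = 0 := by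
      intro K h1 h2
      have := congrArg (R.B x) K.lam_sub_one_smul_β
      rw [map_smul, map_sub, map_smul, h1, h2, smul_zero, sub_zero, smul_eq_mul] at this
      exact (mul_eq_zero.1 this).resolve_left K.lam_sub_one_pos.ne'
    exact ⟨key H h1 h2, key H.swap h2 h1⟩
  · rintro ⟨h1, h2⟩
    simp [p, q, h1, h2]

theorem mm_orth_β (x : V) : R.B (H.mm x) H.β = 0 :=
  (H.orth_iff.1 ⟨H.mm_orth_p x, H.mm_orth_q x⟩).1

theorem mm_orth_γ (x : V) : R.B (H.mm x) H.γ = 0 :=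
  (H.orth_iff.1 ⟨H.mm_orth_p x, H.mm_orth_q x⟩).2

theorem g_of_orth {x : V} (h1 : R.B x H.β = 0) (h2 : R.B x H.γ = 0) : R.ρ H.g x = x := by
  rw [g, mul_apply, R.s_apply _ H.hγ, h2]
  simp [R.s_apply _ H.hβ, h1]

theorem zpow_of_orth {x : V} (h1 : R.B x H.β = 0) (h2 : R.B x H.γ = 0) (k : ℤ) :
    R.ρ (H.g ^ k) x = x := by
  induction k using Int.induction_on with
  | zero => simp
  | succ k ih => rw [zpow_add_one, mul_apply, H.g_of_orth h1 h2, ih]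
  | pred k ih =>
    rw [zpow_sub_one, mul_apply]
    have := R.inv_apply_self H.g x
    rw [H.g_of_orth h1 h2] at this
    rw [this, ih]

theorem zpow_mm (k : ℤ) (x : V) : R.ρ (H.g ^ k) (H.mm x) = H.mm x :=
  H.zpow_of_orth (H.mm_orth_β x) (H.mm_orth_γ x) k

theorem zpow_apply (k : ℤ) (x : V) : R.ρ (H.g ^ k) x =
    (H.lam ^ k * H.cp x) • H.p + (H.lam ^ (-k) * H.cq x) • H.q + H.mm x := by
  conv_lhs => rw [H.decomp x]
  rw [map_add, map_add, map_smul, map_smul, zpow_p, zpow_q, zpow_mm]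
  module

theorem cp_zpow (k : ℤ) (x : V) : H.cp (R.ρ (H.g ^ k) x) = H.lam ^ k * H.cp x := by
  rw [zpow_apply]
  simp [H.cp_mm x]

theorem tendsto_lam_pow : Tendsto (fun k : ℕ => H.lam ^ (k : ℤ)) UF atTop := by
  simp only [zpow_natCast]
  exact (tendsto_pow_atTop_atTop_of_one_lt H.one_lt_lam).mono_left uf_le_atTop

theorem tendsto_lam_neg_pow : Tendsto (fun k : ℕ => H.lam ^ (-(k : ℤ))) UF (𝓝 0) := by
  simp only [zpow_neg]
  exact H.tendsto_lam_pow.inv_tendsto_atTop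

theorem lam_zpow_ne (k : ℤ) : H.lam ^ k ≠ 0 := zpow_ne_zero _ H.lam_pos.ne'

theorem tendsto_zpow_smul (x : V) :
    Tendsto (fun k : ℕ => H.lam ^ (-(k : ℤ)) • R.ρ (H.g ^ (k : ℤ)) x) UF
      (𝓝 (H.cp x • H.p)) := by
  have h : ∀ k : ℕ, H.lam ^ (-(k : ℤ)) • R.ρ (H.g ^ (k : ℤ)) x =
      H.cp x • H.p + (H.lam ^ (-(k : ℤ)) * H.lam ^ (-(k : ℤ)) * H.cq x) • H.q +
        H.lam ^ (-(k : ℤ)) • H.mm x := fun k => by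
    have h1 : H.lam ^ (-(k : ℤ)) * H.lam ^ (k : ℤ) = 1 := by
      rw [zpow_neg, inv_mul_cancel₀ (H.lam_zpow_ne _)]
    rw [zpow_apply, smul_add, smul_add, smul_smul, smul_smul, ← mul_assoc, h1, one_mul, mul_assoc]
  simp only [h]
  have h0 := H.tendsto_lam_neg_pow
  have := (tendsto_const_nhds (x := H.cp x • H.p)).add
    (((h0.mul h0).mul_const (H.cq x)).smul_const H.q) |>.add (h0.smul_const (H.mm x))
  simpa using this

theorem tendsto_neg_zpow_smul (x : V) :
    Tendsto (fun k : ℕ => H.lam ^ (-(k : ℤ)) • R.ρ (H.g ^ (-(k : ℤ))) x) UF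
      (𝓝 (H.cq x • H.q)) := by
  have := H.swap.tendsto_zpow_smul x
  simpa only [swap_lam, swap_g, inv_zpow', swap_cp, swap_p] using this

end HypPair

theorem smul_add_mem_or_neg_mem (R : RootData W V) {β γ : V} {r : ℝ} (hβ : β ∈ R.Φ) (hγ : γ ∈ R.Φ)
    (hr : 1 < r) (hB : R.B β γ = -(r + r⁻¹) / 2) : r • β + γ ∈ R.L ∨ -(r • β + γ) ∈ R.L := by
  have hr0 : r ≠ 0 := (one_pos.trans hr).ne'
  have hr1 : 1 < r ^ 2 := one_lt_pow₀ hr two_ne_zero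
  have hB' : R.B γ β = -(r + r⁻¹) / 2 := by rw [R.comm, hB]
  set p := r • β + γ with hp
  set q := r • γ + β with hq
  have h1 : R.ρ (R.s γ) p = r • q := R.s_smul_add hγ hr hB
  have h2 : R.ρ (R.s β) q = r • p := R.s_smul_add hβ hr hB'
  have h3 : R.ρ (R.s β) p = r⁻¹ • q := by
    have h := congrArg (R.ρ (R.s β)) h2
    rw [R.s_s hβ, map_smul] at h
    rw [h, smul_smul, inv_mul_cancel₀ hr0, one_smul]
  have h4 : R.ρ (R.s γ) q = r⁻¹ • p := by
    have h := congrArg (R.ρ (R.s γ)) h1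
    rw [R.s_s hγ, map_smul] at h
    rw [h, smul_smul, inv_mul_cancel₀ hr0, one_smul]
  have h5 : ∀ k : ℕ, (r ^ 2 - 1) • R.ρ ((R.s β * R.s γ) ^ k) β =
      (r * (r ^ 2) ^ k) • p - ((r ^ 2) ^ k)⁻¹ • q := by
    intro k
    induction k with
    | zero =>
      rw [pow_zero, pow_zero, one_apply, hp, hq]
      module
    | succ k ih =>
      rw [pow_succ' (R.s β * R.s γ), mul_apply, ← map_smul, ih, map_sub, map_smul, map_smul, mul_apply, mul_apply,
        h1, h4, map_smul, map_smul, h2, h3, smul_smul, smul_smul, smul_smul, smul_smul]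
      congr 2
      · ring
      · field_simp
        ring
  have hlim : Tendsto (fun k : ℕ => (r ^ 2) ^ k) UF atTop :=
    (tendsto_pow_atTop_atTop_of_one_lt hr1).mono_left uf_le_atTop
  have hlim' := hlim.inv_tendsto_atTop
  have hc : 0 < (r ^ 2 - 1) / r := div_pos (sub_pos.2 hr1) (one_pos.trans hr)
  refine R.L_limit (fun k => R.ρ ((R.s β * R.s γ) ^ k) β)
    (fun k => (r ^ 2 - 1) / r * ((r ^ 2) ^ k)⁻¹) p (fun k => R.Φ_map _ _ hβ) ?_ (fun k => ?_) ?_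
  · simpa using hlim'.const_mul ((r ^ 2 - 1) / r)
  · positivity
  · have h6 : ∀ k : ℕ, ((r ^ 2 - 1) / r * ((r ^ 2) ^ k)⁻¹) • R.ρ ((R.s β * R.s γ) ^ k) β =
        p - (r⁻¹ * (((r ^ 2) ^ k)⁻¹ * ((r ^ 2) ^ k)⁻¹)) • q := fun k => by
      have h7 : (r ^ 2 - 1) / r * ((r ^ 2) ^ k)⁻¹ = (r⁻¹ * ((r ^ 2) ^ k)⁻¹) * (r ^ 2 - 1) := by ring
      have h8 : r⁻¹ * ((r ^ 2) ^ k)⁻¹ * (r * (r ^ 2) ^ k) = 1 := by field_simp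
      rw [h7, mul_smul, h5, smul_sub, smul_smul, smul_smul, h8, one_smul, mul_assoc]
    simp only [h6]
    simpa using (tendsto_const_nhds (x := p)).sub
      (((hlim'.mul hlim').const_mul r⁻¹).smul_const q)

theorem exists_hypPair (R : RootData W V) {β γ : V} (hβ : β ∈ R.Φ) (hγ : γ ∈ R.Φ)
    (h : 1 < |R.B β γ|) :
    ∃ H : R.HypPair, (H.β = β ∨ H.β = -β) ∧ (H.γ = γ ∨ H.γ = -γ) := by
  have key : ∀ γ ∈ R.Φ, R.B β γ < -1 →
      ∃ H : R.HypPair, (H.β = β ∧ H.γ = γ) ∨ (H.β = -β ∧ H.γ = -γ) := by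
    intro γ hγ hlt
    set c := -R.B β γ with hc
    have hc1 : 1 < c := by linarith
    set r := c + √(c ^ 2 - 1) with hr
    have hsq : √(c ^ 2 - 1) ^ 2 = c ^ 2 - 1 := Real.sq_sqrt (by nlinarith)
    have hr1 : 1 < r := by linarith [Real.sqrt_nonneg (c ^ 2 - 1)]
    have hinv : r⁻¹ = c - √(c ^ 2 - 1) := by
      refine inv_eq_of_mul_eq_one_right ?_
      rw [hr]; linear_combination -hsq
    have hB : R.B β γ = -(r + r⁻¹) / 2 := by
      rw [hinv, hr]; linarith
    have hB' : R.B γ β = -(r + r⁻¹) / 2 := by rw [R.comm, hB]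
    have hpq : 2 * r * R.B (r • β + γ) (r • γ + β) = -(r ^ 2 - 1) ^ 2 := by
      have h1 : r * r⁻¹ = 1 := mul_inv_cancel₀ (by linarith)
      simp only [map_add, map_smul, LinearMap.add_apply, LinearMap.smul_apply, smul_eq_mul,
        R.Φ_self _ hβ, R.Φ_self _ hγ, hB, hB']
      linear_combination -(r ^ 2 + 1) * h1
    have hpq' : R.B (r • β + γ) (r • γ + β) < 0 := by
      have h3 : 0 < (r ^ 2 - 1) ^ 2 := pow_pos (by nlinarith) 2
      by_contra! h
      nlinarith
    rcases R.smul_add_mem_or_neg_mem hβ hγ hr1 hB with hp | hp <;>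
      rcases R.smul_add_mem_or_neg_mem hγ hβ hr1 hB' with hq | hq
    · exact ⟨⟨β, γ, r, hβ, hγ, hr1, hB, hp, hq⟩, Or.inl ⟨rfl, rfl⟩⟩
    · have := R.L_nonpos _ hp _ hq
      rw [map_neg] at this
      linarith
    · have := R.L_nonpos _ hp _ hq
      rw [map_neg, LinearMap.neg_apply] at this
      linarith
    · refine ⟨⟨-β, -γ, r, R.neg_mem hβ, R.neg_mem hγ, hr1, by simpa using hB, ?_, ?_⟩,
        Or.inr ⟨rfl, rfl⟩⟩
      · convert hp using 1; module
      · convert hq using 1; module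
  rcases lt_abs.1 h with h1 | h1
  · obtain ⟨H, h2⟩ := key (-γ) (R.neg_mem hγ) (by rw [map_neg]; linarith)
    rw [neg_neg] at h2
    exact ⟨H, by tauto, by tauto⟩
  · obtain ⟨H, h2⟩ := key γ hγ (by linarith)
    exact ⟨H, by tauto, by tauto⟩

end RootData

end CoxeterTits

namespace CoxeterTits

open Filter Topology

theorem eq_of_tendsto_uf {X : Type*} [TopologicalSpace X] [T2Space X] {f : ℕ → X} {x c : X}
    (h : Tendsto f UF (𝓝 x)) (hc : ∀ᶠ k in UF, f k = c) : x = c :=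
  tendsto_nhds_unique h (tendsto_nhds_of_eventually_eq hc)

namespace RootData

variable {W : Type*} [Group W] {V : Type*} [NormedAddCommGroup V] [NormedSpace ℝ V]

namespace HypPair

variable {R : RootData W V} (H : R.HypPair)

theorem β_eq : H.β = (H.r ^ 2 - 1)⁻¹ • (H.r • H.p - H.q) := by
  rw [← lam_sub_one_smul_β, smul_smul, inv_mul_cancel₀ H.lam_sub_one_pos.ne', one_smul]

theorem cp_β_pos : 0 < H.cp H.β := by
  rw [β_eq]
  simpa using mul_pos (inv_pos.2 H.lam_sub_one_pos) H.r_pos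

theorem cq_β_neg : H.cq H.β < 0 := by
  rw [β_eq]
  simpa using H.lam_sub_one_pos

theorem orth_sub {x : V} (h : R.B x H.p = 0) (h' : R.B x H.q = 0) (y : V) :
    R.B x (H.mm y) = R.B x y := by
  rw [mm_apply, map_sub, map_sub, map_smul, map_smul, h, h', smul_zero, smul_zero, sub_zero,
    sub_zero]

/-- No nonzero limit direction is orthogonal to the pair. -/
def Regular : Prop := ∀ z ∈ R.L, R.B z H.β = 0 → R.B z H.γ = 0 → z = 0

/-- The roots orthogonal to the pair. -/
def orthRoots : Set V := {δ | δ ∈ R.Φ ∧ R.B δ H.β = 0 ∧ R.B δ H.γ = 0}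

section FiniteDimensional

variable [FiniteDimensional ℝ V]

theorem eventually_one_lt_abs {ε : V} (hε : R.B ε H.q ≠ 0) :
    ∀ᶠ k : ℕ in UF, 1 < |R.B (R.ρ (H.g ^ (k : ℤ)) ε) (R.ρ (H.g ^ (-(k : ℤ))) H.β)| := by
  have h1 := tendsto_bilin R.B (H.tendsto_zpow_smul ε) (H.tendsto_neg_zpow_smul H.β)
  have hne : R.B (H.cp ε • H.p) (H.cq H.β • H.q) ≠ 0 := by
    simp only [map_smul, LinearMap.smul_apply, smul_eq_mul]
    refine mul_ne_zero H.cq_β_neg.ne (mul_ne_zero ?_ H.pq_ne)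
    rw [form_q] at hε
    exact right_ne_zero_of_mul hε
  have h2 : Tendsto (fun k : ℕ => H.lam ^ (k : ℤ) * H.lam ^ (k : ℤ)) UF atTop :=
    H.tendsto_lam_pow.atTop_mul_atTop₀ H.tendsto_lam_pow
  have h3 := h2.atTop_mul_pos (abs_pos.2 hne) h1.abs
  refine (h3.eventually_gt_atTop 1).mono fun k hk => ?_
  refine hk.trans_eq ?_
  have h4 : H.lam ^ (k : ℤ) * H.lam ^ (-(k : ℤ)) = 1 := by
    rw [zpow_neg, mul_inv_cancel₀ (H.lam_zpow_ne _)]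
  have h5 : 0 < H.lam ^ (k : ℤ) * H.lam ^ (k : ℤ) :=
    mul_pos (zpow_pos H.lam_pos _) (zpow_pos H.lam_pos _)
  rw [← abs_of_pos h5, ← abs_mul]
  congr 1
  simp only [map_smul, LinearMap.smul_apply, smul_eq_mul]
  linear_combination (H.lam ^ (k : ℤ) * H.lam ^ (-(k : ℤ)) + 1) *
    (R.B (R.ρ (H.g ^ (k : ℤ)) ε)) ((R.ρ (H.g ^ (-(k : ℤ)))) H.β) * h4

theorem eventually_no_limit {ε : V} (hεΦ : ε ∈ R.Φ) (hε : R.B ε H.q ≠ 0) {D : Set V}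
    (hD : ∀ z ∈ R.L, (∀ δ ∈ D, R.B z δ = 0) → R.B z H.β = 0 → R.B z H.γ = 0 → R.B z ε = 0 → z = 0) :
    ∀ᶠ k : ℕ in UF, ∀ z ∈ R.L, (∀ δ ∈ D, R.B z δ = 0) → R.B z (R.ρ (H.g ^ (k : ℤ)) ε) = 0 →
      R.B z (R.ρ (H.g ^ (-(k : ℤ))) H.β) = 0 → z = 0 := by
  by_contra hcon
  rw [uf_not] at hcon
  push Not at hcon
  have hcon' : ∀ᶠ k : ℕ in UF, ∃ z ∈ R.L, ‖z‖ = 1 ∧ (∀ δ ∈ D, R.B z δ = 0) ∧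
      R.B z (R.ρ (H.g ^ (k : ℤ)) ε) = 0 ∧ R.B z (R.ρ (H.g ^ (-(k : ℤ))) H.β) = 0 := by
    refine hcon.mono fun k hk => ?_
    obtain ⟨z, hz, h1, h2, h3, h4⟩ := hk
    refine ⟨‖z‖⁻¹ • z, R.L_smul _ (inv_pos.2 (norm_pos_iff.2 h4)) _ hz, ?_, fun δ hδ => ?_, ?_, ?_⟩
    · rw [norm_smul, norm_inv, norm_norm, inv_mul_cancel₀ (norm_ne_zero_iff.2 h4)]
    · simp [h1 δ hδ]
    · rw [map_smul, LinearMap.smul_apply, h2, smul_zero]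
    · rw [map_smul, LinearMap.smul_apply, h3, smul_zero]
  obtain ⟨z, hz⟩ := hcon'.choice
  obtain ⟨z0, hlim⟩ := uf_exists_tendsto_of_norm_le (hz.mono fun k hk => hk.2.1.le)
  have hz0L : z0 ∈ R.L := R.L_closed.mem_of_tendsto hlim (hz.mono fun k hk => hk.1)
  have hz01 : ‖z0‖ = 1 := tendsto_nhds_unique hlim.norm
    (tendsto_const_nhds.congr' (hz.mono fun k hk => hk.2.1.symm))
  have hA : H.cp ε ≠ 0 := by
    rw [form_q] at hε
    exact right_ne_zero_of_mul hε
  have hp : R.B z0 H.p = 0 := by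
    have h1 := tendsto_bilin R.B hlim (H.tendsto_zpow_smul ε)
    have h2 := eq_of_tendsto_uf h1 (hz.mono fun k hk => by
      rw [map_smul, hk.2.2.2.1, smul_zero])
    rw [map_smul, smul_eq_mul] at h2
    exact (mul_eq_zero.1 h2).resolve_left hA
  have hq : R.B z0 H.q = 0 := by
    have h1 := tendsto_bilin R.B hlim (H.tendsto_neg_zpow_smul H.β)
    have h2 := eq_of_tendsto_uf h1 (hz.mono fun k hk => by
      rw [map_smul, hk.2.2.2.2, smul_zero])
    rw [map_smul, smul_eq_mul] at h2
    exact (mul_eq_zero.1 h2).resolve_left H.cq_β_neg.ne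
  have h1 : 0 ≤ H.cp ε * R.B z0 ε := by
    have h2 : Tendsto (fun k : ℕ => H.cp ε * R.B (z k) (H.mm ε) +
        H.cp ε * H.cq ε * (H.lam ^ (-(k : ℤ)) * R.B (z k) H.q)) UF
        (𝓝 (H.cp ε * R.B z0 (H.mm ε) + H.cp ε * H.cq ε * (0 * R.B z0 H.q))) :=
      ((tendsto_bilin R.B hlim tendsto_const_nhds).const_mul _).add
        ((H.tendsto_lam_neg_pow.mul (tendsto_bilin R.B hlim tendsto_const_nhds)).const_mul _)
    rw [zero_mul, mul_zero, add_zero, H.orth_sub hp hq] at h2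
    refine ge_of_tendsto h2 (hz.mono fun k hk => ?_)
    have h3 := hk.2.2.2.1
    rw [zpow_apply, map_add, map_add, map_smul, map_smul, smul_eq_mul, smul_eq_mul] at h3
    have h4 : H.cp ε * R.B (z k) (H.mm ε) + H.cp ε * H.cq ε * (H.lam ^ (-(k : ℤ)) * R.B (z k) H.q)
        = H.cp ε ^ 2 * H.lam ^ (k : ℤ) * (-R.B (z k) H.p) := by
      linear_combination H.cp ε * h3
    rw [h4]
    exact mul_nonneg (mul_nonneg (sq_nonneg _) (zpow_nonneg H.lam_pos.le _))
      (neg_nonneg.2 (R.L_nonpos _ hk.1 _ H.p_mem))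
  have h2 : R.B (R.ρ (R.s ε) z0) H.q ≤ 0 := R.L_nonpos _ (R.L_map _ _ hz0L) _ H.q_mem
  rw [R.s_apply _ hεΦ, map_sub, LinearMap.sub_apply, hq, map_smul, LinearMap.smul_apply,
    smul_eq_mul, form_q] at h2
  have h3 : R.B z0 ε = 0 := by
    have h4 : 0 ≤ -(H.cp ε * R.B z0 ε) := by
      by_contra! h5
      nlinarith [H.pq_neg]
    exact (mul_eq_zero.1 (le_antisymm (neg_nonneg.1 h4) h1)).resolve_left hA
  have h4 := H.orth_iff.1 ⟨hp, hq⟩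
  have h5 : z0 = 0 := hD z0 hz0L (fun δ hδ => tendsto_nhds_unique
    (tendsto_bilin R.B hlim (tendsto_const_nhds (x := δ)))
    (tendsto_const_nhds.congr' (hz.mono fun k hk => (hk.2.2.1 δ hδ).symm))) h4.1 h4.2 h3
  rw [h5, norm_zero] at hz01
  exact zero_ne_one hz01

theorem absorb {ε : V} (hεΦ : ε ∈ R.Φ) (hε : R.B ε H.q ≠ 0) {D : Set V}
    (hD : ∀ z ∈ R.L, (∀ δ ∈ D, R.B z δ = 0) → R.B z H.β = 0 → R.B z H.γ = 0 → R.B z ε = 0 → z = 0) :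
    ∀ᶠ k : ℕ in UF, ∃ K : R.HypPair,
      (∀ x, R.B x K.β = 0 ↔ R.B x (R.ρ (H.g ^ (k : ℤ)) ε) = 0) ∧
      (∀ x, R.B x K.γ = 0 ↔ R.B x (R.ρ (H.g ^ (-(k : ℤ))) H.β) = 0) ∧
      ∀ z ∈ R.L, (∀ δ ∈ D, R.B z δ = 0) → R.B z K.β = 0 → R.B z K.γ = 0 → z = 0 := by
  filter_upwards [H.eventually_one_lt_abs hε, H.eventually_no_limit hεΦ hε hD] with k h1 h2
  obtain ⟨K, h3, h4⟩ := R.exists_hypPair (R.Φ_map _ _ hεΦ) (R.Φ_map _ _ H.hβ) h1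
  have h5 : ∀ x, R.B x K.β = 0 ↔ R.B x (R.ρ (H.g ^ (k : ℤ)) ε) = 0 := fun x => by
    rcases h3 with h | h <;> simp [h]
  have h6 : ∀ x, R.B x K.γ = 0 ↔ R.B x (R.ρ (H.g ^ (-(k : ℤ))) H.β) = 0 := fun x => by
    rcases h4 with h | h <;> simp [h]
  exact ⟨K, h5, h6, fun z hz hδ h7 h8 => h2 z hz hδ ((h5 z).1 h7) ((h6 z).1 h8)⟩

theorem finite_orthRoots (hH : H.Regular) : H.orthRoots.Finite := by
  refine finite_of_forall_seq fun f hf => ?_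
  rcases R.seq_dichotomy (Eventually.of_forall fun k => (hf k).1) with ⟨a, -, h⟩ | ⟨-, z, hz, hz1, c, hc, hlim⟩
  · exact ⟨a, h⟩
  · exfalso
    have h : ∀ y, (∀ k, R.B (f k) y = 0) → R.B z y = 0 := fun y hy =>
      tendsto_nhds_unique (tendsto_bilin R.B hlim tendsto_const_nhds) (by simp [hy])
    have h0 := hH z hz (h _ fun k => (hf k).2.1) (h _ fun k => (hf k).2.2)
    rw [h0, norm_zero] at hz1
    exact zero_ne_one hz1

end FiniteDimensional

end HypPair

variable (R : RootData W V)

theorem exists_root_nonorth_of_mem_L {z : V} (hz : z ∈ R.L) (h : z ≠ 0) :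
    ∃ β ∈ R.Φ, R.B β z ≠ 0 := by
  by_contra! hcon
  exact h (R.L_rad z hz fun β hβ => by rw [R.comm, hcon β hβ])

theorem exists_root_nonorth_of_root {δ : V} (hδ : δ ∈ R.Φ) : ∃ β ∈ R.Φ, R.B β δ ≠ 0 :=
  ⟨δ, hδ, by rw [R.Φ_self δ hδ]; exact one_ne_zero⟩

variable [FiniteDimensional ℝ V]

theorem exists_regular : ∃ H : R.HypPair, H.Regular := by
  classical
  have key : ∀ D : Finset V, (∀ δ ∈ D, δ ∈ R.Φ) → (∃ H : R.HypPair, ∀ z ∈ R.L,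
      (∀ δ ∈ D, R.B z δ = 0) → R.B z H.β = 0 → R.B z H.γ = 0 → z = 0) →
      ∃ H : R.HypPair, H.Regular := by
    intro D
    induction D using Finset.induction_on with
    | empty =>
      rintro - ⟨H, hH⟩
      exact ⟨H, fun z hz => hH z hz (by simp)⟩
    | insert δ D hδD ih =>
      rintro hΦ ⟨H, hH⟩
      have hδ : δ ∈ R.Φ := hΦ δ (by simp)
      have key1 : ∀ K : R.HypPair, (∀ z ∈ R.L, (∀ δ' ∈ insert δ D, R.B z δ' = 0) →
          R.B z K.β = 0 → R.B z K.γ = 0 → z = 0) → R.B δ K.q ≠ 0 →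
          ∃ H : R.HypPair, H.Regular := by
        intro K hK hδK
        obtain ⟨k, K', -, -, h⟩ := (K.absorb hδ hδK (D := D) fun z hz h1 h2 h3 h4 =>
          hK z hz (by simpa [h4] using h1) h2 h3).exists
        exact ih (fun δ' h' => hΦ δ' (by simp [h'])) ⟨K', h⟩
      have key2 : ∀ K : R.HypPair, (∀ z ∈ R.L, (∀ δ' ∈ insert δ D, R.B z δ' = 0) →
          R.B z K.β = 0 → R.B z K.γ = 0 → z = 0) → (R.B δ K.β ≠ 0 ∨ R.B δ K.γ ≠ 0) →
          ∃ H : R.HypPair, H.Regular := by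
        intro K hK hδK
        have h1 : ¬ (R.B δ K.p = 0 ∧ R.B δ K.q = 0) := by
          rw [K.orth_iff]; tauto
        rw [not_and_or] at h1
        rcases h1 with h1 | h1
        · exact key1 K.swap (fun z hz h2 h3 h4 => hK z hz h2 h4 h3) h1
        · exact key1 K hK h1
      by_cases hor : R.B δ H.β ≠ 0 ∨ R.B δ H.γ ≠ 0
      · exact key2 H hH hor
      push Not at hor
      obtain ⟨ε, hε, hεδ, hεq⟩ := R.nonorth δ H.q (R.exists_root_nonorth_of_root hδ)
        (R.exists_root_nonorth_of_mem_L H.q_mem H.q_ne_zero)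
      obtain ⟨k, K, h1, -, h2⟩ := (H.absorb hε hεq (D := ((insert δ D : Finset V) : Set V))
        fun z hz h1 h2 h3 h4 => hH z hz h1 h2 h3).exists
      refine key2 K h2 (Or.inl fun h3 => hεδ ?_)
      rw [h1] at h3
      have h4 := R.inv (H.g ^ (k : ℤ)) δ ε
      rw [H.zpow_of_orth hor.1 hor.2, h3] at h4
      rw [R.comm, ← h4]
  obtain ⟨β, hβ, γ, hγ, h⟩ := R.hyp
  obtain ⟨H, -⟩ := R.exists_hypPair hβ hγ h
  refine key R.Δ R.Δ_sub ⟨H, fun z hz h1 _ _ => R.L_rad z hz fun β _ => ?_⟩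
  have h2 : R.B z = 0 := LinearMap.ext_on R.Δ_span fun δ hδ => by simpa using h1 δ hδ
  rw [h2, LinearMap.zero_apply]

theorem exists_generic : ∃ H : R.HypPair, H.Regular ∧ H.orthRoots = ∅ := by
  have key : ∀ n : ℕ, ∀ H : R.HypPair, H.Regular → H.orthRoots.ncard = n →
      ∃ H : R.HypPair, H.Regular ∧ H.orthRoots = ∅ := by
    intro n
    induction n using Nat.strong_induction_on with
    | _ n ih =>
      intro H hH hn
      rcases H.orthRoots.eq_empty_or_nonempty with h0 | ⟨δ, hδ⟩
      · exact ⟨H, hH, h0⟩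
      obtain ⟨ε, hε, hεδ, hεq⟩ := R.nonorth δ H.q (R.exists_root_nonorth_of_root hδ.1)
        (R.exists_root_nonorth_of_mem_L H.q_mem H.q_ne_zero)
      have h1 := H.absorb hε hεq (D := ∅) fun z hz _ h2 h3 _ => hH z hz h2 h3
      have hA : H.cp ε ≠ 0 := by
        rw [H.form_q] at hεq
        exact right_ne_zero_of_mul hεq
      have h2 : ∀ᶠ k : ℕ in UF, ∀ δ' ∈ R.Φ, R.B δ' (R.ρ (H.g ^ (k : ℤ)) ε) = 0 →
          R.B δ' (R.ρ (H.g ^ (-(k : ℤ))) H.β) = 0 → δ' ∈ H.orthRoots \ {δ} := by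
        by_contra hcon
        rw [uf_not] at hcon
        push Not at hcon
        obtain ⟨f, hf⟩ := hcon.choice
        have hlimit : ∀ (c : ℕ → ℝ) (z : V), Tendsto (fun k => c k • f k) UF (𝓝 z) →
            R.B z H.β = 0 ∧ R.B z H.γ = 0 := by
          intro c z hlim
          rw [← H.orth_iff]
          constructor
          · have h3 := tendsto_bilin R.B hlim (H.tendsto_zpow_smul ε)
            have h4 := eq_of_tendsto_uf h3 (hf.mono fun k hk => by
              rw [map_smul, map_smul, LinearMap.smul_apply, hk.2.1, smul_zero, smul_zero])
            rw [map_smul, smul_eq_mul] at h4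
            exact (mul_eq_zero.1 h4).resolve_left hA
          · have h3 := tendsto_bilin R.B hlim (H.tendsto_neg_zpow_smul H.β)
            have h4 := eq_of_tendsto_uf h3 (hf.mono fun k hk => by
              rw [map_smul, map_smul, LinearMap.smul_apply, hk.2.2.1, smul_zero, smul_zero])
            rw [map_smul, smul_eq_mul] at h4
            exact (mul_eq_zero.1 h4).resolve_left H.cq_β_neg.ne
        rcases R.seq_dichotomy (hf.mono fun k hk => hk.1) with
          ⟨a, ha, h⟩ | ⟨-, z, hz, hz1, c, hc, hlim⟩
        · have h3 := hlimit (fun _ => 1) a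
            (tendsto_nhds_of_eventually_eq (h.mono fun k hk => by rw [hk, one_smul]))
          obtain ⟨k, h4, h5⟩ := (hf.and h).exists
          rw [h5] at h4
          refine h4.2.2.2 ⟨⟨ha, h3⟩, fun h6 => hεδ ?_⟩
          have h7 := R.inv (H.g ^ (k : ℤ)) a ε
          rw [H.zpow_of_orth h3.1 h3.2, h4.2.1] at h7
          rw [R.comm, ← Set.mem_singleton_iff.1 h6, ← h7]
        · have h3 := hlimit c z hlim
          have h0 := hH z hz h3.1 h3.2
          rw [h0, norm_zero] at hz1
          exact zero_ne_one hz1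
      obtain ⟨k, ⟨K, h3, h4, h5⟩, h6⟩ := (h1.and h2).exists
      refine ih _ ?_ K (fun z hz => h5 z hz (by simp)) rfl
      rw [← hn]
      refine Set.ncard_lt_ncard ?_ (H.finite_orthRoots hH)
      refine ⟨fun x hx => (h6 x hx.1 ((h3 x).1 hx.2.1) ((h4 x).1 hx.2.2)).1, fun hsub => ?_⟩
      have hx := hsub hδ
      exact (h6 δ hx.1 ((h3 δ).1 hx.2.1) ((h4 δ).1 hx.2.2)).2 rfl
  obtain ⟨H, hH⟩ := R.exists_regular
  exact key _ H hH rfl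

end RootData

end CoxeterTits

namespace CoxeterTits

open Filter Topology

namespace RootData

variable {W : Type*} [Group W] {V : Type*} [NormedAddCommGroup V] [NormedSpace ℝ V]
  {R : RootData W V}

/-- A limit direction is regular if it is orthogonal only to its own multiples. -/
def Reg (R : RootData W V) (P : V) : Prop := P ∈ R.L ∧ ∀ z ∈ R.L, R.B z P = 0 → ∃ c : ℝ, z = c • P

theorem form_add_ne_zero {P Q : V} (hP : R.Reg P) (hQ : Q ∈ R.L) (hPQ : R.B P Q ≠ 0) {z : V}
    (hz : z ∈ R.L) (hz0 : z ≠ 0) : R.B (P + Q) z ≠ 0 := by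
  intro h
  rw [map_add, LinearMap.add_apply] at h
  have h1 := R.L_nonpos _ hP.1 _ hz
  have h2 := R.L_nonpos _ hQ _ hz
  obtain ⟨c, rfl⟩ := hP.2 z hz (by rw [R.comm]; linarith)
  have h3 : R.B Q (c • P) = 0 := by linarith
  rw [map_smul, R.comm, smul_eq_mul] at h3
  rcases mul_eq_zero.1 h3 with h4 | h4
  · exact hz0 (by rw [h4, zero_smul])
  · exact hPQ h4

theorem eventually_const [FiniteDimensional ℝ V] {P Q : V} (hP : R.Reg P) (hQ : Q ∈ R.L)
    (hPQ : R.B P Q ≠ 0) {u : ℕ → W} {y : ℕ → V} {x : V} (hy : Tendsto y UF (𝓝 (P + Q)))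
    (hu : Tendsto (fun k => R.ρ (u k) (y k)) UF (𝓝 x)) : ∃ w, ∀ᶠ k in UF, u k = w := by
  have h1 : ∀ δ ∈ R.Δ, ∃ a, ∀ᶠ k in UF, R.ρ (u k)⁻¹ δ = a := by
    intro δ hδ
    rcases R.seq_dichotomy (f := fun k => R.ρ (u k)⁻¹ δ)
      (Eventually.of_forall fun k => R.Φ_map _ _ (R.Δ_sub δ hδ)) with
      ⟨a, -, h⟩ | ⟨-, z, hz, hz1, c, hc, hlim⟩
    · exact ⟨a, h⟩
    · exfalso
      have h2 := tendsto_bilin R.B hy hlim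
      have h3 := hc.mul (tendsto_bilin R.B hu (tendsto_const_nhds (x := δ)))
      rw [zero_mul] at h3
      have h4 : ∀ k, c k * R.B (R.ρ (u k) (y k)) δ = R.B (y k) (c k • R.ρ (u k)⁻¹ δ) := fun k => by
        rw [map_smul, smul_eq_mul, R.comm (y k), R.form_inv_left, R.comm]
      simp only [h4] at h3
      refine form_add_ne_zero hP hQ hPQ hz ?_ (tendsto_nhds_unique h2 h3)
      rintro rfl
      simp at hz1
  choose! a ha using h1
  have h2 : ∀ᶠ k in UF, ∀ δ ∈ R.Δ, R.ρ (u k)⁻¹ δ = a δ := (eventually_all_finset R.Δ).2 ha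
  obtain ⟨k0, hk0⟩ := h2.exists
  refine ⟨u k0, h2.mono fun k hk => inv_injective (R.ext_Δ fun δ hδ => ?_)⟩
  rw [hk δ hδ, hk0 δ hδ]

namespace HypPair

variable (H : R.HypPair)

theorem cp_nonneg {z : V} (hz : z ∈ R.L) : 0 ≤ H.cp z :=
  mul_nonneg_of_nonpos_of_nonpos (inv_nonpos.2 H.pq_neg.le) (R.L_nonpos _ H.q_mem _ hz)

theorem cq_nonneg {z : V} (hz : z ∈ R.L) : 0 ≤ H.cq z :=
  mul_nonneg_of_nonpos_of_nonpos (inv_nonpos.2 H.pq_neg.le) (R.L_nonpos _ H.p_mem _ hz)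

/-- A pair with no orthogonal limit directions and no orthogonal roots. -/
def Generic : Prop := H.Regular ∧ H.orthRoots = ∅

/-- `w` acts on the two ends by `τ` and `τ⁻¹`. -/
def Fix (w : W) (τ : ℝ) : Prop := 0 < τ ∧ R.ρ w H.p = τ • H.p ∧ R.ρ w H.q = τ⁻¹ • H.q

/-- `w` exchanges the two ends. -/
def Flip (w : W) (τ : ℝ) : Prop := 0 < τ ∧ R.ρ w H.p = τ • H.q ∧ R.ρ w H.q = τ⁻¹ • H.p

theorem smul_p_ne_smul_q {a b : ℝ} (ha : a ≠ 0) : a • H.p ≠ b • H.q := fun h => by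
  have := congrArg H.cp h
  simp [ha] at this

theorem Flip.swap {w : W} {τ : ℝ} (h : H.Flip w τ) : H.swap.Flip w τ⁻¹ :=
  ⟨inv_pos.2 h.1, h.2.2, by rw [inv_inv]; exact h.2.1⟩

theorem Fix.swap {w : W} {τ : ℝ} (h : H.Fix w τ) : H.swap.Fix w τ⁻¹ :=
  ⟨inv_pos.2 h.1, h.2.2, by rw [inv_inv]; exact h.2.1⟩

theorem Regular.swap (hH : H.Regular) : H.swap.Regular := fun z hz h1 h2 => hH z hz h2 h1

theorem fix_one : H.Fix 1 1 := ⟨one_pos, by simp, by simp⟩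

theorem fix_g : H.Fix H.g H.lam := ⟨H.lam_pos, H.g_p, H.g_q⟩

theorem flip_s : H.Flip (R.s H.β) H.r⁻¹ :=
  ⟨inv_pos.2 H.r_pos, H.s_β_p, by rw [inv_inv]; exact H.s_β_q⟩

variable {H}

theorem Fix.mul {u w : W} {a b : ℝ} (hu : H.Fix u a) (hw : H.Fix w b) : H.Fix (u * w) (a * b) :=
  ⟨mul_pos hu.1 hw.1, by rw [mul_apply, hw.2.1, map_smul, hu.2.1, smul_smul, mul_comm],
    by rw [mul_apply, hw.2.2, map_smul, hu.2.2, smul_smul, mul_inv, mul_comm]⟩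

theorem Fix.inv {u : W} {a : ℝ} (hu : H.Fix u a) : H.Fix u⁻¹ a⁻¹ := by
  refine ⟨inv_pos.2 hu.1, R.apply_injective u ?_, R.apply_injective u ?_⟩
  · rw [apply_inv_self, map_smul, hu.2.1, smul_smul, inv_mul_cancel₀ hu.1.ne', one_smul]
  · rw [apply_inv_self, map_smul, hu.2.2, smul_smul, inv_inv, mul_inv_cancel₀ hu.1.ne', one_smul]

theorem Fix.zpow {u : W} {a : ℝ} (hu : H.Fix u a) (k : ℤ) : H.Fix (u ^ k) (a ^ k) := by
  induction k using Int.induction_on with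
  | zero => simpa using H.fix_one
  | succ k ih => rw [zpow_add_one, zpow_add_one₀ hu.1.ne']; exact ih.mul hu
  | pred k ih => rw [zpow_sub_one, zpow_sub_one₀ hu.1.ne']; exact ih.mul hu.inv

theorem Flip.mul_flip {u w : W} {a b : ℝ} (hu : H.Flip u a) (hw : H.Flip w b) :
    H.Fix (u * w) (b * a⁻¹) :=
  ⟨mul_pos hw.1 (inv_pos.2 hu.1),
    by rw [mul_apply, hw.2.1, map_smul, hu.2.2, smul_smul],
    by rw [mul_apply, hw.2.2, map_smul, hu.2.1, smul_smul, mul_inv, inv_inv]⟩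

theorem Flip.mul_fix {u w : W} {a b : ℝ} (hu : H.Flip u a) (hw : H.Fix w b) :
    H.Flip (u * w) (b * a) :=
  ⟨mul_pos hw.1 hu.1,
    by rw [mul_apply, hw.2.1, map_smul, hu.2.1, smul_smul],
    by rw [mul_apply, hw.2.2, map_smul, hu.2.2, smul_smul, mul_inv]⟩

theorem Fix.mul_flip {u w : W} {a b : ℝ} (hu : H.Fix u a) (hw : H.Flip w b) :
    H.Flip (u * w) (b * a⁻¹) :=
  ⟨mul_pos hw.1 (inv_pos.2 hu.1),
    by rw [mul_apply, hw.2.1, map_smul, hu.2.2, smul_smul],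
    by rw [mul_apply, hw.2.2, map_smul, hu.2.1, smul_smul, mul_inv, inv_inv]⟩

theorem Flip.not_fix {u : W} {a b : ℝ} (hu : H.Flip u a) : ¬ H.Fix u b := fun h =>
  H.smul_p_ne_smul_q h.1.ne' (h.2.1.symm.trans hu.2.1)

theorem Fix.unique {u : W} {a b : ℝ} (h : H.Fix u a) (h' : H.Fix u b) : a = b :=
  smul_left_injective ℝ H.p_ne_zero (h.2.1.symm.trans h'.2.1)

theorem Regular.eq_smul_p (hH : H.Regular) {z : V} (hz : z ∈ R.L) (h : H.cq z = 0) :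
    z = H.cp z • H.p := by
  have h1 : ∀ k : ℕ, R.ρ (H.g ^ (-(k : ℤ))) z = (H.lam ^ (-(k : ℤ)) * H.cp z) • H.p + H.mm z :=
    fun k => by rw [zpow_apply, h, mul_zero, zero_smul, add_zero]
  have h2 : H.mm z ∈ R.L := by
    refine R.L_closed.mem_of_tendsto (b := UF) (f := fun k : ℕ => R.ρ (H.g ^ (-(k : ℤ))) z) ?_
      (Eventually.of_forall fun k => R.L_map _ _ hz)
    simp only [h1]
    simpa using ((H.tendsto_lam_neg_pow.mul_const (H.cp z)).smul_const H.p).add_const (H.mm z)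
  have h3 := H.decomp z
  rwa [hH _ h2 (H.mm_orth_β z) (H.mm_orth_γ z), h, zero_smul, add_zero, add_zero] at h3

theorem Regular.eq_smul_q (hH : H.Regular) {z : V} (hz : z ∈ R.L) (h : H.cp z = 0) :
    z = H.cq z • H.q := by
  simpa using hH.swap.eq_smul_p hz (by simpa using h)

theorem Regular.reg_p (hH : H.Regular) : R.Reg H.p :=
  ⟨H.p_mem, fun z hz h => ⟨H.cp z, hH.eq_smul_p hz (by rw [cq_apply, R.comm H.p z, h, mul_zero])⟩⟩

theorem Regular.eigenvector (hH : H.Regular) {w : W} {τ μ : ℝ} (hw : H.Fix w τ) (hτ : τ ≠ 1)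
    {z : V} (hz : z ∈ R.L) (h : R.ρ w z = μ • z) : z = H.cp z • H.p ∨ z = H.cq z • H.q := by
  have h1 := R.inv w z H.p
  have h2 := R.inv w z H.q
  rw [h, hw.2.1, map_smul, map_smul, LinearMap.smul_apply, smul_eq_mul, smul_eq_mul] at h1
  rw [h, hw.2.2, map_smul, map_smul, LinearMap.smul_apply, smul_eq_mul, smul_eq_mul] at h2
  by_cases hp : R.B z H.p = 0
  · exact Or.inl (hH.eq_smul_p hz (by rw [cq_apply, R.comm H.p z, hp, mul_zero]))
  by_cases hq : R.B z H.q = 0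
  · exact Or.inr (hH.eq_smul_q hz (by rw [cp_apply, R.comm H.q z, hq, mul_zero]))
  exfalso
  have h3 : μ * τ = 1 := mul_right_cancel₀ hp (by linear_combination h1)
  have h4 : μ * τ⁻¹ = 1 := mul_right_cancel₀ hq (by linear_combination h2)
  have h5 : μ = τ := by field_simp [hw.1.ne'] at h4; linarith [mul_inv_cancel₀ hw.1.ne']
  rw [h5] at h3
  rcases mul_self_eq_one_iff.1 h3 with h6 | h6
  · exact hτ h6
  · linarith [hw.1]

variable [FiniteDimensional ℝ V]

theorem Regular.fix_of_apply_p (hH : H.Regular) {w : W} {τ : ℝ} (h : R.ρ w H.p = τ • H.p) :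
    H.Fix w τ := by
  have hτ0 : τ ≠ 0 := by
    rintro rfl
    rw [zero_smul, apply_eq_zero] at h
    exact H.p_ne_zero h
  have hτ : 0 < τ := by
    refine lt_of_le_of_ne ?_ hτ0.symm
    have := H.cp_nonneg (R.L_map w _ H.p_mem)
    rw [h] at this
    simpa using this
  have hcq : H.cq (R.ρ w H.q) = τ⁻¹ := by
    have h1 := R.inv w H.p H.q
    rw [h, map_smul, LinearMap.smul_apply, smul_eq_mul] at h1
    rw [cq_apply, ← h1]
    have h2 := H.pq_ne
    rw [← h1] at h2
    field_simp
    rw [div_self (right_ne_zero_of_mul h2)]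
  have hup : ∀ k : ℕ, R.ρ (H.g ^ (-(k : ℤ)) * w * H.g ^ (k : ℤ)) H.p = τ • H.p := fun k => by
    rw [mul_apply, mul_apply, zpow_p, map_smul, h, map_smul, map_smul, zpow_p, smul_comm τ,
      smul_smul, zpow_neg, mul_inv_cancel₀ (H.lam_zpow_ne _), one_smul]
  have huq : Tendsto (fun k : ℕ => R.ρ (H.g ^ (-(k : ℤ)) * w * H.g ^ (k : ℤ)) H.q) UF
      (𝓝 (τ⁻¹ • H.q)) := by
    rw [← hcq]
    refine (H.tendsto_neg_zpow_smul (R.ρ w H.q)).congr fun k => ?_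
    rw [mul_apply, mul_apply, zpow_q, map_smul, map_smul]
  have hu : Tendsto (fun k : ℕ => R.ρ (H.g ^ (-(k : ℤ)) * w * H.g ^ (k : ℤ)) (H.p + H.q)) UF
      (𝓝 (τ • H.p + τ⁻¹ • H.q)) := by
    simp only [map_add, hup]
    exact huq.const_add _
  obtain ⟨v, hv⟩ := eventually_const hH.reg_p H.q_mem H.pq_ne tendsto_const_nhds hu
  have hvq : τ⁻¹ • H.q = R.ρ v H.q :=
    eq_of_tendsto_uf huq (hv.mono fun k hk => by rw [hk])
  obtain ⟨k, hk⟩ := hv.exists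
  refine ⟨hτ, h, ?_⟩
  have hw : w = H.g ^ (k : ℤ) * v * H.g ^ (-(k : ℤ)) := by rw [← hk]; group
  rw [hw, mul_apply, mul_apply, zpow_q, map_smul, map_smul, ← hvq, map_smul, zpow_q, smul_smul,
    smul_smul, mul_right_comm, ← zpow_add₀ H.lam_pos.ne', neg_add_cancel, zpow_zero, one_mul]

theorem Regular.fix_of_apply_q (hH : H.Regular) {w : W} {τ : ℝ} (h : R.ρ w H.q = τ • H.q) :
    H.Fix w τ⁻¹ :=
  (hH.swap.fix_of_apply_p h).swap

theorem Regular.flip_of_apply_p (hH : H.Regular) {w : W} {τ : ℝ} (h : R.ρ w H.p = τ • H.q) :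
    H.Flip w τ := by
  have h1 : H.Fix (R.s H.β * w) (τ * H.r) := hH.fix_of_apply_p (by
    rw [mul_apply, h, map_smul, s_β_q, smul_smul])
  have h2 := H.flip_s.mul_fix h1
  rwa [← mul_assoc, R.s_mul_self H.hβ, one_mul, mul_assoc, mul_inv_cancel₀ H.r_pos.ne',
    mul_one] at h2

theorem Generic.exists_off_walls (hH : H.Generic) :
    ∃ t : ℝ, 0 < t ∧ ∀ β ∈ R.Φ, R.B (t • H.p + H.q) β ≠ 0 := by
  have hfin : {β | β ∈ R.Φ ∧ ∃ t ∈ Set.Icc (1 : ℝ) 2, R.B (t • H.p + H.q) β = 0}.Finite := by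
    refine finite_of_forall_seq fun f hf => ?_
    rcases R.seq_dichotomy (Eventually.of_forall fun k => (hf k).1) with
      ⟨a, -, h⟩ | ⟨-, z, hz, hz1, c, hc, hlim⟩
    · exact ⟨a, h⟩
    · exfalso
      choose t ht htB using fun k => (hf k).2
      obtain ⟨t0, ht0, htlim⟩ := uf_exists_tendsto_of_mem_Icc (Eventually.of_forall ht)
      have h1 := tendsto_bilin R.B ((htlim.smul_const H.p).add_const H.q) hlim
      have h2 := eq_of_tendsto_uf h1 (c := 0) (Eventually.of_forall fun k => by
        rw [map_smul, htB, smul_zero])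
      have h3 : (0 : ℝ) < t0 := by linarith [ht0.1]
      refine form_add_ne_zero (P := t0 • H.p) ⟨R.L_smul _ h3 _ H.p_mem, fun z hz h => ?_⟩ H.q_mem
        ?_ hz ?_ h2
      · rw [map_smul, smul_eq_mul] at h
        obtain ⟨c, rfl⟩ := hH.1.reg_p.2 z hz ((mul_eq_zero.1 h).resolve_left h3.ne')
        exact ⟨c * t0⁻¹, by rw [smul_smul, inv_mul_cancel_right₀ h3.ne']⟩
      · rw [map_smul, LinearMap.smul_apply, smul_eq_mul]
        exact mul_ne_zero h3.ne' H.pq_ne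
      · rintro rfl
        simp at hz1
  have hbad : {t : ℝ | t ∈ Set.Icc (1 : ℝ) 2 ∧ ∃ β ∈ R.Φ, R.B (t • H.p + H.q) β = 0}.Finite := by
    refine (hfin.biUnion (t := fun β => {t : ℝ | β ∈ R.Φ ∧ R.B (t • H.p + H.q) β = 0})
      fun β _ => Set.Subsingleton.finite fun t ht t' ht' => ?_).subset fun t ht => ?_
    · obtain ⟨hβ, h1⟩ := ht
      obtain ⟨-, h2⟩ := ht'
      rw [map_add, map_smul, LinearMap.add_apply, LinearMap.smul_apply, smul_eq_mul] at h1 h2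
      by_contra hne
      have h3 : R.B H.p β = 0 := by
        have : (t - t') * R.B H.p β = 0 := by linear_combination h1 - h2
        exact (mul_eq_zero.1 this).resolve_left (sub_ne_zero.2 hne)
      have h4 : R.B H.q β = 0 := by rw [h3, mul_zero, zero_add] at h1; exact h1
      have h5 : β ∈ H.orthRoots := ⟨hβ, H.orth_iff.1 ⟨by rw [R.comm, h3], by rw [R.comm, h4]⟩⟩
      rw [hH.2] at h5
      exact h5
    · obtain ⟨ht1, β, hβ, h⟩ := ht
      exact Set.mem_biUnion (show β ∈ _ from ⟨hβ, t, ht1, h⟩) ⟨hβ, h⟩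
  obtain ⟨t, ht, hbad'⟩ := ((Set.Icc_infinite (one_lt_two (α := ℝ))).sdiff hbad).nonempty
  exact ⟨t, by linarith [ht.1], fun β hβ h => hbad' ⟨ht, β, hβ, h⟩⟩

theorem Generic.eq_one (hH : H.Generic) {w : W} (hw : H.Fix w 1) : w = 1 := by
  obtain ⟨t, ht, h⟩ := hH.exists_off_walls
  refine R.stab (t • H.p + H.q) (fun z hz hz0 => lt_of_le_of_ne ?_ ?_) h w ?_
  · rw [map_add, map_smul, LinearMap.add_apply, LinearMap.smul_apply, smul_eq_mul]
    have h1 := R.L_nonpos _ H.p_mem _ hz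
    have h2 := R.L_nonpos _ H.q_mem _ hz
    nlinarith
  · have := form_add_ne_zero hH.1.reg_p (R.L_smul _ (inv_pos.2 ht) _ H.q_mem)
      (by rw [map_smul]; exact mul_ne_zero (inv_ne_zero ht.ne') H.pq_ne) hz hz0
    contrapose! this
    rw [map_add, map_smul, LinearMap.add_apply, LinearMap.smul_apply, smul_eq_mul] at this ⊢
    field_simp
    linarith
  · rw [map_add, map_smul, hw.2.1, hw.2.2]
    simp

theorem Generic.eq_of_fix (hH : H.Generic) {u w : W} {a : ℝ} (hu : H.Fix u a) (hw : H.Fix w a) :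
    u = w := by
  have := hu.mul hw.inv
  rw [mul_inv_cancel₀ hw.1.ne'] at this
  exact mul_inv_eq_one.1 (hH.eq_one this)

theorem Generic.comm_of_fix (hH : H.Generic) {u w : W} {a b : ℝ} (hu : H.Fix u a)
    (hw : H.Fix w b) : u * w = w * u :=
  hH.eq_of_fix (hu.mul hw) (mul_comm b a ▸ hw.mul hu)

theorem Generic.flip_mul_self (hH : H.Generic) {u : W} {a : ℝ} (hu : H.Flip u a) : u * u = 1 := by
  refine hH.eq_one ?_
  have := hu.mul_flip hu
  rwa [mul_inv_cancel₀ hu.1.ne'] at this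

theorem Generic.flip_inv (hH : H.Generic) {u : W} {a : ℝ} (hu : H.Flip u a) : u⁻¹ = u :=
  inv_eq_of_mul_eq_one_left (hH.flip_mul_self hu)

theorem Generic.flip_conj (hH : H.Generic) {u w : W} {a b : ℝ} (hu : H.Flip u a)
    (hw : H.Fix w b) : u * w * u⁻¹ = w⁻¹ := by
  rw [hH.flip_inv hu]
  refine hH.eq_of_fix ((hu.mul_fix hw).mul_flip hu) ?_
  have h1 : a * (b * a)⁻¹ = b⁻¹ := by
    have := hu.1.ne'
    have := hw.1.ne'
    field_simp
  rw [h1]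
  exact hw.inv

theorem Generic.eventually_eq_one (hH : H.Generic) {d : ℕ → W} {τ : ℕ → ℝ}
    (hd : ∀ᶠ k in UF, H.Fix (d k) (τ k)) (hτ : Tendsto τ UF (𝓝 1)) : ∀ᶠ k in UF, d k = 1 := by
  have h1 : Tendsto (fun k => R.ρ (d k) (H.p + H.q)) UF (𝓝 ((1 : ℝ) • H.p + (1 : ℝ)⁻¹ • H.q)) :=
    ((hτ.smul_const H.p).add ((hτ.inv₀ one_ne_zero).smul_const H.q)).congr'
      (hd.mono fun k hk => by dsimp only; rw [map_add, hk.2.1, hk.2.2])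
  obtain ⟨w, hw⟩ := eventually_const hH.1.reg_p H.q_mem H.pq_ne tendsto_const_nhds h1
  obtain ⟨k, h2, h3⟩ := (hd.and hw).exists
  rw [h3] at h2
  have h4 : 1 = τ k := eq_of_tendsto_uf hτ
    ((hd.and hw).mono fun j hj => (hj.2 ▸ hj.1).unique h2)
  rw [← h4] at h2
  exact hw.mono fun j hj => by rw [hj, hH.eq_one h2]

/-- The stabiliser of the pair of ends, as a subgroup. -/
def stabilizer (hH : H.Generic) : Subgroup W where
  carrier := {w | ∃ τ, H.Fix w τ ∨ H.Flip w τ}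
  one_mem' := ⟨1, Or.inl H.fix_one⟩
  mul_mem' := by
    rintro u w ⟨a, hu | hu⟩ ⟨b, hw | hw⟩
    · exact ⟨_, Or.inl (hu.mul hw)⟩
    · exact ⟨_, Or.inr (hu.mul_flip hw)⟩
    · exact ⟨_, Or.inr (hu.mul_fix hw)⟩
    · exact ⟨_, Or.inl (hu.mul_flip hw)⟩
  inv_mem' := by
    rintro u ⟨a, hu | hu⟩
    · exact ⟨_, Or.inl hu.inv⟩
    · exact ⟨a, Or.inr (by rwa [hH.flip_inv hu])⟩

theorem Generic.exists_root_notMem (hH : H.Generic)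
    (hva : ¬ ∃ A : Subgroup W, A.index ≠ 0 ∧ ∀ x y : A, x * y = y * x) :
    ∃ δ ∈ R.Φ, R.s δ ∉ stabilizer hH := by
  by_contra! hcon
  have htop : ∀ w : W, w ∈ stabilizer hH := by
    have : Subgroup.closure (R.s '' R.Φ) ≤ stabilizer hH := by
      rw [Subgroup.closure_le]
      rintro _ ⟨δ, hδ, rfl⟩
      exact hcon δ hδ
    rw [R.gen] at this
    exact fun w => this (Subgroup.mem_top w)
  let A : Subgroup W :=
    { carrier := {w | ∃ τ, H.Fix w τ}
      one_mem' := ⟨1, H.fix_one⟩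
      mul_mem' := fun ⟨_, hu⟩ ⟨_, hw⟩ => ⟨_, hu.mul hw⟩
      inv_mem' := fun ⟨_, hu⟩ => ⟨_, hu.inv⟩ }
  refine hva ⟨A, ?_, ?_⟩
  · have : A.index = 2 := by
      rw [Subgroup.index_eq_two_iff]
      refine ⟨R.s H.β, fun b => ?_⟩
      obtain ⟨τ, hb | hb⟩ := htop b
      · exact Or.inr ⟨⟨τ, hb⟩, fun ⟨_, h⟩ => (hb.mul_flip H.flip_s).not_fix h⟩
      · exact Or.inl ⟨⟨_, hb.mul_flip H.flip_s⟩, fun ⟨_, h⟩ => hb.not_fix h⟩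
    rw [this]
    exact two_ne_zero
  · rintro ⟨x, a, hx⟩ ⟨y, b, hy⟩
    exact Subtype.ext (hH.comm_of_fix hx hy)

end HypPair

end RootData

end CoxeterTits

namespace CoxeterTits

open Filter Topology

namespace RootData

variable {W : Type*} [Group W] {V : Type*} [NormedAddCommGroup V] [NormedSpace ℝ V]
  {R : RootData W V}

namespace HypPair

variable {H : R.HypPair}

theorem tendsto_lam_neg_mul {n : ℤ} (hn : 0 < n) :
    Tendsto (fun k : ℕ => H.lam ^ (-(n * (k : ℤ)))) UF (𝓝 0) := by
  have h1 : H.lam ^ (-n) < 1 := zpow_lt_one_of_neg₀ H.one_lt_lam (neg_lt_zero.2 hn)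
  refine ((tendsto_pow_atTop_nhds_zero_of_lt_one (zpow_pos H.lam_pos _).le h1).mono_left
    uf_le_atTop).congr fun k => ?_
  rw [← zpow_natCast, ← zpow_mul, neg_mul]

theorem zpow_eq_one_iff {k : ℤ} : H.g ^ k = 1 ↔ k = 0 := by
  refine ⟨fun h => ?_, fun h => by rw [h, zpow_zero]⟩
  have h1 := H.fix_g.zpow k
  rw [h] at h1
  exact (zpow_eq_one_iff_right₀ H.lam_pos.le H.one_lt_lam.ne').1 (h1.unique H.fix_one)

theorem tendsto_zpow_mul_smul {n : ℤ} (hn : 0 < n) (x : V) :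
    Tendsto (fun k : ℕ => H.lam ^ (-(n * (k : ℤ))) • R.ρ (H.g ^ (n * (k : ℤ))) x) UF
      (𝓝 (H.cp x • H.p)) := by
  have h1 := H.tendsto_lam_neg_mul hn
  have h2 := (((h1.mul h1).mul_const (H.cq x)).smul_const H.q).const_add (H.cp x • H.p)
  have h3 := h2.add (h1.smul_const (H.mm x))
  simp only [mul_zero, zero_mul, zero_smul, add_zero] at h3
  refine h3.congr fun k => ?_
  rw [H.zpow_apply (n * k) x, smul_add, smul_add, smul_smul, smul_smul, ← mul_assoc, ← mul_assoc,
    ← zpow_add₀ H.lam_pos.ne' _ (n * (k : ℤ)), neg_add_cancel, zpow_zero, one_mul]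

theorem tendsto_neg_zpow_mul_smul {n : ℤ} (hn : 0 < n) (x : V) :
    Tendsto (fun k : ℕ => H.lam ^ (-(n * (k : ℤ))) • R.ρ (H.g ^ (-(n * (k : ℤ)))) x) UF
      (𝓝 (H.cq x • H.q)) := by
  have := H.swap.tendsto_zpow_mul_smul hn x
  simpa [swap_g] using this

theorem Flip.cp_apply {w : W} {τ : ℝ} (h : H.Flip w τ) (x : V) :
    H.cp (R.ρ w x) = τ⁻¹ * H.cq x := by
  have h1 : H.q = τ⁻¹ • R.ρ w H.p := by
    rw [h.2.1, smul_smul, inv_mul_cancel₀ h.1.ne', one_smul]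
  rw [HypPair.cp_apply, HypPair.cq_apply]
  nth_rw 2 [h1]
  rw [map_smul, LinearMap.smul_apply, R.inv, smul_eq_mul]
  ring

theorem Flip.cq_apply {w : W} {τ : ℝ} (h : H.Flip w τ) (x : V) :
    H.cq (R.ρ w x) = τ * H.cp x := by
  have := h.swap.cp_apply x
  simpa using this

theorem Flip.mm_apply {w : W} {τ : ℝ} (h : H.Flip w τ) (x : V) :
    H.mm (R.ρ w x) = R.ρ w (H.mm x) := by
  rw [HypPair.mm_apply, HypPair.mm_apply, h.cp_apply, h.cq_apply, map_sub, map_sub, map_smul,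
    map_smul, h.2.1, h.2.2]
  module

theorem Fix.cp_apply {w : W} {τ : ℝ} (h : H.Fix w τ) (x : V) : H.cp (R.ρ w x) = τ * H.cp x := by
  have h1 : H.q = τ • R.ρ w H.q := by
    rw [h.2.2, smul_smul, mul_inv_cancel₀ h.1.ne', one_smul]
  rw [HypPair.cp_apply, HypPair.cp_apply]
  nth_rw 2 [h1]
  rw [map_smul, LinearMap.smul_apply, R.inv, smul_eq_mul]
  ring

theorem Fix.cq_apply {w : W} {τ : ℝ} (h : H.Fix w τ) (x : V) :
    H.cq (R.ρ w x) = τ⁻¹ * H.cq x := by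
  have := h.swap.cp_apply x
  simpa using this

theorem Regular.eq_or_of_apply_p (hH : H.Regular) {u v w : W} {a b : ℝ} (hu : H.Fix u a)
    (hv : H.Fix v b) (hb : b ≠ 1) (h : w * u * w⁻¹ = v) :
    (∃ c : ℝ, R.ρ w H.p = c • H.p) ∨ ∃ c : ℝ, R.ρ w H.p = c • H.q := by
  have h1 : R.ρ v (R.ρ w H.p) = a • R.ρ w H.p := by
    rw [← h, ← mul_apply, inv_mul_cancel_right, mul_apply, hu.2.1, map_smul]
  exact (hH.eigenvector hv hb (R.L_map w _ H.p_mem) h1).imp (fun h => ⟨_, h⟩) fun h => ⟨_, h⟩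

/-- An element conjugating a translation along the axis to another one stabilises the ends. -/
theorem Regular.fix_or_flip_of_conj [FiniteDimensional ℝ V] (hH : H.Regular) {u v w : W} {a b : ℝ} (hu : H.Fix u a)
    (hv : H.Fix v b) (hb : b ≠ 1) (h : w * u * w⁻¹ = v) : ∃ τ, H.Fix w τ ∨ H.Flip w τ :=
  (hH.eq_or_of_apply_p hu hv hb h).elim (fun ⟨c, hc⟩ => ⟨c, Or.inl (hH.fix_of_apply_p hc)⟩)
    fun ⟨c, hc⟩ => ⟨c, Or.inr (hH.flip_of_apply_p hc)⟩

theorem lam_zpow_ne_one {k : ℤ} (hk : k ≠ 0) : H.lam ^ k ≠ 1 := fun h =>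
  hk ((zpow_eq_one_iff_right₀ H.lam_pos.le H.one_lt_lam.ne').1 h)

theorem Generic.flip_of_conj_inv [FiniteDimensional ℝ V] (hH : H.Generic) {w : W} {m : ℤ} (hm : m ≠ 0)
    (h : w * H.g ^ m * w⁻¹ = (H.g ^ m)⁻¹) : ∃ τ, H.Flip w τ := by
  have hf := H.fix_g.zpow m
  have h1 : H.lam ^ (-m) ≠ 1 := lam_zpow_ne_one (neg_ne_zero.2 hm)
  rw [zpow_neg] at h1
  obtain ⟨τ, h2 | h2⟩ := hH.1.fix_or_flip_of_conj hf hf.inv h1 h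
  · exfalso
    rw [hH.comm_of_fix h2 hf, mul_inv_cancel_right, eq_inv_iff_mul_eq_one, ← zpow_add,
      zpow_eq_one_iff] at h
    omega
  · exact ⟨τ, h2⟩

/-- A sequence of flips with diverging axes, all acting in the same way transversally. -/
def FlipSeq (H : R.HypPair) (f : ℕ → W) (ε : ℕ → ℝ) (f₀ : W) : Prop :=
  Tendsto ε UF (𝓝 0) ∧ ∀ k, H.Flip (f k) (ε k) ∧ ∀ x, R.ρ (f k) (H.mm x) = R.ρ f₀ (H.mm x)

theorem Flip.flipSeq {f₀ : W} {c : ℝ} (hf : H.Flip f₀ c) {n : ℤ} (hn : 0 < n) : ∃ ε,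
    H.FlipSeq (fun k : ℕ => H.g ^ (n * (k : ℤ)) * f₀ * (H.g ^ (n * (k : ℤ)))⁻¹) ε f₀ := by
  refine ⟨fun k => (H.lam ^ (n * (k : ℤ)))⁻¹ * (c * (H.lam ^ (n * (k : ℤ)))⁻¹), ?_, fun k =>
    ⟨?_, fun x => ?_⟩⟩
  · have h1 := H.tendsto_lam_neg_mul hn
    have h2 := h1.mul (h1.const_mul c)
    simpa [zpow_neg] using h2
  · exact ((H.fix_g.zpow (n * k)).mul_flip hf).mul_fix (H.fix_g.zpow (n * k)).inv
  · rw [mul_apply, mul_apply, ← zpow_neg, zpow_mm, ← hf.mm_apply, zpow_mm]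

theorem FlipSeq.apply_eq {f : ℕ → W} {ε : ℕ → ℝ} {f₀ : W} (hf : H.FlipSeq f ε f₀) (k : ℕ) (x : V) :
    ε k • R.ρ (f k) x = (ε k * ε k * H.cp x) • H.q + H.cq x • H.p + ε k • R.ρ f₀ (H.mm x) := by
  obtain ⟨⟨h0, h1, h2⟩, h3⟩ := hf.2 k
  conv_lhs => rw [H.decomp x]
  rw [map_add, map_add, map_smul, map_smul, h1, h2, h3, smul_add, smul_add, smul_smul, smul_smul,
    smul_smul, smul_smul, mul_right_comm (ε k) (H.cq x), mul_inv_cancel₀ h0.ne', one_mul,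
    mul_right_comm, mul_assoc]

/-- If a vector `x` of the cone satisfies `t x ∝ f x`, then one of `x`, `t x` is close to the
end `p`. -/
theorem FlipSeq.tendsto_or [FiniteDimensional ℝ V] {f : ℕ → W} {ε : ℕ → ℝ} {f₀ : W} (hf : H.FlipSeq f ε f₀)
    (hH : H.Regular) {t : W} {x : ℕ → V} (hx : ∀ᶠ k in UF, x k ∈ R.L ∧ x k ≠ 0 ∧
      ∃ a : ℝ, 0 < a ∧ R.ρ t (x k) = a • R.ρ (f k) (x k)) :
    (∃ c : ℕ → ℝ, (∀ᶠ k in UF, 0 < c k) ∧ Tendsto (fun k => c k • x k) UF (𝓝 H.p)) ∨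
      ∃ c : ℕ → ℝ, (∀ᶠ k in UF, 0 < c k) ∧ Tendsto (fun k => c k • R.ρ t (x k)) UF (𝓝 H.p) := by
  obtain ⟨z, hz, hz1, hlim⟩ := R.exists_tendsto_unit (hx.mono fun k h => ⟨h.1, h.2.1⟩)
  have hz0 : z ≠ 0 := by
    rintro rfl
    simp at hz1
  by_cases hq : H.cq z = 0
  · left
    have h1 := hH.eq_smul_p hz hq
    have hp : H.cp z ≠ 0 := by
      intro h
      rw [h, zero_smul] at h1
      exact hz0 h1
    have hp' := (H.cp_nonneg hz).lt_of_ne' hp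
    refine ⟨fun k => (H.cp z)⁻¹ * ‖x k‖⁻¹, hx.mono fun k h =>
      mul_pos (inv_pos.2 hp') (inv_pos.2 (norm_pos_iff.2 h.2.1)), ?_⟩
    have h2 := hlim.const_smul (H.cp z)⁻¹
    rw [h1, map_smul, cp_p, smul_eq_mul, mul_one, smul_smul, inv_mul_cancel₀ hp, one_smul] at h2
    simpa only [smul_smul] using h2
  · right
    have hq' := (H.cq_nonneg hz).lt_of_ne' hq
    have h1 : Tendsto (fun k => ε k • R.ρ (f k) (‖x k‖⁻¹ • x k)) UF (𝓝 (H.cq z • H.p)) := by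
      simp only [hf.apply_eq]
      have h2 := ((hf.1.mul hf.1).mul (tendsto_linear H.cp hlim)).smul_const H.q
      have h3 := (tendsto_linear H.cq hlim).smul_const H.p
      have h4 := hf.1.smul (tendsto_linear (R.ρ f₀ ∘ₗ H.mm) hlim)
      simpa using (h2.add h3).add h4
    have h2 := h1.const_smul (H.cq z)⁻¹
    rw [smul_smul, inv_mul_cancel₀ hq, one_smul] at h2
    obtain ⟨a, ha⟩ := (hx.mono fun k h => h.2.2).choice
    refine ⟨fun k => (H.cq z)⁻¹ * (ε k * (‖x k‖⁻¹ * (a k)⁻¹)), (hx.and ha).mono fun k h => ?_,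
      h2.congr' (ha.mono fun k h => ?_)⟩
    · have := (hf.2 k).1.1
      have := norm_pos_iff.2 h.1.2.1
      have := h.2.1
      positivity
    · dsimp only
      rw [h.2, map_smul]
      simp only [smul_smul]
      rw [mul_assoc _ _ (a k), mul_assoc _ _ (a k), mul_assoc _ _ (a k), inv_mul_cancel₀ h.1.ne',
        mul_one]

end HypPair

/-- Reflections in two roots with form larger than one generate an infinite dihedral group. -/
theorem zpow_mul_ne_one [FiniteDimensional ℝ V] {β γ : V} (hβ : β ∈ R.Φ) (hγ : γ ∈ R.Φ)
    (h : 1 < |R.B β γ|) {k : ℤ} (hk : k ≠ 0) : (R.s β * R.s γ) ^ k ≠ 1 := by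
  obtain ⟨K, h1, h2⟩ := R.exists_hypPair hβ hγ h
  have h3 : R.s K.β = R.s β := by
    rcases h1 with h1 | h1 <;> rw [h1]
    exact R.s_neg hβ
  have h4 : R.s K.γ = R.s γ := by
    rcases h2 with h2 | h2 <;> rw [h2]
    exact R.s_neg hγ
  rw [← h3, ← h4]
  exact fun h => hk (HypPair.zpow_eq_one_iff (H := K).1 h)

end RootData

end CoxeterTits

namespace CoxeterTits

open Filter Topology

namespace RootData

variable {W : Type*} [Group W] {V : Type*} [NormedAddCommGroup V] [NormedSpace ℝ V]
  {R : RootData W V}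

theorem zpow_apply_of_apply {x : W} {P : V} {c : ℝ} (hc : c ≠ 0) (h : R.ρ x P = c • P) (j : ℤ) :
    R.ρ (x ^ j) P = c ^ j • P := by
  have h1 : R.ρ x⁻¹ P = c⁻¹ • P := R.apply_injective x (by
    rw [apply_inv_self, map_smul, h, smul_smul, inv_mul_cancel₀ hc, one_smul])
  induction j using Int.induction_on with
  | zero => simp
  | succ k ih => rw [zpow_add_one, zpow_add_one₀ hc, mul_apply, h, map_smul, ih, smul_smul, mul_comm]
  | pred k ih =>
    rw [zpow_sub_one, zpow_sub_one₀ hc, mul_apply, h1, map_smul, ih, smul_smul, mul_comm]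

namespace HypPair

theorem exists_apply_p_of_conj (K : R.HypPair) {w : W} {b : ℤ} (hb : b ≠ 0)
    (h : w * K.g ^ b * w⁻¹ = (K.g ^ b)⁻¹) : ∃ a : ℝ, 0 < a ∧ R.ρ w K.p = a • K.q := by
  set y := R.ρ w K.p with hy
  have hyL : y ∈ R.L := R.L_map w _ K.p_mem
  have h1 : R.ρ (K.g ^ b) y = K.lam ^ (-b) • y := by
    have h2 : K.g ^ b * w = w * (K.g ^ b)⁻¹ := by
      have h3 := congrArg (fun x => x⁻¹ * w) h
      simp only [mul_inv_rev, inv_inv] at h3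
      rw [← h3]
      group
    rw [hy, ← mul_apply, h2, mul_apply, ← zpow_neg, zpow_p, map_smul]
  have hne : K.lam ^ b ≠ K.lam ^ (-b) := fun h => by
    have := zpow_right_injective₀ K.lam_pos K.one_lt_lam.ne' h
    omega
  have hcp : K.cp y = 0 := by
    have h2 := K.cp_zpow b y
    rw [h1, map_smul, smul_eq_mul] at h2
    have h3 : (K.lam ^ b - K.lam ^ (-b)) * K.cp y = 0 := by linear_combination -h2
    exact (mul_eq_zero.1 h3).resolve_left (sub_ne_zero.2 hne)
  have hmm : K.mm y = 0 := by
    have h2 := K.zpow_apply b y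
    rw [h1] at h2
    nth_rw 1 [K.decomp y] at h2
    rw [hcp] at h2
    have h3 : (K.lam ^ (-b) - 1) • K.mm y = 0 := by
      rw [mul_zero, zero_smul, zero_add, zero_add, smul_add, smul_smul] at h2
      rw [sub_smul, one_smul, sub_eq_zero]
      exact add_left_cancel h2
    exact (smul_eq_zero.1 h3).resolve_left (sub_ne_zero.2 (lam_zpow_ne_one (neg_ne_zero.2 hb)))
  have hdec := K.decomp y
  rw [hcp, hmm, zero_smul, zero_add, add_zero] at hdec
  refine ⟨K.cq y, (K.cq_nonneg hyL).lt_of_ne' fun h0 => ?_, hdec⟩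
  rw [h0, zero_smul, hy, apply_eq_zero] at hdec
  exact K.p_ne_zero hdec

theorem exists_conj_ends (K : R.HypPair) {x : W} (hx : CommElem x K.g) :
    ∃ z : W, ∀ y : W, y * x * y⁻¹ = x⁻¹ → ∃ a : ℝ, 0 < a ∧ R.ρ y (R.ρ z K.p) = a • R.ρ z K.q := by
  obtain ⟨z, b, a, hb, ha, hz⟩ := hx
  refine ⟨z, fun y hy => ?_⟩
  obtain ⟨c, hc, h⟩ := K.exists_apply_p_of_conj (w := z⁻¹ * y * z) hb (by
    have h1 : K.g ^ b = z⁻¹ * x ^ a * z := by rw [hz]; group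
    have h2 : y * x ^ a * y⁻¹ = (x ^ a)⁻¹ := by
      rw [← conj_zpow, hy, inv_zpow]
    rw [h1]
    calc _ = z⁻¹ * (y * x ^ a * y⁻¹) * z := by group
      _ = _ := by rw [h2]; group)
  refine ⟨c, hc, ?_⟩
  rw [← map_smul, ← h, ← mul_apply, ← mul_apply]
  congr 2
  group

end HypPair

/-- The limit direction `P` is exchanged with `t P` by `t` and `f`, and its image under `z` is
exchanged with `z t P` by `t'` and `f'`. -/
structure Paired (R : RootData W V) (t f t' f' : W) (P : V) (z : W) : Prop where
  mem : P ∈ R.L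
  ne : P ≠ 0
  apply_f : ∃ a : ℝ, 0 < a ∧ R.ρ f P = a • R.ρ t P
  apply_t' : ∃ a : ℝ, 0 < a ∧ R.ρ t' (R.ρ z P) = a • R.ρ z (R.ρ t P)
  apply_f' : ∃ a : ℝ, 0 < a ∧ R.ρ f' (R.ρ z P) = a • R.ρ z (R.ρ t P)

theorem apply_apply_of_mul_self {w : W} (h : w * w = 1) (x : V) : R.ρ w (R.ρ w x) = x := by
  rw [← mul_apply, h, one_apply]

theorem apply_eq_inv_smul {w : W} (h : w * w = 1) {x y : V} {a : ℝ} (ha : 0 < a)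
    (hx : R.ρ w x = a • y) : R.ρ w y = a⁻¹ • x := by
  rw [← apply_apply_of_mul_self (R := R) h x, hx, map_smul, smul_smul, inv_mul_cancel₀ ha.ne',
    one_smul]

namespace Paired

variable {t f t' f' : W} {P : V} {z : W}

theorem smul (h : R.Paired t f t' f' P z) {c : ℝ} (hc : 0 < c) : R.Paired t f t' f' (c • P) z := by
  obtain ⟨h1, h2, ⟨a, ha, h3⟩, ⟨b, hb, h4⟩, d, hd, h5⟩ := h
  refine ⟨R.L_smul _ hc _ h1, smul_ne_zero hc.ne' h2, ⟨a, ha, ?_⟩, ⟨b, hb, ?_⟩, d, hd, ?_⟩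
  · rw [map_smul, map_smul, h3, smul_comm]
  · rw [map_smul, map_smul, map_smul, map_smul, h4, smul_comm]
  · rw [map_smul, map_smul, map_smul, map_smul, h5, smul_comm]

theorem apply (h : R.Paired t f t' f' P z) (ht : t * t = 1) (hf : f * f = 1) (ht' : t' * t' = 1)
    (hf' : f' * f' = 1) : R.Paired t f t' f' (R.ρ t P) z := by
  obtain ⟨h1, h2, ⟨a, ha, h3⟩, ⟨b, hb, h4⟩, d, hd, h5⟩ := h
  refine ⟨R.L_map _ _ h1, fun h0 => h2 (R.apply_eq_zero.1 h0), ⟨a⁻¹, inv_pos.2 ha, ?_⟩,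
    ⟨b⁻¹, inv_pos.2 hb, ?_⟩, d⁻¹, inv_pos.2 hd, ?_⟩ <;> rw [apply_apply_of_mul_self ht]
  · exact apply_eq_inv_smul hf ha h3
  · exact apply_eq_inv_smul ht' hb h4
  · exact apply_eq_inv_smul hf' hd h5

theorem mul_left (h : R.Paired t f t' f' P z) (ht' : t' * t' = 1) (hf' : f' * f' = 1) :
    R.Paired t f t' f' P (t' * z) := by
  obtain ⟨h1, h2, h3, ⟨b, hb, h4⟩, d, hd, h5⟩ := h
  refine ⟨h1, h2, h3, ⟨b, hb, ?_⟩, b * (d⁻¹ * b), by positivity, ?_⟩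
  · rw [mul_apply, mul_apply, h4, apply_eq_inv_smul ht' hb h4, map_smul,
      apply_eq_inv_smul ht' hb h4]
  · rw [mul_apply, mul_apply, h4, apply_eq_inv_smul ht' hb h4, map_smul,
      apply_eq_inv_smul hf' hd h5, smul_smul, smul_smul, mul_assoc, mul_assoc,
      mul_inv_cancel₀ hb.ne', mul_one]

end Paired

theorem exists_paired [FiniteDimensional ℝ V] {δ β : V} (hδ : δ ∈ R.Φ) (hβ : β ∈ R.Φ)
    (h : 1 < |R.B δ β|) {φ : W →* W} (hφ : ∀ g, CommElem (φ g) g) :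
    ∃ P z, R.Paired (R.s δ) (R.s β) (φ (R.s δ)) (φ (R.s β)) P z := by
  obtain ⟨K, h1, h2⟩ := R.exists_hypPair hδ hβ h
  have h3 : R.s δ = R.s K.β := by
    rcases h1 with h1 | h1 <;> rw [h1]
    exact (R.s_neg hδ).symm
  have h4 : R.s β = R.s K.γ := by
    rcases h2 with h2 | h2 <;> rw [h2]
    exact (R.s_neg hβ).symm
  obtain ⟨z, hz⟩ := K.exists_conj_ends (hφ K.g)
  have ht : φ (R.s K.β) * φ (R.s K.β) = 1 := by rw [← map_mul, R.s_mul_self K.hβ, map_one]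
  have hf : φ (R.s K.γ) * φ (R.s K.γ) = 1 := by rw [← map_mul, R.s_mul_self K.hγ, map_one]
  have hg : φ K.g = φ (R.s K.β) * φ (R.s K.γ) := by rw [← map_mul]; rfl
  have hq : R.ρ (R.s K.β) K.p = K.r⁻¹ • K.q := K.s_β_p
  have hr := K.r_pos
  refine ⟨K.p, z, ?_⟩
  rw [h3, h4]
  refine ⟨K.p_mem, K.p_ne_zero, ⟨K.r * K.r, by positivity, ?_⟩, ?_, ?_⟩
  · rw [hq, K.s_γ_p, smul_smul, mul_inv_cancel_right₀ hr.ne']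
  · obtain ⟨a, ha, h⟩ := hz (φ (R.s K.β)) (by
      rw [hg, ← mul_assoc, ht, one_mul, mul_inv_rev, inv_eq_of_mul_eq_one_left hf])
    · refine ⟨a * K.r, by positivity, ?_⟩
      rw [h, hq, map_smul, smul_smul, mul_inv_cancel_right₀ hr.ne']
  · obtain ⟨a, ha, h⟩ := hz (φ (R.s K.γ)) (by
      rw [hg, mul_assoc, mul_inv_cancel_right, mul_inv_rev, inv_eq_of_mul_eq_one_left ht,
        inv_eq_of_mul_eq_one_left hf])
    · refine ⟨a * K.r, by positivity, ?_⟩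
      rw [h, hq, map_smul, smul_smul, mul_inv_cancel_right₀ hr.ne']

/-- Rescaling an element carrying `P`, `t P` to multiples of `Q`, `t' Q` by powers of `t f` and by
the two reflections. -/
theorem exists_balanced {t f t' z : W} {P Q : V} {Λ τ τ' m M : ℝ} (ht : t * t = 1)
    (hf : f * f = 1) (ht' : t' * t' = 1) (hΛ : 0 < Λ) (hΛ1 : Λ < 1)
    (hfP : R.ρ f P = Λ • R.ρ t P) (hτ : 0 < τ) (hτ' : 0 < τ') (h1 : R.ρ z P = τ • Q)
    (h2 : R.ρ z (R.ρ t P) = τ' • R.ρ t' Q) (hm : 0 < m) (hmm : m ≤ τ * τ') (hM : τ * τ' ≤ M) :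
    ∃ (z : W) (σ σ' : ℝ), 0 < σ ∧ 0 < σ' ∧ R.ρ z P = σ • Q ∧ R.ρ z (R.ρ t P) = σ' • R.ρ t' Q ∧
      σ * σ' = τ * τ' ∧ σ ^ 2 ≤ M ∧ min 1 (m ^ 2) * Λ ≤ σ ^ 2 := by
  have hxP : R.ρ (t * f) P = Λ • P := by
    rw [mul_apply, hfP, map_smul, apply_apply_of_mul_self ht]
  have hxQ : R.ρ (t * f) (R.ρ t P) = Λ⁻¹ • R.ρ t P := by
    rw [mul_apply, apply_eq_inv_smul hf hΛ hfP, map_smul]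
  obtain ⟨j, hj1, hj2⟩ := exists_mem_Ico_zpow (x := τ ^ 2 * Λ⁻¹) (y := Λ⁻¹ ^ 2) (by positivity)
    (one_lt_pow₀ ((one_lt_inv₀ hΛ).2 hΛ1) two_ne_zero)
  set ℓ := Λ ^ j with hℓ
  have hℓ0 : 0 < ℓ := zpow_pos hΛ j
  have h3 : (Λ⁻¹ ^ 2) ^ j = (ℓ ^ 2)⁻¹ := by
    rw [hℓ, inv_pow, inv_zpow, ← zpow_natCast, ← zpow_natCast, zpow_comm]
  rw [h3] at hj1
  rw [zpow_add_one₀ (by positivity), h3] at hj2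
  have h4 : Λ ≤ (ℓ * τ) ^ 2 := by
    rw [inv_le_iff_one_le_mul₀ (by positivity)] at hj1
    rw [← div_eq_mul_inv, div_mul_eq_mul_div, le_div_iff₀ hΛ] at hj1
    linarith [mul_pow ℓ τ 2]
  have h5 : (ℓ * τ) ^ 2 * Λ ≤ 1 := by
    have : (τ ^ 2 * Λ⁻¹) * (ℓ ^ 2 * Λ ^ 2) ≤ ((ℓ ^ 2)⁻¹ * Λ⁻¹ ^ 2) * (ℓ ^ 2 * Λ ^ 2) :=
      mul_le_mul_of_nonneg_right hj2.le (by positivity)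
    field_simp at this
    nlinarith
  have h6 : R.ρ (z * (t * f) ^ j) P = (ℓ * τ) • Q := by
    rw [mul_apply, zpow_apply_of_apply hΛ.ne' hxP, map_smul, h1, smul_smul]
  have h7 : R.ρ (z * (t * f) ^ j) (R.ρ t P) = (ℓ⁻¹ * τ') • R.ρ t' Q := by
    rw [mul_apply, zpow_apply_of_apply (inv_ne_zero hΛ.ne') hxQ, map_smul, h2, smul_smul, inv_zpow]
  have h8 : ℓ * τ * (ℓ⁻¹ * τ') = τ * τ' := by field_simp
  have h9 : 0 < ℓ * τ := by positivity
  have h10 : 0 < ℓ⁻¹ * τ' := by positivity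
  generalize ℓ * τ = σ at *
  generalize ℓ⁻¹ * τ' = σ' at *
  rcases le_total σ σ' with hle | hle
  · refine ⟨_, σ, σ', h9, h10, h6, h7, h8, by nlinarith, ?_⟩
    exact (mul_le_of_le_one_left hΛ.le (min_le_left _ _)).trans h4
  · refine ⟨t' * (z * (t * f) ^ j) * t, σ', σ, h10, h9, ?_, ?_, by rw [mul_comm, h8],
      by nlinarith, ?_⟩
    · rw [mul_apply, mul_apply, h7, map_smul, apply_apply_of_mul_self ht']
    · rw [mul_apply, mul_apply, apply_apply_of_mul_self ht, h6, map_smul]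
    · refine (mul_le_mul_of_nonneg_right (min_le_right _ _) hΛ.le).trans ?_
      have h11 : m ^ 2 ≤ (σ * σ') ^ 2 := pow_le_pow_left₀ hm.le (h8 ▸ hmm) 2
      calc m ^ 2 * Λ ≤ (σ * σ') ^ 2 * Λ := mul_le_mul_of_nonneg_right h11 hΛ.le
        _ = σ' ^ 2 * (σ ^ 2 * Λ) := by ring
        _ ≤ σ' ^ 2 * 1 := mul_le_mul_of_nonneg_left h5 (by positivity)
        _ = σ' ^ 2 := mul_one _

end RootData

end CoxeterTits

namespace CoxeterTits

open Filter Topology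

namespace RootData

variable {W : Type*} [Group W] {V : Type*} [NormedAddCommGroup V] [NormedSpace ℝ V]
  [FiniteDimensional ℝ V] {R : RootData W V}

namespace HypPair

variable {H : R.HypPair}

theorem Generic.cq_apply_pos (hH : H.Generic) {w : W} (hw : w ∉ stabilizer hH) :
    0 < H.cq (R.ρ w H.p) := by
  refine (H.cq_nonneg (R.L_map _ _ H.p_mem)).lt_of_ne' fun h => hw ?_
  exact ⟨_, Or.inl (hH.1.fix_of_apply_p (hH.1.eq_smul_p (R.L_map _ _ H.p_mem) h))⟩

theorem Generic.cp_apply_pos (hH : H.Generic) {w : W} (hw : w ∉ stabilizer hH) :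
    0 < H.cp (R.ρ w H.p) := by
  refine (H.cp_nonneg (R.L_map _ _ H.p_mem)).lt_of_ne' fun h => hw ?_
  exact ⟨_, Or.inr (hH.1.flip_of_apply_p (hH.1.eq_smul_q (R.L_map _ _ H.p_mem) h))⟩

theorem Generic.form_p_ne (hH : H.Generic) {δ : V} (hδ : δ ∈ R.Φ) (h : R.s δ ∉ stabilizer hH) :
    R.B H.p δ ≠ 0 := fun h0 => h ⟨1, Or.inl (hH.1.fix_of_apply_p (by
  rw [R.s_apply δ hδ, h0]
  simp))⟩

theorem Generic.form_q_ne (hH : H.Generic) {δ : V} (hδ : δ ∈ R.Φ) (h : R.s δ ∉ stabilizer hH) :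
    R.B H.q δ ≠ 0 := fun h0 => h ⟨1⁻¹, Or.inl (hH.1.fix_of_apply_q (by
  rw [R.s_apply δ hδ, h0]
  simp))⟩

theorem Generic.cp_root_ne (hH : H.Generic) {δ : V} (hδ : δ ∈ R.Φ) (h : R.s δ ∉ stabilizer hH) :
    H.cp δ ≠ 0 := mul_ne_zero (inv_ne_zero H.pq_ne) (hH.form_q_ne hδ h)

theorem Generic.cq_root_ne (hH : H.Generic) {δ : V} (hδ : δ ∈ R.Φ) (h : R.s δ ∉ stabilizer hH) :
    H.cq δ ≠ 0 := mul_ne_zero (inv_ne_zero H.pq_ne) (hH.form_p_ne hδ h)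

/-- An off-axis reflection and another involution agreeing with it at `p` up to the stabiliser of
the ends are conjugate by that stabiliser. -/
theorem Generic.eq_conj_of_apply (hH : H.Generic) {t t' z : W} (ht2 : t * t = 1)
    (ht : t ∉ stabilizer hH) (ht2' : t' * t' = 1) {σ b : ℝ} (hz : H.Fix z σ)
    (h : R.ρ z (R.ρ t H.p) = b • R.ρ t' H.p) : t' = z * t * z⁻¹ := by
  have hzE : z ∈ stabilizer hH := ⟨σ, Or.inl hz⟩
  have hy : H.Fix (t' * z * t) b := hH.1.fix_of_apply_p (by
    rw [mul_apply, mul_apply, h, map_smul, apply_apply_of_mul_self ht2'])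
  set T := z * t * z⁻¹ with hT
  have hTE : T ∉ stabilizer hH := fun h0 => ht (by
    have : t = z⁻¹ * T * z := by rw [hT]; group
    rw [this]
    exact mul_mem (mul_mem (inv_mem hzE) h0) hzE)
  have hT2 : T * T = 1 := by
    calc T * T = z * (t * t) * z⁻¹ := by rw [hT]; group
      _ = 1 := by rw [ht2]; group
  have hv := (hy.mul hz.inv).inv
  have h1 : t' = T * (t' * z * t * z⁻¹)⁻¹ := by
    rw [show t' * z * t * z⁻¹ = t' * T by rw [hT]; group, mul_inv_rev, mul_inv_cancel_left,
      inv_eq_of_mul_eq_one_left ht2']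
  generalize (t' * z * t * z⁻¹)⁻¹ = v at *
  by_cases hσ : (b * σ⁻¹)⁻¹ = 1
  · rw [hσ] at hv
    rw [h1, hH.eq_one hv, mul_one]
  · refine absurd (hH.1.fix_or_flip_of_conj hv hv.inv (inv_ne_one.2 hσ) (w := T) ?_) hTE
    rw [inv_eq_of_mul_eq_one_left hT2, eq_inv_iff_mul_eq_one, mul_assoc, ← h1, ht2']

/-- The estimates relating the two ends of the axis of `t f`. -/
theorem FlipSeq.limit {f : ℕ → W} {ε : ℕ → ℝ} {f₀ : W} (hf : H.FlipSeq f ε f₀) {t : W}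
    (ht : 0 < H.cq (R.ρ t H.p)) {P : ℕ → V} {Λ : ℕ → ℝ} (hP : Tendsto P UF (𝓝 H.p))
    (h : ∀ᶠ k in UF, 0 < Λ k ∧ R.ρ (f k) (P k) = Λ k • R.ρ t (P k)) :
    Tendsto Λ UF (𝓝 0) ∧ (∀ᶠ k in UF, H.cq (P k) = ε k * Λ k * H.cp (R.ρ t (P k))) ∧
      ∀ᶠ k in UF, H.mm (P k) = Λ k • R.ρ f₀⁻¹ (H.mm (R.ρ t (P k))) := by
  have hq : Tendsto (fun k => H.cq (R.ρ t (P k))) UF (𝓝 (H.cq (R.ρ t H.p))) :=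
    tendsto_linear H.cq (tendsto_linear (R.ρ t) hP)
  refine ⟨?_, h.mono fun k hk => ?_, h.mono fun k hk => ?_⟩
  · have h1 := (hf.1.mul (tendsto_linear H.cp hP)).mul (hq.inv₀ ht.ne')
    rw [zero_mul, zero_mul] at h1
    refine h1.congr' ((h.and (hq.eventually_ne ht.ne')).mono fun k hk => ?_)
    have h2 := (hf.2 k).1.cq_apply (P k)
    rw [hk.1.2, map_smul, smul_eq_mul] at h2
    rw [← h2, mul_inv_cancel_right₀ hk.2]
  · have h2 := (hf.2 k).1.cp_apply (P k)
    rw [hk.2, map_smul, smul_eq_mul] at h2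
    rw [mul_assoc, h2, mul_inv_cancel_left₀ (hf.2 k).1.1.ne']
  · have h2 := (hf.2 k).1.mm_apply (P k)
    rw [hk.2, map_smul, (hf.2 k).2] at h2
    rw [← map_smul, h2, inv_apply_self]

/-- Limit directions of axes can be chosen simultaneously close to `p`. -/
theorem Regular.exists_tendsto_paired (hH : H.Regular) {t t' : W} {f f' : ℕ → W} {ε ε' : ℕ → ℝ}
    {f₀ f₀' : W} (hf : H.FlipSeq f ε f₀) (hf' : H.FlipSeq f' ε' f₀') (ht : t * t = 1)
    (ht' : t' * t' = 1) (hf2 : ∀ k, f k * f k = 1) (hf2' : ∀ k, f' k * f' k = 1)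
    (hP : ∀ᶠ k in UF, ∃ P z, R.Paired t (f k) t' (f' k) P z) :
    ∃ (P : ℕ → V) (z : ℕ → W) (c : ℕ → ℝ), (∀ᶠ k in UF, R.Paired t (f k) t' (f' k) (P k) (z k)) ∧
      (∀ᶠ k in UF, 0 < c k) ∧ Tendsto P UF (𝓝 H.p) ∧
      Tendsto (fun k => c k • R.ρ (z k) (P k)) UF (𝓝 H.p) := by
  obtain ⟨P, hP⟩ := hP.choice
  obtain ⟨z, hz⟩ := hP.choice
  obtain ⟨P, hz, hlim⟩ : ∃ P : ℕ → V, (∀ᶠ k in UF, R.Paired t (f k) t' (f' k) (P k) (z k)) ∧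
      Tendsto P UF (𝓝 H.p) := by
    rcases hf.tendsto_or hH (t := t) (x := P) (hz.mono fun k h => ⟨h.mem, h.ne, by
      obtain ⟨a, ha, h1⟩ := h.apply_f
      exact ⟨a⁻¹, inv_pos.2 ha, by rw [h1, smul_smul, inv_mul_cancel₀ ha.ne', one_smul]⟩⟩) with
      ⟨c, hc, h1⟩ | ⟨c, hc, h1⟩
    · exact ⟨_, (hz.and hc).mono fun k h => h.1.smul h.2, h1⟩
    · exact ⟨_, (hz.and hc).mono fun k h => (h.1.apply ht (hf2 k) ht' (hf2' k)).smul h.2, h1⟩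
  rcases hf'.tendsto_or hH (t := t') (x := fun k => R.ρ (z k) (P k)) (hz.mono fun k h =>
    ⟨R.L_map _ _ h.mem, fun h0 => h.ne (R.apply_eq_zero.1 h0), by
      obtain ⟨a, ha, h1⟩ := h.apply_f'
      obtain ⟨b, hb, h2⟩ := h.apply_t'
      refine ⟨b * a⁻¹, mul_pos hb (inv_pos.2 ha), ?_⟩
      rw [h1, h2, smul_smul, inv_mul_cancel_right₀ ha.ne']⟩) with
    ⟨c, hc, h1⟩ | ⟨c, hc, h1⟩
  · exact ⟨P, z, c, hz, hc, hlim, h1⟩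
  · exact ⟨P, fun k => t' * z k, c, hz.mono fun k h => h.mul_left ht' (hf2' k), hc, hlim,
      by simpa only [mul_apply] using h1⟩

/-- The elements `z` matching the axes of `t f` and `t' f'` can be chosen with controlled
distortion. -/
theorem Generic.exists_balanced_seq (hH : H.Generic) {t t' : W} {f f' : ℕ → W} {ε ε' : ℕ → ℝ}
    {f₀ f₀' : W} (hf : H.FlipSeq f ε f₀) (hf' : H.FlipSeq f' ε' f₀') (ht : t * t = 1)
    (ht' : t' * t' = 1) (htE : t ∉ stabilizer hH) (htE' : t' ∉ stabilizer hH)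
    (hP : ∀ᶠ k in UF, ∃ P z, R.Paired t (f k) t' (f' k) P z) :
    ∃ (P Q : ℕ → V) (z : ℕ → W) (Λ τ τ' : ℕ → ℝ) (ω c C : ℝ), 0 < ω ∧ 0 < c ∧
      Tendsto P UF (𝓝 H.p) ∧ Tendsto Q UF (𝓝 H.p) ∧ Tendsto (fun k => τ k * τ' k) UF (𝓝 ω) ∧
      ∀ᶠ k in UF, 0 < Λ k ∧ R.ρ (f k) (P k) = Λ k • R.ρ t (P k) ∧ 0 < τ k ∧ 0 < τ' k ∧
        R.ρ (z k) (P k) = τ k • Q k ∧ R.ρ (z k) (R.ρ t (P k)) = τ' k • R.ρ t' (Q k) ∧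
        τ k ^ 2 ≤ C ∧ c * Λ k ≤ τ k ^ 2 := by
  have hf2 := fun k => hH.flip_mul_self (hf.2 k).1
  have hf2' := fun k => hH.flip_mul_self (hf'.2 k).1
  obtain ⟨P, z, c, hPz, hc, hlim, hlim'⟩ := hH.1.exists_tendsto_paired hf hf' ht ht' hf2 hf2' hP
  obtain ⟨Λ, hΛ⟩ := (hPz.mono fun k h => h.apply_f).choice
  obtain ⟨a, ha⟩ := (hPz.mono fun k h => h.apply_t').choice
  have hΛ0 := (hf.limit (hH.cq_apply_pos htE) hlim hΛ).1
  set Q := fun k => c k • R.ρ (z k) (P k) with hQ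
  have hne : ∀ w : W, w ∉ stabilizer hH → R.B H.p (R.ρ w H.p) < 0 := fun w hw => by
    rw [R.comm, form_p]
    exact mul_neg_of_neg_of_pos H.pq_neg (hH.cq_apply_pos hw)
  have h1 : ∀ᶠ k in UF, 0 < (c k)⁻¹ ∧ 0 < (a k)⁻¹ * (c k)⁻¹ ∧
      R.ρ (z k) (P k) = (c k)⁻¹ • Q k ∧
      R.ρ (z k) (R.ρ t (P k)) = ((a k)⁻¹ * (c k)⁻¹) • R.ρ t' (Q k) :=
    (hc.and ha).mono fun k h => by
      obtain ⟨h1, h2, h3⟩ := h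
      refine ⟨by positivity, by positivity, ?_, ?_⟩
      · rw [hQ, smul_smul, inv_mul_cancel₀ h1.ne', one_smul]
      · rw [hQ]
        dsimp only
        rw [map_smul, smul_smul, inv_mul_cancel_right₀ h1.ne', h3, smul_smul,
          inv_mul_cancel₀ h2.ne', one_smul]
  have hB : Tendsto (fun k => R.B (P k) (R.ρ t (P k))) UF (𝓝 (R.B H.p (R.ρ t H.p))) :=
    tendsto_bilin R.B hlim (tendsto_linear _ hlim)
  have hB' : Tendsto (fun k => R.B (Q k) (R.ρ t' (Q k))) UF (𝓝 (R.B H.p (R.ρ t' H.p))) :=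
    tendsto_bilin R.B hlim' (tendsto_linear _ hlim')
  have hω : Tendsto (fun k => (c k)⁻¹ * ((a k)⁻¹ * (c k)⁻¹)) UF
      (𝓝 (R.B H.p (R.ρ t H.p) / R.B H.p (R.ρ t' H.p))) := by
    refine (hB.div hB' (hne _ htE').ne).congr' ((h1.and
      (hB'.eventually_ne (hne _ htE').ne)).mono fun k h => ?_)
    obtain ⟨⟨-, -, h3, h4⟩, h5⟩ := h
    have h6 := R.inv (z k) (P k) (R.ρ t (P k))
    rw [h3, h4, map_smul, map_smul, LinearMap.smul_apply, smul_eq_mul, smul_eq_mul] at h6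
    simp only [Pi.div_apply]
    rw [← h6]
    field_simp
  have hω0 : 0 < R.B H.p (R.ρ t H.p) / R.B H.p (R.ρ t' H.p) :=
    div_pos_of_neg_of_neg (hne _ htE) (hne _ htE')
  generalize R.B H.p (R.ρ t H.p) / R.B H.p (R.ρ t' H.p) = ω at hω hω0
  have h2 : ∀ᶠ k in UF, ∃ (w : W) (σ σ' : ℝ), 0 < σ ∧ 0 < σ' ∧ R.ρ w (P k) = σ • Q k ∧
      R.ρ w (R.ρ t (P k)) = σ' • R.ρ t' (Q k) ∧ σ * σ' = (c k)⁻¹ * ((a k)⁻¹ * (c k)⁻¹) ∧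
      σ ^ 2 ≤ 2 * ω ∧ min 1 ((ω / 2) ^ 2) * Λ k ≤ σ ^ 2 := by
    filter_upwards [h1, hΛ, hΛ0.eventually_lt_const one_pos,
      hω.eventually_const_le (half_lt_self hω0),
      hω.eventually_le_const (show ω < 2 * ω by linarith)] with k h1 h2 h3 h4 h5
    exact exists_balanced ht (hf2 k) ht' h2.1 h3 h2.2 h1.1 h1.2.1 h1.2.2.1 h1.2.2.2
      (half_pos hω0) h4 h5
  obtain ⟨w, h2⟩ := h2.choice
  obtain ⟨σ, h2⟩ := h2.choice
  obtain ⟨σ', h2⟩ := h2.choice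
  refine ⟨P, Q, w, Λ, σ, σ', ω, min 1 ((ω / 2) ^ 2), 2 * ω, hω0,
    lt_min one_pos (by positivity), hlim, hlim',
    hω.congr' (h2.mono fun k h => h.2.2.2.2.1.symm), (hΛ.and h2).mono fun k h => ?_⟩
  obtain ⟨⟨h1, h2⟩, h3, h4, h5, h6, -, h7, h8⟩ := h
  exact ⟨h1, h2, h3, h4, h5, h6, h7, h8⟩

end HypPair

end RootData

end CoxeterTits

namespace CoxeterTits

open Filter Topology

namespace RootData

variable {W : Type*} [Group W] {V : Type*} [NormedAddCommGroup V] [NormedSpace ℝ V]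
  [FiniteDimensional ℝ V] {R : RootData W V}

namespace HypPair

variable {H : R.HypPair}

theorem Generic.exists_fix_conj (hH : H.Generic) {t t' : W} {f f' : ℕ → W} {ε ε' : ℕ → ℝ}
    {f₀ f₀' : W} (hf : H.FlipSeq f ε f₀) (hf' : H.FlipSeq f' ε' f₀') (ht : t * t = 1)
    (ht' : t' * t' = 1) (htE : t ∉ stabilizer hH) (htE' : t' ∉ stabilizer hH)
    (hP : ∀ᶠ k in UF, ∃ P z, R.Paired t (f k) t' (f' k) P z) :
    ∃ e τ, H.Fix e τ ∧ t' = e * t * e⁻¹ := by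
  obtain ⟨P, Q, z, Λ, τ, τ', ω, c, C, hω, hc, hPlim, hQlim, hωlim, hall⟩ :=
    hH.exists_balanced_seq hf hf' ht ht' htE htE' hP
  obtain ⟨hΛ, hcq, hmm⟩ := hf.limit (hH.cq_apply_pos htE) hPlim
    (hall.mono fun k h => ⟨h.1, h.2.1⟩)
  have htP : Tendsto (fun k => R.ρ t (P k)) UF (𝓝 (R.ρ t H.p)) := tendsto_linear _ hPlim
  -- the scale of the distortion
  obtain ⟨i, hi⟩ := (hall.mono fun k h =>
    exists_mem_Ico_zpow (inv_pos.2 h.2.2.1) H.one_lt_lam).choice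
  set e : ℕ → ℝ := fun k => (τ k)⁻¹ * H.lam ^ (-i k) with he_def
  have he : ∀ k, e k = (τ k)⁻¹ * H.lam ^ (-i k) := fun k => rfl
  obtain ⟨e₀, ⟨he₀, -⟩, helim⟩ := uf_exists_tendsto_of_mem_Icc (f := e) (a := 1) (b := H.lam)
    (hi.mono fun k h => by
      have h0 := zpow_pos H.lam_pos (i k)
      rw [he, zpow_neg]
      refine ⟨?_, ?_⟩
      · rw [← div_eq_mul_inv, one_le_div h0]
        exact h.1
      · rw [← div_eq_mul_inv, div_le_iff₀ h0, mul_comm, ← zpow_add_one₀ H.lam_pos.ne']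
        exact h.2.le)
  have he₀' : 0 < e₀ := one_pos.trans_le he₀
  obtain ⟨τ₀, ⟨hτ₀, -⟩, hτlim⟩ := uf_exists_tendsto_of_mem_Icc (f := τ) (a := 0) (b := 1 + C)
    (hall.mono fun k h => ⟨h.2.2.1.le, by nlinarith [h.2.2.2.2.2.2.1, sq_nonneg (τ k - 1)]⟩)
  obtain ⟨θ, -, hθ⟩ := uf_exists_tendsto_of_mem_Icc (f := fun k => (τ k ^ 2)⁻¹ * Λ k) (a := 0)
    (b := c⁻¹) (hall.mono fun k h => by
      have h1 := h.1
      have h2 := h.2.2.1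
      refine ⟨by positivity, ?_⟩
      rw [inv_mul_le_iff₀ (by positivity), ← div_eq_mul_inv, le_div_iff₀ hc, mul_comm]
      exact h.2.2.2.2.2.2.2)
  have hsq : Tendsto (fun k => (τ k)⁻¹ * Λ k) UF (𝓝 0) := by
    have h1 := (Real.continuous_sqrt.tendsto _).comp (hθ.mul hΛ)
    rw [mul_zero, Real.sqrt_zero] at h1
    refine h1.congr' (hall.mono fun k h => ?_)
    have h1 := h.1
    have h2 := h.2.2.1
    simp only [Function.comp_apply]
    rw [show (τ k ^ 2)⁻¹ * Λ k * Λ k = ((τ k)⁻¹ * Λ k) ^ 2 by rw [mul_pow, inv_pow]; ring]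
    exact Real.sqrt_sq (by positivity)
  set u : ℕ → W := fun k => H.g ^ (-i k) * (z k)⁻¹ with hu_def
  have hu : ∀ k, u k = H.g ^ (-i k) * (z k)⁻¹ := fun k => rfl
  have hinv : ∀ᶠ k in UF, (e k)⁻¹ * (τ k)⁻¹ = H.lam ^ (- -i k) ∧
      e k * τ k = H.lam ^ (-i k) := hall.mono fun k h => by
    have h0 := h.2.2.1.ne'
    have h1 := H.lam_zpow_ne (i k)
    rw [he, zpow_neg, zpow_neg, zpow_neg]
    constructor <;> field_simp
  have huQ : Tendsto (fun k => R.ρ (u k) (Q k)) UF (𝓝 (e₀ • H.p)) := by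
    have h1 := (helim.mul (tendsto_linear H.cp hPlim)).smul_const H.p
    have h2 := ((helim.inv₀ he₀'.ne').mul (hθ.mul
      (hf.1.mul (tendsto_linear H.cp htP)))).smul_const H.q
    have h3 := hsq.smul (tendsto_linear (R.ρ f₀⁻¹ ∘ₗ H.mm) htP)
    have h4 := (h1.add h2).add h3
    simp only [cp_p, mul_one, zero_mul, mul_zero, zero_smul, add_zero] at h4
    refine h4.congr' ((hall.and (hcq.and (hmm.and hinv))).mono fun k h => ?_)
    obtain ⟨⟨h1, -, h2, -, h3, -⟩, h4, h5, h6, -⟩ := h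
    have h7 : R.ρ (z k)⁻¹ (Q k) = (τ k)⁻¹ • P k := R.apply_injective (z k) (by
      rw [apply_inv_self, map_smul, h3, smul_smul, inv_mul_cancel₀ h2.ne', one_smul])
    dsimp only
    rw [hu, mul_apply, h7, map_smul, H.zpow_apply, h4, ← h6, h5, smul_add, smul_add, smul_smul,
      smul_smul, smul_smul, he, LinearMap.comp_apply]
    congr 3
    · ring
    · ring
  have hut : Tendsto (fun k => R.ρ (u k) (R.ρ t' (Q k))) UF (𝓝 (ω⁻¹ •
      ((e₀ * τ₀ ^ 2 * H.cp (R.ρ t H.p)) • H.p + (e₀⁻¹ * H.cq (R.ρ t H.p)) • H.q +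
        τ₀ • H.mm (R.ρ t H.p)))) := by
    have h1 := ((helim.mul (hτlim.pow 2)).mul (tendsto_linear H.cp htP)).smul_const H.p
    have h2 := ((helim.inv₀ he₀'.ne').mul (tendsto_linear H.cq htP)).smul_const H.q
    have h3 := hτlim.smul (tendsto_linear H.mm htP)
    refine ((hωlim.inv₀ hω.ne').smul ((h1.add h2).add h3)).congr' ((hall.and hinv).mono
      fun k h => ?_)
    obtain ⟨⟨-, -, h2, h3, -, h4, -⟩, h5, h6⟩ := h
    have h7 : R.ρ (z k)⁻¹ (R.ρ t' (Q k)) = (τ' k)⁻¹ • R.ρ t (P k) := R.apply_injective (z k) (by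
      rw [apply_inv_self, map_smul, h4, smul_smul, inv_mul_cancel₀ h3.ne', one_smul])
    dsimp only
    rw [hu, mul_apply, h7, map_smul, H.zpow_apply, ← h5, ← h6]
    simp only [smul_add, smul_smul]
    have := h2.ne'
    have := h3.ne'
    congr 3
    · field_simp
    · field_simp
    · field_simp
  obtain ⟨w, hw⟩ := eventually_const (P := H.p) (Q := R.ρ t' H.p) hH.1.reg_p (R.L_map _ _ H.p_mem)
    (by rw [R.comm, form_p]; exact mul_ne_zero H.pq_ne (hH.cq_apply_pos htE').ne')
    (hQlim.add (tendsto_linear (R.ρ t') hQlim)) (u := u) (by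
      simp only [map_add]
      exact huQ.add hut)
  have hwp : R.ρ w H.p = e₀ • H.p := by
    refine tendsto_nhds_unique (tendsto_linear (R.ρ w) hQlim) (huQ.congr' (hw.mono fun k h => ?_))
    rw [h]
  have hwt := tendsto_nhds_unique (tendsto_linear (R.ρ w) (tendsto_linear (R.ρ t') hQlim))
    (hut.congr' (hw.mono fun k h => by rw [h]))
  have hwF := hH.1.fix_of_apply_p hwp
  rcases hτ₀.eq_or_lt with h0 | hτ₀
  · exfalso
    rw [← h0, zero_pow two_ne_zero, mul_zero, zero_mul, zero_smul, zero_smul, zero_add, add_zero,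
      smul_smul, ← mul_apply] at hwt
    have h1 : w * t' ∈ stabilizer hH := ⟨_, Or.inr (hH.1.flip_of_apply_p hwt)⟩
    have h2 : w ∈ stabilizer hH := ⟨_, Or.inl hwF⟩
    exact htE' ((Subgroup.mul_mem_cancel_left _ h2).1 h1)
  have hzF : ∀ᶠ k in UF, H.Fix (z k) (e₀⁻¹ * (e k * τ k)) := (hw.and hinv).mono fun k h => by
    have h1 : z k = w⁻¹ * H.g ^ (-i k) := by
      rw [← h.1, hu]
      group
    rw [h.2.2, h1]
    exact hwF.inv.mul (H.fix_g.zpow (-i k))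
  have hσ : Tendsto (fun k => e₀⁻¹ * (e k * τ k)) UF (𝓝 τ₀) := by
    have := (helim.mul hτlim).const_mul e₀⁻¹
    rwa [inv_mul_cancel_left₀ he₀'.ne'] at this
  obtain ⟨v, hv⟩ := eventually_const hH.1.reg_p H.q_mem H.pq_ne (u := z) (y := fun _ => H.p + H.q)
    (x := τ₀ • H.p + τ₀⁻¹ • H.q) tendsto_const_nhds
    (((hσ.smul_const H.p).add ((hσ.inv₀ hτ₀.ne').smul_const H.q)).congr' (hzF.mono fun k h => by
      dsimp only
      rw [map_add, h.2.1, h.2.2]))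
  obtain ⟨k, hk, hk'⟩ := (hzF.and hv).exists
  rw [hk'] at hk
  refine ⟨v, _, hk, hH.eq_conj_of_apply ht htE ht' hk (b := τ₀⁻¹ * ω) ?_⟩
  have h1 : Tendsto (fun k => ((τ k)⁻¹ * (τ k * τ' k)) • R.ρ t' (Q k)) UF
      (𝓝 ((τ₀⁻¹ * ω) • R.ρ t' H.p)) :=
    ((hτlim.inv₀ hτ₀.ne').mul hωlim).smul (tendsto_linear _ hQlim)
  refine tendsto_nhds_unique (tendsto_linear (R.ρ v) htP)
    (h1.congr' ((hall.and hv).mono fun k h => ?_))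
  dsimp only
  rw [inv_mul_cancel_left₀ h.1.2.2.1.ne', ← h.1.2.2.2.2.2.1, h.2]

end HypPair

end RootData

end CoxeterTits

namespace CoxeterTits

open Filter Topology

theorem eventually_one_lt_abs_of_tendsto {a b : ℕ → ℝ} {l : ℝ} (ha : Tendsto a UF (𝓝 0))
    (h : Tendsto (fun k => a k * b k) UF (𝓝 l)) (hl : l ≠ 0) : ∀ᶠ k in UF, 1 < |b k| := by
  have h0 : 0 < |l| / 2 := half_pos (abs_pos.2 hl)
  have h1 := ha.abs.eventually (eventually_lt_nhds (b := |l| / 2) (by rwa [abs_zero]))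
  have h2 := h.abs.eventually (eventually_gt_nhds (half_lt_self (abs_pos.2 hl)))
  filter_upwards [h1, h2] with k h1 h2
  rw [abs_mul] at h2
  by_contra! h3
  nlinarith [mul_le_mul_of_nonneg_left h3 (abs_nonneg (a k))]

theorem ne_zero_of_commElem_one {G : Type*} [Group G] {x : G} (h : CommElem 1 x) :
    ∃ m : ℤ, m ≠ 0 ∧ x ^ m = 1 := by
  obtain ⟨z, m, n, hm, -, h⟩ := h
  refine ⟨m, hm, ?_⟩
  rw [one_zpow, eq_comm, mul_inv_eq_one] at h
  exact mul_eq_left.1 h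

namespace RootData

variable {W : Type*} [Group W] {V : Type*} [NormedAddCommGroup V] [NormedSpace ℝ V]
  [FiniteDimensional ℝ V] {R : RootData W V}

theorem eventually_one_lt_abs_form {X Y : ℕ → V} {a b : ℕ → ℝ} {x y : V}
    (ha : Tendsto a UF (𝓝 0)) (hb : Tendsto b UF (𝓝 0))
    (hx : Tendsto (fun k => a k • X k) UF (𝓝 x)) (hy : Tendsto (fun k => b k • Y k) UF (𝓝 y))
    (hxy : R.B x y ≠ 0) : ∀ᶠ k in UF, 1 < |R.B (X k) (Y k)| := by
  refine eventually_one_lt_abs_of_tendsto (a := fun k => a k * b k) (by simpa using ha.mul hb)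
    ((tendsto_bilin R.B hx hy).congr fun k => ?_) hxy
  rw [map_smul, map_smul, LinearMap.smul_apply, smul_eq_mul, smul_eq_mul]
  ring

theorem map_s_ne {φ : W →* W} (hφ : ∀ g, CommElem (φ g) g) {x y : V} (hx : x ∈ R.Φ)
    (hy : y ∈ R.Φ) (h : 1 < |R.B x y|) : φ (R.s x) ≠ φ (R.s y) := fun h0 => by
  have h1 := hφ (R.s x * R.s y)
  rw [map_mul, h0, ← map_mul, R.s_mul_self hy, map_one] at h1
  obtain ⟨m, hm, h1⟩ := ne_zero_of_commElem_one h1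
  exact zpow_mul_ne_one hx hy h hm h1

namespace HypPair

variable {H : R.HypPair}

theorem Generic.flip_map (hH : H.Generic) {φ : W →* W} {n m : ℤ} (hm : m ≠ 0)
    (hG : φ (H.g ^ n) = H.g ^ m) : ∃ τ, H.Flip (φ (R.s H.β)) τ := by
  refine hH.flip_of_conj_inv hm ?_
  rw [← hG, ← map_inv, ← map_inv, ← map_mul, ← map_mul, hH.flip_conj H.flip_s (H.fix_g.zpow n)]

theorem Generic.map_notMem (hH : H.Generic) {φ : W →* W} (hφ : ∀ g, CommElem (φ g) g) {n m : ℤ}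
    (hn : 0 < n) (hG : φ (H.g ^ n) = H.g ^ m) {δ : V} (hδ : δ ∈ R.Φ)
    (h : R.s δ ∉ stabilizer hH) : φ (R.s δ) ∉ stabilizer hH := by
  have hG' : ∀ j : ℤ, φ (H.g ^ (n * j)) = H.g ^ (m * j) := fun j => by
    rw [zpow_mul, map_zpow, hG, zpow_mul]
  have hX : Tendsto (fun k : ℕ => H.lam ^ (-(n * (k : ℤ))) •
      R.ρ (R.s δ * H.g ^ (n * (k : ℤ)) * R.s δ) δ) UF (𝓝 (-(H.cp δ • R.ρ (R.s δ) H.p))) := by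
    have h1 := (tendsto_linear (R.ρ (R.s δ)) (H.tendsto_zpow_mul_smul hn δ)).neg
    rw [map_smul] at h1
    refine h1.congr fun k => ?_
    rw [mul_apply, R.s_self hδ, mul_apply, map_neg, map_neg, map_smul, smul_neg]
  have h0 := H.tendsto_lam_neg_mul hn
  have hcp := hH.cp_root_ne hδ h
  have hcq := hH.cq_root_ne hδ h
  rintro ⟨τ, hτ | hτ⟩
  · obtain ⟨k, hk⟩ := (eventually_one_lt_abs_form (R := R) h0 h0 hX (H.tendsto_zpow_mul_smul hn δ)
      (by
        rw [map_neg, map_smul, map_smul, LinearMap.neg_apply, LinearMap.smul_apply, H.form_p]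
        exact mul_ne_zero hcp (neg_ne_zero.2 (mul_ne_zero hcp
          (mul_ne_zero H.pq_ne (hH.cq_apply_pos h).ne'))))).exists
    refine map_s_ne hφ (R.Φ_map _ _ hδ) (R.Φ_map _ _ hδ) hk ?_
    rw [← R.conj_s hδ, ← R.conj_s hδ]
    simp only [map_mul, map_inv, hG']
    rw [hH.comm_of_fix hτ (H.fix_g.zpow (m * k))]
    group
  · obtain ⟨k, hk⟩ := (eventually_one_lt_abs_form (R := R) h0 h0 hX
      (H.tendsto_neg_zpow_mul_smul hn δ)
      (by
        rw [map_neg, map_smul, map_smul, LinearMap.neg_apply, LinearMap.smul_apply, H.form_q]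
        exact mul_ne_zero hcq (neg_ne_zero.2 (mul_ne_zero hcp
          (mul_ne_zero H.pq_ne (hH.cp_apply_pos h).ne'))))).exists
    refine map_s_ne hφ (R.Φ_map _ _ hδ) (R.Φ_map _ _ hδ) hk ?_
    rw [← R.conj_s hδ, ← R.conj_s hδ]
    simp only [map_mul, map_inv, zpow_neg, hG']
    have h1 := hH.flip_conj hτ (H.fix_g.zpow (m * k))
    rw [hH.flip_inv hτ] at h1
    rw [h1]

theorem Generic.map_eq_conj (hH : H.Generic) {φ : W →* W} (hφ : ∀ g, CommElem (φ g) g) {n m : ℤ}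
    (hn : 0 < n) (hm : 0 < m) (hG : φ (H.g ^ n) = H.g ^ m) {δ : V} (hδ : δ ∈ R.Φ)
    (h : R.s δ ∉ stabilizer hH) : ∃ e τ, H.Fix e τ ∧ φ (R.s δ) = e * R.s δ * e⁻¹ := by
  obtain ⟨c, hc⟩ := hH.flip_map hm.ne' hG
  obtain ⟨ε, hε⟩ := H.flip_s.flipSeq hn
  obtain ⟨ε', hε'⟩ := hc.flipSeq hm
  refine hH.exists_fix_conj hε hε' (R.s_mul_self hδ)
    (by rw [← map_mul, R.s_mul_self hδ, map_one]) h (hH.map_notMem hφ hn hG hδ h) ?_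
  have h1 : ∀ᶠ k : ℕ in UF, 1 < |R.B δ (R.ρ (H.g ^ (n * (k : ℤ))) H.β)| := by
    refine eventually_one_lt_abs_of_tendsto (H.tendsto_lam_neg_mul hn) ((tendsto_linear (R.B δ)
      (H.tendsto_zpow_mul_smul hn H.β)).congr fun k => by rw [map_smul, smul_eq_mul]) ?_
    rw [map_smul, R.comm]
    exact mul_ne_zero H.cp_β_pos.ne' (hH.form_p_ne hδ h)
  refine h1.mono fun k hk => ?_
  obtain ⟨P, z, hP⟩ := R.exists_paired hδ (R.Φ_map _ _ H.hβ) hk hφ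
  refine ⟨P, z, ?_⟩
  rw [← R.conj_s H.hβ] at hP
  simpa only [map_mul, map_inv, zpow_mul, map_zpow, hG] using hP

end HypPair

end RootData

end CoxeterTits

namespace CoxeterTits

open Filter Topology

namespace RootData

variable {W : Type*} [Group W] {V : Type*} [NormedAddCommGroup V] [NormedSpace ℝ V]
  [FiniteDimensional ℝ V] {R : RootData W V}

namespace HypPair

variable {H : R.HypPair}

theorem Generic.not_fix_s (hH : H.Generic) {δ : V} (hδ : δ ∈ R.Φ) {τ : ℝ} :
    ¬ H.Fix (R.s δ) τ := fun h => by
  have h1 := h.mul h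
  rw [R.s_mul_self hδ] at h1
  have h2 : τ * τ = 1 := h1.unique H.fix_one
  have h3 : τ = 1 := by nlinarith [h.1]
  rw [h3] at h
  exact R.s_ne_one hδ (hH.eq_one h)

theorem Generic.exists_flip_s (hH : H.Generic) {δ : V} (hδ : δ ∈ R.Φ)
    (h : R.s δ ∈ stabilizer hH) : ∃ τ, H.Flip (R.s δ) τ := by
  obtain ⟨τ, h | h⟩ := h
  · exact (hH.not_fix_s hδ h).elim
  · exact ⟨τ, h⟩

theorem Generic.cp_mul_cq_neg (hH : H.Generic) {δ : V} (hδ : δ ∈ R.Φ)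
    (h : R.s δ ∈ stabilizer hH) : H.cp δ * H.cq δ < 0 := by
  obtain ⟨τ, h⟩ := hH.exists_flip_s hδ h
  have h1 := congrArg H.cp h.2.1
  rw [R.s_apply δ hδ, R.comm, H.form_p] at h1
  simp only [map_sub, map_smul, cp_p, cp_q, smul_eq_mul, mul_zero] at h1
  by_contra! h2
  nlinarith [mul_nonneg (neg_nonneg.2 H.pq_neg.le) h2]

theorem Generic.eventually_notMem (hH : H.Generic) {n : ℤ} (hn : 0 < n) {t : W} {δ : V}
    (hδ : δ ∈ R.Φ) (ht : t ∉ stabilizer hH) (h : R.s δ ∉ stabilizer hH) :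
    ∀ᶠ k : ℕ in UF, R.s (R.ρ (t * H.g ^ (n * (k : ℤ))) δ) ∉ stabilizer hH := by
  have h1 := tendsto_linear (R.ρ t) (H.tendsto_zpow_mul_smul hn δ)
  have h2 := (tendsto_linear H.cp h1).mul (tendsto_linear H.cq h1)
  have hpos : 0 < H.cp (R.ρ t (H.cp δ • H.p)) * H.cq (R.ρ t (H.cp δ • H.p)) := by
    have h3 := mul_pos (hH.cp_apply_pos ht) (hH.cq_apply_pos ht)
    have h4 : 0 < H.cp δ * H.cp δ := mul_self_pos.2 (hH.cp_root_ne hδ h)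
    simp only [map_smul, smul_eq_mul]
    nlinarith [mul_pos h4 h3]
  refine (h2.eventually (eventually_gt_nhds hpos)).mono fun k hk h0 => ?_
  have h3 := hH.cp_mul_cq_neg (R.Φ_map _ _ hδ) h0
  rw [mul_apply] at h3
  have h4 := zpow_pos H.lam_pos (-(n * (k : ℤ)))
  simp only [map_smul, smul_eq_mul] at hk
  nlinarith [mul_pos h4 h4]

theorem Generic.conj_unique (hH : H.Generic) {φ : W →* W} (hφ : ∀ g, CommElem (φ g) g) {n m : ℤ}
    (hn : 0 < n) (hm : 0 < m) (hG : φ (H.g ^ n) = H.g ^ m) {δ δ' : V} (hδ : δ ∈ R.Φ)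
    (hδ' : δ' ∈ R.Φ) (h : R.s δ ∉ stabilizer hH) (h' : R.s δ' ∉ stabilizer hH) {e e' : W}
    {τ τ' : ℝ} (he : H.Fix e τ) (he' : H.Fix e' τ') (h1 : φ (R.s δ) = e * R.s δ * e⁻¹)
    (h1' : φ (R.s δ') = e' * R.s δ' * e'⁻¹) : e = e' := by
  set t := R.s δ with ht
  have htinv : t⁻¹ = t := R.s_inv hδ
  have hfix := he.inv.mul he'
  set b := e⁻¹ * e' with hb
  set α := τ⁻¹ * τ' with hα
  have hφc : ∀ k : ℕ, φ (R.s (R.ρ (t * H.g ^ (n * (k : ℤ))) δ')) =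
      e * R.s (R.ρ (t * (b * H.g ^ (m * (k : ℤ)))) δ') * e⁻¹ := fun k => by
    have hc : H.g ^ (m * (k : ℤ)) * e' = e' * H.g ^ (m * (k : ℤ)) :=
      hH.comm_of_fix (H.fix_g.zpow _) he'
    rw [← R.conj_s hδ', ← R.conj_s hδ', mul_inv_rev, mul_inv_rev, htinv]
    simp only [map_mul, map_inv, h1, h1', zpow_mul, map_zpow, hG]
    rw [← zpow_mul]
    have h2 : e⁻¹ * H.g ^ (m * (k : ℤ)) * e' = b * H.g ^ (m * (k : ℤ)) := by
      rw [mul_assoc, hc, hb, mul_assoc]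
    rw [← h2]
    group
  have key : ∀ᶠ k : ℕ in UF, ∃ σ D : ℝ, σ * σ = 1 ∧ 0 < D ∧
      H.cp (R.ρ (t * (b * H.g ^ (m * (k : ℤ)))) δ') =
        σ * (D * H.cp (R.ρ (t * H.g ^ (n * (k : ℤ))) δ')) ∧
      H.cq (R.ρ (t * (b * H.g ^ (m * (k : ℤ)))) δ') =
        σ * (D⁻¹ * H.cq (R.ρ (t * H.g ^ (n * (k : ℤ))) δ')) := by
    refine (hH.eventually_notMem hn hδ' h h').mono fun k hk => ?_
    obtain ⟨u, ν, hu, h2⟩ := hH.map_eq_conj hφ hn hm hG (R.Φ_map _ _ hδ') hk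
    have hd := he.inv.mul hu
    rw [hφc] at h2
    have h3 : R.s (R.ρ (t * (b * H.g ^ (m * (k : ℤ)))) δ') =
        R.s (R.ρ (e⁻¹ * u) (R.ρ (t * H.g ^ (n * (k : ℤ))) δ')) := by
      rw [← R.conj_s (R.Φ_map _ _ hδ') (e⁻¹ * u)]
      have h4 := congrArg (fun x => e⁻¹ * x * e) h2
      simp only [mul_assoc, inv_mul_cancel_left, inv_mul_cancel, mul_one] at h4
      rw [h4]
      group
    rcases R.eq_or_eq_neg_of_s_eq (R.Φ_map _ _ hδ') (R.Φ_map _ _ (R.Φ_map _ _ hδ')) h3 with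
      h4 | h4
    · refine ⟨1, _, by norm_num, hd.1, ?_, ?_⟩ <;> rw [h4]
      · rw [hd.cp_apply, one_mul]
      · rw [hd.cq_apply, one_mul]
    · refine ⟨-1, _, by norm_num, hd.1, ?_, ?_⟩ <;> rw [h4, map_neg]
      · rw [hd.cp_apply, neg_one_mul]
      · rw [hd.cq_apply, neg_one_mul]
  have hlim := tendsto_linear (R.ρ t) (H.tendsto_zpow_mul_smul hn δ')
  have hlim' := (tendsto_linear (R.ρ t) (tendsto_linear (R.ρ b)
    (H.tendsto_zpow_mul_smul hm δ'))).const_smul α⁻¹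
  have hend : α⁻¹ • R.ρ t (R.ρ b (H.cp δ' • H.p)) = R.ρ t (H.cp δ' • H.p) := by
    rw [map_smul, hfix.2.1, smul_comm, map_smul, inv_smul_smul₀ hfix.1.ne']
  rw [hend] at hlim'
  have hcp : H.cp (R.ρ t (H.cp δ' • H.p)) ≠ 0 := by
    rw [map_smul, map_smul, smul_eq_mul]
    exact mul_ne_zero (hH.cp_root_ne hδ' h') (hH.cp_apply_pos h).ne'
  have hcq : H.cq (R.ρ t (H.cp δ' • H.p)) ≠ 0 := by
    rw [map_smul, map_smul, smul_eq_mul]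
    exact mul_ne_zero (hH.cp_root_ne hδ' h') (hH.cq_apply_pos h).ne'
  have hrp := (tendsto_linear H.cp hlim').div (tendsto_linear H.cp hlim) hcp
  have hrq := (tendsto_linear H.cq hlim').div (tendsto_linear H.cq hlim) hcq
  have hprod := hrp.mul hrq
  rw [div_self hcp, div_self hcq, mul_one] at hprod
  have hsqrt := (Real.continuous_sqrt.tendsto _).comp hprod
  rw [Real.sqrt_one] at hsqrt
  have hnep := (tendsto_linear H.cp hlim).eventually_ne hcp
  have hneq := (tendsto_linear H.cq hlim).eventually_ne hcq
  have hone : ∀ᶠ k : ℕ in UF, H.g ^ (n * (k : ℤ)) * (b * H.g ^ (m * (k : ℤ)))⁻¹ = 1 := by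
    refine hH.eventually_eq_one
      (τ := fun k => H.lam ^ (n * (k : ℤ)) * (α * H.lam ^ (m * (k : ℤ)))⁻¹)
      (Eventually.of_forall fun k =>
        (H.fix_g.zpow _).mul (hfix.mul (H.fix_g.zpow _)).inv) (hsqrt.congr' ?_)
    filter_upwards [key, hnep, hneq] with k hk h2 h3
    obtain ⟨σ, D, hσ, hD, h4, h5⟩ := hk
    have hn0 := zpow_pos H.lam_pos (n * (k : ℤ))
    have hm0 := zpow_pos H.lam_pos (m * (k : ℤ))
    have hα0 := hfix.1
    simp only [map_smul, smul_eq_mul, ← mul_apply] at h2 h3 ⊢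
    simp only [Function.comp_apply, Pi.div_apply]
    rw [Real.sqrt_eq_iff_mul_self_eq_of_pos (by positivity), h4, h5]
    rw [zpow_neg] at h2 h3 ⊢
    have h6 := right_ne_zero_of_mul h2
    have h7 := right_ne_zero_of_mul h3
    rw [zpow_neg]
    field_simp
    linear_combination -hσ
  have hb1 : ∀ᶠ k : ℕ in UF, H.g ^ ((n - m) * (k : ℤ)) = b := hone.mono fun k hk => by
    rw [sub_mul, zpow_sub, mul_inv_eq_one.1 hk]
    group
  have hnm : n = m := by
    by_contra hne
    refine uf_not_eventually_eq_of_injective (fun k l hkl => ?_) b hb1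
    have h2 : H.g ^ ((n - m) * (k : ℤ) - (n - m) * (l : ℤ)) = 1 := by
      rw [zpow_sub]
      exact mul_inv_eq_one.2 hkl
    rw [zpow_eq_one_iff, ← mul_sub, mul_eq_zero] at h2
    omega
  obtain ⟨k, hk⟩ := hb1.exists
  rw [hnm, sub_self, zero_mul, zpow_zero, hb] at hk
  exact inv_mul_eq_one.1 hk.symm

end HypPair

end RootData

end CoxeterTits

namespace CoxeterTits

open Filter Topology

namespace RootData

variable {W : Type*} [Group W] {V : Type*} [NormedAddCommGroup V] [NormedSpace ℝ V]
  [FiniteDimensional ℝ V] {R : RootData W V}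

namespace HypPair

variable {H : R.HypPair}

theorem Generic.conj_zpow_notMem (hH : H.Generic) {k : ℤ} (hk : k ≠ 0) {t : W}
    (ht : t ∉ stabilizer hH) : t * H.g ^ k * t⁻¹ ∉ stabilizer hH := by
  rintro ⟨σ, hσ | hσ⟩
  · have hne : t * H.g ^ k * t⁻¹ ≠ 1 := fun h => hk (zpow_eq_one_iff.1 (conj_eq_one_iff.1 h))
    have hσ1 : σ ≠ 1 := fun h => hne (hH.eq_one (h ▸ hσ))
    exact ht (hH.1.fix_or_flip_of_conj (H.fix_g.zpow k) hσ hσ1 rfl)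
  · have h1 := hH.flip_mul_self hσ
    have h2 : t * H.g ^ (k + k) * t⁻¹ = 1 := by
      rw [← h1, zpow_add]
      group
    have h3 := zpow_eq_one_iff.1 (conj_eq_one_iff.1 h2)
    omega

/-- Every reflection is a product of off-axis reflections. -/
theorem Generic.s_mem (hH : H.Generic) {K : Subgroup W}
    (hK : ∀ δ ∈ R.Φ, R.s δ ∉ stabilizer hH → R.s δ ∈ K) {ε : V} (hε : ε ∈ R.Φ)
    (h : R.s ε ∉ stabilizer hH) {δ : V} (hδ : δ ∈ R.Φ) : R.s δ ∈ K := by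
  have conj_mem : ∀ x ∈ R.Φ, R.s x ∉ stabilizer hH →
      R.s x * R.s δ * (R.s x)⁻¹ ∉ stabilizer hH → R.s δ ∈ K := fun x hx h1 h2 => by
    rw [R.conj_s hδ] at h2
    have h3 := hK _ (R.Φ_map _ _ hδ) h2
    rw [← R.conj_s hδ] at h3
    exact (Subgroup.mul_mem_cancel_left _ (hK x hx h1)).1
      ((Subgroup.mul_mem_cancel_right _ (K.inv_mem (hK x hx h1))).1 h3)
  by_cases hδE : R.s δ ∈ stabilizer hH
  swap
  · exact hK δ hδ hδE
  by_cases h1 : R.s ε * R.s δ * (R.s ε)⁻¹ ∈ stabilizer hH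
  swap
  · exact conj_mem ε hε h h1
  have hg : H.g ∈ stabilizer hH := ⟨_, Or.inl H.fix_g⟩
  have ht : H.g * R.s ε * H.g⁻¹ ∉ stabilizer hH := fun h2 => h
    ((Subgroup.mul_mem_cancel_left _ hg).1
      ((Subgroup.mul_mem_cancel_right _ (inv_mem hg)).1 h2))
  rw [R.conj_s hε] at ht
  refine conj_mem _ (R.Φ_map H.g _ hε) ht fun h2 => hH.conj_zpow_notMem (k := -2) (by norm_num) h ?_
  obtain ⟨τ, hτ⟩ := hH.exists_flip_s hδ hδE
  have h3 : R.s ε * H.g ^ (-2 : ℤ) * (R.s ε)⁻¹ = H.g⁻¹ * (R.s (R.ρ H.g ε) * R.s δ *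
      (R.s (R.ρ H.g ε))⁻¹) * H.g * (R.s ε * R.s δ * (R.s ε)⁻¹)⁻¹ := by
    rw [← R.conj_s hε, show (-2 : ℤ) = -1 + -1 by rfl, zpow_add, zpow_neg_one]
    nth_rw 2 [← hH.flip_conj hτ H.fix_g]
    group
  rw [h3]
  exact mul_mem (mul_mem (mul_mem (inv_mem hg) h2) hg) (inv_mem h1)

theorem Generic.eq_conj (hH : H.Generic)
    (hva : ¬ ∃ A : Subgroup W, A.index ≠ 0 ∧ ∀ x y : A, x * y = y * x)
    {φ : W →* W} (hφ : ∀ g, CommElem (φ g) g) {n m : ℤ} (hn : 0 < n) (hm : 0 < m)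
    (hG : φ (H.g ^ n) = H.g ^ m) : ∃ e, ∀ x, φ x = e * x * e⁻¹ := by
  obtain ⟨ε, hε, h⟩ := hH.exists_root_notMem hva
  obtain ⟨e, τ, he, h1⟩ := hH.map_eq_conj hφ hn hm hG hε h
  have hK : ∀ δ ∈ R.Φ, R.s δ ∉ stabilizer hH →
      R.s δ ∈ MonoidHom.eqLocus φ (MulAut.conj e).toMonoidHom := fun δ hδ h' => by
    obtain ⟨e', τ', he', h1'⟩ := hH.map_eq_conj hφ hn hm hG hδ h'
    rw [hH.conj_unique hφ hn hm hG hε hδ h h' he he' h1 h1']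
    exact h1'
  have htop : (⊤ : Subgroup W) ≤ MonoidHom.eqLocus φ (MulAut.conj e).toMonoidHom := by
    rw [← R.gen, Subgroup.closure_le]
    rintro _ ⟨δ, hδ, rfl⟩
    exact hH.s_mem hK hε h hδ
  exact ⟨e, fun x => htop (Subgroup.mem_top x)⟩

theorem Generic.exists_conj_zpow (hH : H.Generic) {x : W} (hx : CommElem x H.g) :
    ∃ (z : W) (m n : ℤ), 0 < m ∧ 0 < n ∧ x ^ n = z * H.g ^ m * z⁻¹ := by
  have key : ∀ (z : W) (m n : ℤ), m ≠ 0 → 0 < n → x ^ n = z * H.g ^ m * z⁻¹ →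
      ∃ (z : W) (m n : ℤ), 0 < m ∧ 0 < n ∧ x ^ n = z * H.g ^ m * z⁻¹ := by
    intro z m n hm hn h
    rcases hm.lt_or_gt with hm | hm
    · refine ⟨z * R.s H.β, -m, n, by omega, hn, ?_⟩
      have h1 := hH.flip_conj H.flip_s (H.fix_g.zpow (-m))
      rw [zpow_neg, inv_inv] at h1
      rw [h, ← h1, zpow_neg]
      group
    · exact ⟨z, m, n, hm, hn, h⟩
  obtain ⟨z, m, n, hm, hn, h⟩ := hx
  rcases hn.lt_or_gt with hn | hn
  · refine key z (-m) (-n) (by omega) (by omega) ?_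
    rw [zpow_neg, zpow_neg, h]
    group
  · exact key z m n hm hn h

end HypPair

theorem exists_eq_conj (R : RootData W V)
    (hva : ¬ ∃ A : Subgroup W, A.index ≠ 0 ∧ ∀ x y : A, x * y = y * x)
    {φ : W →* W} (hφ : ∀ g, CommElem (φ g) g) : ∃ e, ∀ x, φ x = e * x * e⁻¹ := by
  obtain ⟨H, hH⟩ := R.exists_generic
  have hH : H.Generic := hH
  obtain ⟨z, m, n, hm, hn, h⟩ := hH.exists_conj_zpow (hφ H.g)
  obtain ⟨e, he⟩ := hH.eq_conj hva (φ := (MulAut.conj z⁻¹).toMonoidHom.comp φ) (fun x => by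
    obtain ⟨y, k, l, hk, hl, h1⟩ := hφ x
    refine ⟨z⁻¹ * y, k, l, hk, hl, ?_⟩
    rw [MonoidHom.comp_apply, ← map_zpow, h1]
    simp [mul_assoc]) hn hm (by
    rw [map_zpow, MonoidHom.comp_apply, ← map_zpow, h]
    simp [mul_assoc])
  refine ⟨z * e, fun x => ?_⟩
  have h1 := he x
  simp only [MonoidHom.comp_apply, MulEquiv.toMonoidHom_eq_coe, MonoidHom.coe_coe,
    MulAut.conj_apply, inv_inv] at h1
  rw [mul_inv_rev, mul_assoc z, mul_assoc z, ← mul_assoc _ e⁻¹, ← h1]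
  group

end RootData

end CoxeterTits

/-- Every commensurating endomorphism of a finitely generated infinite irreducible
Coxeter group which is not virtually abelian (equivalently, non-affine) is an inner
automorphism. -/
theorem commensurating_endomorphism_of_coxeter_is_inner
    {B : Type*} [Finite B] (M : CoxeterMatrix B)
    (W : Type*) [Group W] (cs : CoxeterSystem M W) [Infinite W]
    (hirr : CoxeterIrreducible M)
    (hva : ¬ ∃ A : Subgroup W, A.index ≠ 0 ∧ ∀ x y : A, x * y = y * x)
    (φ : W →* W) (hφ : ∀ g : W, CommElem (φ g) g) :
    ∃ w : W, ∀ g : W, φ g = w * g * w⁻¹ := by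
  classical
  cases nonempty_fintype B
  have : Nonempty B := by
    by_contra h
    rw [not_nonempty_iff] at h
    have h1 : (⊤ : Subgroup W) = ⊥ := by
      rw [← cs.subgroup_closure_range_simple, Set.range_eq_empty, Subgroup.closure_empty]
    have := (Subgroup.subsingleton_iff.1 (subsingleton_of_bot_eq_top h1.symm))
    exact not_subsingleton W this
  obtain ⟨μ, v, hv, hvμ, hμ⟩ := CoxeterTits.exists_perron hirr
  refine (CoxeterTits.rootData cs hirr (fun h0 => hva ?_) hv hvμ).exists_eq_conj hva hφ
  subst h0
  refine CoxeterTits.virtually_abelian_of_affine cs hirr (fun x => by simpa using hμ x) hv ?_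
  have h1 : CoxeterTits.form M v = 0 :=
    (Pi.basisFun ℝ B).ext fun i => by
      simpa [CoxeterTits.simpleRoot] using hvμ i
  exact fun x => by rw [h1, LinearMap.zero_apply]
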